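/- Suppose that for all sufficiently large T, every nontrivial zero ρ = β + iγ of the Riemann zeta function with T < γ ≤ 2T satisfies |β − 1/2| < 0.3185/(2 log T). Then, as T → ∞, the number of simple nontrivial zeros ρ = β + iγ of ζ with T < γ ≤ 2T (counted with multiplicity) is at least (0.66666908 + o(1)) · (T/(2π)) log T. -/

import Mathlib

open Filter Topology MeasureTheory Set

/-- The multiplicity of `ρ` as a zero of the Riemann zeta function:
the least `n` such that the `n`-th iterated derivative of `ζ` is nonzero at `ρ`. -/
noncomputable def zetaMult (ρ : ℂ) : ℕ :=
  sInf {n : ℕ | iteratedDeriv n riemannZeta ρ ≠ 0}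

/-- `ρ` is a nontrivial zero of the Riemann zeta function. -/
def IsNontrivialZero (ρ : ℂ) : Prop :=
  riemannZeta ρ = 0 ∧ 0 < ρ.re ∧ ρ.re < 1

/-- The set of nontrivial zeros `ρ = β + iγ` with `T < γ ≤ 2T`. -/
def zeroBand (T : ℝ) : Set ℂ :=
  {ρ | IsNontrivialZero ρ ∧ T < ρ.im ∧ ρ.im ≤ 2 * T}

/-- Number of nontrivial zeros with `T < γ ≤ 2T`, counted with multiplicity. -/
noncomputable def Ntot (T : ℝ) : ℝ :=
  ∑ᶠ ρ ∈ zeroBand T, (zetaMult ρ : ℝ)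

/-- Number of simple nontrivial zeros with `T < γ ≤ 2T`. -/
noncomputable def Nsimple (T : ℝ) : ℝ :=
  ∑ᶠ ρ ∈ {ρ ∈ zeroBand T | zetaMult ρ = 1}, (1 : ℝ)

/-- Number of nontrivial zeros with `T < γ ≤ 2T` on the critical line, with multiplicity. -/
noncomputable def Nline (T : ℝ) : ℝ :=
  ∑ᶠ ρ ∈ {ρ ∈ zeroBand T | ρ.re = 1/2}, (zetaMult ρ : ℝ)

/-- Number of simple critical-line nontrivial zeros with `T < γ ≤ 2T`. -/
noncomputable def NlineSimple (T : ℝ) : ℝ :=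
  ∑ᶠ ρ ∈ {ρ ∈ zeroBand T | ρ.re = 1/2 ∧ zetaMult ρ = 1}, (1 : ℝ)


open Filter Topology MeasureTheory Set

lemma fac_single {g : ℂ → ℂ} (hg : Differentiable ℂ g) (a : ℂ) (hfin : analyticOrderAt g a ≠ ⊤) :
    ∃ g' : ℂ → ℂ, Differentiable ℂ g' ∧ (∀ z, g z = (z - a) ^ (analyticOrderNatAt g a) * g' z) ∧
      g' a ≠ 0 := by
  have han : AnalyticAt ℂ g a := hg.analyticAt a
  obtain ⟨g0, h0, h1, h2⟩ := (han.analyticOrderAt_eq_natCast (n := analyticOrderNatAt g a)).1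
    (by rw [Nat.cast_analyticOrderNatAt hfin])
  set n := analyticOrderNatAt g a
  classical
  refine ⟨Function.update (fun z => g z / (z - a) ^ n) a (g0 a), ?_, ?_, by simpa using h1⟩
  · intro z
    by_cases hz : z = a
    · subst hz
      refine h0.differentiableAt.congr_of_eventuallyEq ?_
      filter_upwards [h2] with w hw
      by_cases hwz : w = z
      · subst hwz; simp
      · rw [Function.update_of_ne hwz, hw, smul_eq_mul, mul_div_cancel_left₀]
        exact pow_ne_zero _ (sub_ne_zero.2 hwz)
    · have : DifferentiableAt ℂ (fun z => g z / (z - a) ^ n) z :=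
        (hg z).div (by fun_prop) (pow_ne_zero _ (sub_ne_zero.2 hz))
      refine this.congr_of_eventuallyEq ?_
      filter_upwards [isOpen_ne.mem_nhds hz] with w hw
      rw [Function.update_of_ne hw]
  · intro z
    by_cases hz : z = a
    · subst hz
      have := h2.self_of_nhds
      simpa using this
    · rw [Function.update_of_ne hz, mul_div_cancel₀]
      exact pow_ne_zero _ (sub_ne_zero.2 hz)

lemma fac_finset {X : ℂ → ℂ} (hX : Differentiable ℂ X) (hfin : ∀ a, analyticOrderAt X a ≠ ⊤)
    (S : Finset ℂ) : ∃ g : ℂ → ℂ, Differentiable ℂ g ∧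
      (∀ z, X z = (∏ ρ ∈ S, (z - ρ) ^ (analyticOrderNatAt X ρ)) * g z) ∧ ∀ ρ ∈ S, g ρ ≠ 0 := by
  classical
  induction S using Finset.induction_on with
  | empty => exact ⟨X, hX, by simp, by simp⟩
  | insert a S ha ih =>
    obtain ⟨g, hg, hXg, hne⟩ := ih
    have hP : AnalyticAt ℂ (fun z => ∏ ρ ∈ S, (z - ρ) ^ (analyticOrderNatAt X ρ)) a := by
      fun_prop
    have hP0 : analyticOrderAt (fun z => ∏ ρ ∈ S, (z - ρ) ^ (analyticOrderNatAt X ρ)) a = 0 := by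
      rw [hP.analyticOrderAt_eq_zero, Finset.prod_ne_zero_iff]
      intro ρ hρ
      exact pow_ne_zero _ (sub_ne_zero.2 (fun h => ha (h ▸ hρ)))
    have hord : analyticOrderAt X a = analyticOrderAt g a := by
      have h1 : X = (fun z => ∏ ρ ∈ S, (z - ρ) ^ (analyticOrderNatAt X ρ)) * g := by
        funext z; exact hXg z
      conv_lhs => rw [h1]
      rw [analyticOrderAt_mul hP (hg.analyticAt a), hP0, zero_add]
    obtain ⟨g', hg', hgg, hne'⟩ := fac_single hg a (hord ▸ hfin a)
    refine ⟨g', hg', ?_, ?_⟩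
    · intro z
      rw [Finset.prod_insert ha, hXg z, hgg z, analyticOrderNatAt, analyticOrderNatAt, hord]
      ring
    · intro ρ hρ
      rcases Finset.mem_insert.1 hρ with rfl | hρ
      · exact hne'
      · intro h0
        apply hne ρ hρ
        rw [hgg, h0, mul_zero]

/-- Growth control for zero free functions. -/
lemma logderiv_diff_bound {g : ℂ → ℂ} (hg : Differentiable ℂ g) {R A : ℝ} (hR : 0 < R) (hA : 0 < A)
    (hz : ∀ z ∈ Metric.ball (0:ℂ) R, g z ≠ 0) (h0 : g 0 = 1)
    (hb : ∀ z ∈ Metric.ball (0:ℂ) R, ‖g z‖ ≤ Real.exp A) {s t : ℂ} (hs : ‖s‖ ≤ R / 8)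
    (ht : ‖t‖ ≤ R / 8) :
    ‖logDeriv g s - logDeriv g t‖ ≤ 128 * A / R ^ 2 * ‖s - t‖ := by
  have hd : DifferentiableOn ℂ (logDeriv g) (Metric.ball 0 R) := by
    intro z hzz
    have h1 : DifferentiableAt ℂ (deriv g) z := (hg.analyticAt z).deriv.differentiableAt
    exact (h1.div (hg z) (hz z hzz)).differentiableWithinAt
  obtain ⟨f0, hf0⟩ := hd.isExactOn_ball
  set f : ℂ → ℂ := fun z => f0 z - f0 0
  have hf : ∀ z ∈ Metric.ball (0:ℂ) R, HasDerivAt f (logDeriv g z) z := by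
    intro z hz
    exact (hf0 z hz).sub_const _
  have hfd : DifferentiableOn ℂ f (Metric.ball 0 R) :=
    fun z hz => (hf z hz).differentiableAt.differentiableWithinAt
  have h0m : (0:ℂ) ∈ Metric.ball (0:ℂ) R := by simpa using hR
  have hexp : ∀ z ∈ Metric.ball (0:ℂ) R, g z = Complex.exp (f z) := by
    have key : ∀ z ∈ Metric.ball (0:ℂ) R, g z * Complex.exp (-f z) = g 0 * Complex.exp (-f 0) := by
      intro z hzz
      refine (convex_ball (0:ℂ) R).is_const_of_fderivWithin_eq_zero (𝕜 := ℂ)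
        (f := fun z => g z * Complex.exp (-f z)) ?_ ?_ hzz h0m
      · intro w hw
        exact ((hg w).mul ((hf w hw).differentiableAt.neg.cexp)).differentiableWithinAt
      · intro w hw
        have h1 : HasDerivAt (fun z => g z * Complex.exp (-f z)) 0 w := by
          refine HasDerivAt.congr_deriv ((hg w).hasDerivAt.mul ((hf w hw).neg.cexp)) ?_
          rw [logDeriv_apply]
          have := hz w hw
          simp; field_simp; ring
        rw [fderivWithin_of_isOpen Metric.isOpen_ball hw]
        have := h1.hasFDerivAt.fderiv
        rw [this]; ext; simp
    intro z hzz
    have := key z hzz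
    simp only [f, h0, sub_self, neg_zero, Complex.exp_zero, mul_one] at this
    rw [Complex.exp_neg] at this
    field_simp [Complex.exp_ne_zero] at this
    simpa [f] using this
  have hre : Set.MapsTo f (Metric.ball 0 R) {z | z.re ≤ A} := by
    intro z hzz
    have := hb z hzz
    rw [hexp z hzz, Complex.norm_exp] at this
    exact Real.exp_le_exp.1 this
  have hfb : ∀ z ∈ Metric.closedBall (0:ℂ) (R/2), ‖f z‖ ≤ 2 * A := by
    intro z hzz
    have hz' : ‖z‖ ≤ R / 2 := by simpa using hzz
    have := Complex.borelCaratheodory_zero hA hfd hre hR (z := z) (by simp; linarith) (by simp [f])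
    refine this.trans ?_
    rw [div_le_iff₀ (by linarith)]
    nlinarith [norm_nonneg z]
  -- bound for f'
  have hf'b : ∀ z ∈ Metric.closedBall (0:ℂ) (R/4), ‖logDeriv g z‖ ≤ 8 * A / R := by
    intro z hzz
    have hz' : ‖z‖ ≤ R / 4 := by simpa using hzz
    have h1 := Complex.norm_deriv_le_of_forall_mem_sphere_norm_le (c := z) (R := R/4) (f := f)
      (C := 2 * A) (by positivity) ?_ ?_
    · rw [(hf z (by simp; linarith)).deriv] at h1
      refine h1.trans (le_of_eq ?_)
      field_simp; ring
    · refine DifferentiableOn.diffContOnCl ?_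
      refine hfd.mono ?_
      rw [closure_ball _ (by positivity)]
      intro w hw
      have h2 : ‖w - z‖ ≤ R/4 := by simpa [dist_eq_norm] using hw
      have : ‖w‖ ≤ ‖w - z‖ + ‖z‖ := by simpa using norm_add_le (w - z) z
      simp; linarith
    · intro w hw
      have h2 : ‖w - z‖ = R/4 := by simpa [dist_eq_norm] using hw
      have : ‖w‖ ≤ ‖w - z‖ + ‖z‖ := by simpa using norm_add_le (w - z) z
      apply hfb; simp; linarith
  have hd2 : ∀ z ∈ Metric.closedBall (0:ℂ) (R/8), ‖deriv (logDeriv g) z‖ ≤ 128 * A / R ^ 2 := by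
    intro z hzz
    have hz' : ‖z‖ ≤ R / 8 := by simpa using hzz
    have h1 := Complex.norm_deriv_le_of_forall_mem_sphere_norm_le (c := z) (R := R/16)
      (f := logDeriv g) (C := 8 * A / R) (by positivity) ?_ ?_
    · refine h1.trans (le_of_eq ?_)
      field_simp; ring
    · refine DifferentiableOn.diffContOnCl ?_
      refine hd.mono ?_
      rw [closure_ball _ (by positivity)]
      intro w hw
      have h2 : ‖w - z‖ ≤ R/16 := by simpa [dist_eq_norm] using hw
      have : ‖w‖ ≤ ‖w - z‖ + ‖z‖ := by simpa using norm_add_le (w - z) z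
      simp; linarith
    · intro w hw
      have h2 : ‖w - z‖ = R/16 := by simpa [dist_eq_norm] using hw
      have : ‖w‖ ≤ ‖w - z‖ + ‖z‖ := by simpa using norm_add_le (w - z) z
      apply hf'b; simp; linarith
  refine (convex_closedBall (0:ℂ) (R/8)).norm_image_sub_le_of_norm_deriv_le (f := logDeriv g) ?_ hd2
    (by simpa using ht) (by simpa using hs)
  intro z hzz
  have hz' : ‖z‖ ≤ R / 8 := by simpa using hzz
  exact (hd z (by simp; linarith)).differentiableAt (Metric.isOpen_ball.mem_nhds (by simp; linarith))


lemma D_finite {X : ℂ → ℂ} (hX : Differentiable ℂ X) (hfin : ∀ a, analyticOrderAt X a ≠ ⊤)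
    (h0 : X 0 = 1) {R A : ℝ} (hR : 0 < R) (hA : 0 < A)
    (hgrow : ∀ z : ℂ, ‖z‖ = 2 * R → ‖X z‖ ≤ Real.exp A) (S : Finset ℂ)
    (hS : ∀ ρ, ρ ∈ S ↔ X ρ = 0 ∧ ‖ρ‖ ≤ R) {s t : ℂ} (hs : ‖s‖ ≤ R / 8) (ht : ‖t‖ ≤ R / 8)
    (hs0 : X s ≠ 0) (ht0 : X t ≠ 0) :
    ‖(logDeriv X s - logDeriv X t) - ∑ ρ ∈ S, (analyticOrderNatAt X ρ : ℂ) *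
      (1 / (s - ρ) - 1 / (t - ρ))‖ ≤ 128 * A / R ^ 2 * ‖s - t‖ := by
  obtain ⟨g0, hg0, hfac, hne⟩ := fac_finset hX hfin S
  set m := fun ρ => analyticOrderNatAt X ρ
  have hρ0 : ∀ ρ ∈ S, ρ ≠ 0 := by
    rintro ρ hρ rfl
    have := ((hS _).1 hρ).1
    rw [h0] at this; exact one_ne_zero this
  set c : ℂ := ∏ ρ ∈ S, (-ρ) ^ m ρ with hc
  have hc0 : c ≠ 0 := Finset.prod_ne_zero_iff.2 fun ρ hρ => pow_ne_zero _ (neg_ne_zero.2 (hρ0 ρ hρ))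
  set g : ℂ → ℂ := fun z => c * g0 z with hgdef
  have hg : Differentiable ℂ g := hg0.const_mul c
  have hg00 : g 0 = 1 := by
    have := hfac 0
    rw [h0] at this
    simp only [zero_sub] at this
    rw [hgdef]; exact this.symm
  have hgn : ∀ z, X z ≠ 0 → g0 z ≠ 0 := by
    intro z hz h; apply hz; rw [hfac, h, mul_zero]
  have hzf : ∀ z ∈ Metric.ball (0:ℂ) R, g z ≠ 0 := by
    intro z hz
    refine mul_ne_zero hc0 ?_
    by_cases hXz : X z = 0
    · exact hne z ((hS z).2 ⟨hXz, by simpa using (Metric.mem_ball.1 hz).le⟩)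
    · exact hgn z hXz
  have hbd : ∀ z ∈ Metric.closedBall (0:ℂ) (2 * R), ‖g z‖ ≤ Real.exp A := by
    intro z hz
    refine Complex.norm_le_of_forall_mem_frontier_norm_le (U := Metric.ball (0:ℂ) (2 * R))
      Metric.isBounded_ball hg.diffContOnCl ?_ ?_
    · intro w hw
      rw [frontier_ball _ (by positivity)] at hw
      have hw' : ‖w‖ = 2 * R := by simpa using hw
      refine le_trans ?_ (hgrow w hw')
      rw [hfac w, norm_mul, norm_mul]
      gcongr
      rw [hc, norm_prod, norm_prod]
      refine Finset.prod_le_prod (fun _ _ => norm_nonneg _) fun ρ hρ => ?_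
      rw [norm_pow, norm_pow, norm_neg]
      have h1 := ((hS ρ).1 hρ).2
      have h2 : ‖w‖ - ‖ρ‖ ≤ ‖w - ρ‖ := norm_sub_norm_le _ _
      gcongr
      linarith
    · rwa [closure_ball _ (by positivity)]
  have hmain := logderiv_diff_bound hg hR hA hzf hg00 (fun z hz => hbd z (by
    have := Metric.mem_ball.1 hz
    simp at this ⊢; linarith)) hs ht
  have hld : ∀ z, X z ≠ 0 → logDeriv X z = (∑ ρ ∈ S, (m ρ : ℂ) * (1 / (z - ρ))) + logDeriv g z := by
    intro z hz
    have hne' : ∀ ρ ∈ S, (z - ρ) ^ m ρ ≠ 0 := by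
      intro ρ hρ
      refine pow_ne_zero _ (sub_ne_zero.2 ?_)
      rintro rfl
      exact hz ((hS _).1 hρ).1
    have h1 : X = fun z => (∏ ρ ∈ S, (z - ρ) ^ m ρ) * g0 z := funext hfac
    have h2 : logDeriv g z = logDeriv g0 z := by
      rw [hgdef, logDeriv_const_mul _ _ hc0]
    rw [h2]
    conv_lhs => rw [h1]
    rw [logDeriv_mul z (Finset.prod_ne_zero_iff.2 hne') (hgn z hz) (by fun_prop) (hg0 z)]
    congr 1
    rw [logDeriv_prod (f := fun ρ w => (w - ρ) ^ m ρ) hne' (by intros; fun_prop)]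
    refine Finset.sum_congr rfl fun ρ hρ => ?_
    rw [logDeriv_fun_pow (by fun_prop)]
    congr 1
    rw [logDeriv_apply]; simp
  rw [hld s hs0, hld t ht0]
  convert hmain using 2
  simp only [mul_sub, Finset.sum_sub_distrib]
  simp only [m]
  ring


/-- The entire function `-s(1-s)Λ(s)`. -/
noncomputable def XX (s : ℂ) : ℂ := 1 - s * (1 - s) * completedRiemannZeta₀ s

lemma XX_diff : Differentiable ℂ XX := by
  unfold XX
  have := differentiable_completedZeta₀
  fun_prop

lemma XX_zero : XX 0 = 1 := by simp [XX]
lemma XX_one : XX 1 = 1 := by simp [XX]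

lemma XX_symm (s : ℂ) : XX (1 - s) = XX s := by
  unfold XX; rw [completedRiemannZeta₀_one_sub]; ring

lemma XX_eq {s : ℂ} (h0 : s ≠ 0) (h1 : s ≠ 1) : XX s = s * (s - 1) * completedRiemannZeta s := by
  rw [completedRiemannZeta_eq, XX]
  have : 1 - s ≠ 0 := sub_ne_zero.2 (Ne.symm h1)
  field_simp
  ring

lemma XX_eq_zeta {s : ℂ} (hs : 0 < s.re) (h1 : s ≠ 1) :
    XX s = s * (s - 1) * Complex.Gammaℝ s * riemannZeta s := by
  have h0 : s ≠ 0 := by rintro rfl; simp at hs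
  rw [XX_eq h0 h1, riemannZeta_def_of_ne_zero h0]
  have := Complex.Gammaℝ_ne_zero_of_re_pos hs
  field_simp

lemma XX_zero_iff (s : ℂ) : XX s = 0 ↔ IsNontrivialZero s := by
  have aux : ∀ s : ℂ, 0 < s.re → XX s = 0 → riemannZeta s = 0 ∧ s.re < 1 := by
    intro s hs h
    have h1 : s ≠ 1 := by rintro rfl; rw [XX_one] at h; exact one_ne_zero h
    have h0 : s ≠ 0 := by rintro rfl; simp at hs
    rw [XX_eq_zeta hs h1] at h
    have h2 := Complex.Gammaℝ_ne_zero_of_re_pos hs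
    have h3 : riemannZeta s = 0 := by
      simpa [h0, sub_ne_zero.2 h1, h2] using h
    refine ⟨h3, ?_⟩
    by_contra hc
    exact riemannZeta_ne_zero_of_one_le_re (not_lt.1 hc) h3
  constructor
  · intro h
    by_cases hs : 0 < s.re
    · obtain ⟨h1, h2⟩ := aux s hs h
      exact ⟨h1, hs, h2⟩
    · have := aux (1 - s) (by simp; linarith) (by rw [XX_symm, h])
      simp at this
      linarith [this.2]
  · rintro ⟨h1, h2, h3⟩
    rw [XX_eq_zeta h2 (by rintro rfl; simp at h3), h1, mul_zero]

lemma XX_order_ne_top (a : ℂ) : analyticOrderAt XX a ≠ ⊤ := by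
  intro h
  rw [analyticOrderAt_eq_top] at h
  have h2 := AnalyticOnNhd.eq_of_eventuallyEq (f := XX) (g := fun _ => 0)
    (fun z _ => XX_diff.analyticAt z) (fun z _ => analyticAt_const) h
  have := congrFun h2 0
  rw [XX_zero] at this
  exact one_ne_zero this

lemma zetaMult_eq {ρ : ℂ} (hρ : IsNontrivialZero ρ) : zetaMult ρ = analyticOrderNatAt XX ρ := by
  obtain ⟨h1, h2, h3⟩ := hρ
  have hne : ρ ≠ 1 := by rintro rfl; simp at h3
  have hne0 : ρ ≠ 0 := by rintro rfl; simp at h2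
  have hz : AnalyticAt ℂ riemannZeta ρ := analyticOn_riemannZeta ρ hne
  have hord : analyticOrderAt XX ρ = analyticOrderAt riemannZeta ρ := by
    set f : ℂ → ℂ := fun s => s * (s - 1) * Complex.Gammaℝ s with hf
    have hopen : IsOpen {s : ℂ | 0 < s.re ∧ s ≠ 1} :=
      (isOpen_lt continuous_const Complex.continuous_re).inter isOpen_ne
    have hnhds : {s : ℂ | 0 < s.re ∧ s ≠ 1} ∈ 𝓝 ρ := hopen.mem_nhds ⟨h2, hne⟩
    have hfa : AnalyticAt ℂ f ρ := by
      refine DifferentiableOn.analyticAt (s := {s : ℂ | 0 < s.re ∧ s ≠ 1}) ?_ hnhds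
      intro s hs
      have hG : DifferentiableAt ℂ Complex.Gammaℝ s := by
        unfold Complex.Gammaℝ
        have : DifferentiableAt ℂ (fun s : ℂ => Complex.Gamma (s / 2)) s := by
          refine DifferentiableAt.comp s (Complex.differentiableAt_Gamma _ ?_) (by fun_prop)
          intro m hm
          have := congrArg Complex.re hm
          simp at this
          have h5 := hs.1
          have : (0:ℝ) ≤ m := Nat.cast_nonneg m
          linarith
        have h6 : DifferentiableAt ℂ (fun s : ℂ => (Real.pi : ℂ) ^ (-s / 2)) s := by
          refine DifferentiableAt.const_cpow (by fun_prop) (Or.inl ?_)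
          exact_mod_cast Real.pi_ne_zero
        exact h6.mul this
      have : DifferentiableAt ℂ f s := by
        rw [hf]; fun_prop
      exact this.differentiableWithinAt
    have hf0 : f ρ ≠ 0 := mul_ne_zero (mul_ne_zero hne0 (sub_ne_zero.2 hne))
      (Complex.Gammaℝ_ne_zero_of_re_pos h2)
    have h4 : XX =ᶠ[𝓝 ρ] f * riemannZeta := by
      filter_upwards [hnhds] with s hs
      exact XX_eq_zeta hs.1 hs.2
    rw [analyticOrderAt_congr h4, analyticOrderAt_mul hfa hz, hfa.analyticOrderAt_eq_zero.2 hf0,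
      zero_add]
  have hfin : analyticOrderAt riemannZeta ρ ≠ ⊤ := hord ▸ XX_order_ne_top ρ
  rw [analyticOrderNatAt, hord]
  set n := (analyticOrderAt riemannZeta ρ).toNat with hn
  have hcast : (n : ℕ∞) = analyticOrderAt riemannZeta ρ := ENat.natCast_toNat hfin
  have key1 := (natCast_le_analyticOrderAt_iff_iteratedDeriv_eq_zero hz (n := n)).1 hcast.le
  have key2 : iteratedDeriv n riemannZeta ρ ≠ 0 := by
    intro h0
    have := (natCast_le_analyticOrderAt_iff_iteratedDeriv_eq_zero hz (n := n + 1)).2 (by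
      intro i hi
      rcases Nat.lt_succ_iff_lt_or_eq.1 hi with h | h
      · exact key1 i h
      · rw [h, h0])
    rw [← hcast] at this
    have := Nat.cast_le.1 this
    omega
  unfold zetaMult
  apply le_antisymm
  · exact Nat.sInf_le key2
  · refine le_csInf ⟨_, key2⟩ fun k hk => ?_
    by_contra hlt
    exact hk (key1 k (not_le.1 hlt))

lemma zeta0_strip : ∃ B : ℝ, 0 ≤ B ∧ ∀ s : ℂ, -1 ≤ s.re → s.re ≤ 2 → ‖completedRiemannZeta₀ s‖ ≤ B := by
  set P := HurwitzZeta.hurwitzEvenFEPair 0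
  have hconv : ∀ s : ℂ, MellinConvergent P.f_modif s :=
    fun s => (P.isStrongFEPair_toStrongFEPair.hasMellin s).1
  have h1 := (hconv (-1/2 : ℝ)).norm
  have h2 := (hconv (1 : ℝ)).norm
  set M : ℝ := (∫ x in Ioi (0:ℝ), ‖(x:ℂ) ^ (((-1/2 : ℝ) : ℂ) - 1) • P.f_modif x‖) +
    ∫ x in Ioi (0:ℝ), ‖(x:ℂ) ^ (((1 : ℝ) : ℂ) - 1) • P.f_modif x‖ with hM
  have hM0 : 0 ≤ M := add_nonneg (integral_nonneg fun _ => norm_nonneg _)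
    (integral_nonneg fun _ => norm_nonneg _)
  refine ⟨M / 2, by positivity, fun s hs1 hs2 => ?_⟩
  have : completedRiemannZeta₀ s = mellin P.f_modif (s / 2) / 2 := rfl
  rw [this, norm_div]
  simp only [RCLike.norm_ofNat]
  gcongr
  rw [mellin, hM, ← integral_add h1 h2]
  refine norm_integral_le_of_norm_le (h1.add h2) ?_
  refine (ae_restrict_iff' measurableSet_Ioi).2 (Eventually.of_forall fun x hx => ?_)
  have hx : 0 < x := hx
  simp only [Pi.add_apply, norm_smul, ← add_mul]
  gcongr
  rw [Complex.norm_cpow_eq_rpow_re_of_pos hx, Complex.norm_cpow_eq_rpow_re_of_pos hx,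
    Complex.norm_cpow_eq_rpow_re_of_pos hx]
  simp only [Complex.sub_re, Complex.one_re, Complex.ofReal_re]
  have h3 : (s / 2).re = s.re / 2 := by
    rw [show (2:ℂ) = ((2:ℝ):ℂ) by norm_num, Complex.div_ofReal_re]
  rw [h3]
  rcases le_total x 1 with h | h
  · have := Real.rpow_le_rpow_of_exponent_ge hx h (show (-1/2 - 1 : ℝ) ≤ s.re / 2 - 1 by linarith)
    exact le_add_of_le_of_nonneg this (Real.rpow_nonneg hx.le _)
  · have := Real.rpow_le_rpow_of_exponent_le h (show s.re / 2 - 1 ≤ (1 - 1 : ℝ) by linarith)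
    exact le_add_of_nonneg_of_le (Real.rpow_nonneg hx.le _) this

lemma norm_Gamma_le {s : ℂ} (hs : 0 < s.re) : ‖Complex.Gamma s‖ ≤ Real.Gamma s.re := by
  rw [Complex.Gamma_eq_integral hs, Real.Gamma_eq_integral hs, Complex.GammaIntegral]
  refine norm_integral_le_of_norm_le (Real.GammaIntegral_convergent hs) ?_
  refine (ae_restrict_iff' measurableSet_Ioi).2 (Eventually.of_forall fun x hx => ?_)
  have hx : 0 < x := hx
  rw [norm_mul, Complex.norm_cpow_eq_rpow_re_of_pos hx]
  simp [Complex.norm_exp]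

lemma Gamma_le_exp {x : ℝ} (hx : 1 ≤ x) : Real.Gamma x ≤ Real.exp ((x + 1) * Real.log (x + 1)) := by
  have h1 : Real.Gamma x ≤ Real.Gamma (x + 1) := by
    rw [Real.Gamma_add_one (by linarith)]
    have := Real.Gamma_pos_of_pos (show 0 < x by linarith)
    nlinarith
  have h2 : Real.Gamma (x + 1) ≤ Real.Gamma (⌈x⌉₊ + 1) := by
    refine Real.Gamma_strictMonoOn_Ici.monotoneOn (by simp; linarith) ?_ ?_
    · have := Nat.le_ceil x
      simp; linarith
    · have := Nat.le_ceil x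
      linarith
  rw [Real.Gamma_nat_eq_factorial] at h2
  have h3 : ((⌈x⌉₊.factorial : ℕ) : ℝ) ≤ (⌈x⌉₊ : ℝ) ^ ⌈x⌉₊ := by
    exact_mod_cast Nat.factorial_le_pow _
  have h4 : (⌈x⌉₊ : ℝ) ≤ x + 1 := (Nat.ceil_lt_add_one (by linarith)).le
  have h5 : (⌈x⌉₊ : ℝ) ^ ⌈x⌉₊ ≤ (x + 1) ^ ⌈x⌉₊ := by gcongr
  have h6 : (x + 1) ^ ⌈x⌉₊ ≤ (x + 1) ^ (x + 1) := by
    rw [← Real.rpow_natCast]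
    exact Real.rpow_le_rpow_of_exponent_le (by linarith) h4
  rw [Real.rpow_def_of_pos (by linarith), mul_comm] at h6
  linarith

lemma zeta_bound : ∃ B : ℝ, 0 ≤ B ∧ ∀ s : ℂ, 2 ≤ s.re → ‖riemannZeta s‖ ≤ B := by
  have hs : Summable fun n : ℕ => 1 / ((n : ℝ) + 1) ^ 2 := by
    have := (summable_nat_add_iff 1).2 (Real.summable_one_div_nat_pow.2 (show 1 < 2 by norm_num))
    simpa using this
  refine ⟨∑' n : ℕ, 1 / ((n : ℝ) + 1) ^ 2, tsum_nonneg fun _ => by positivity, fun s hs2 => ?_⟩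
  rw [zeta_eq_tsum_one_div_nat_add_one_cpow (by linarith)]
  refine tsum_of_norm_bounded hs.hasSum fun n => ?_
  rw [norm_div, norm_one]
  have h1 : ((n : ℂ) + 1) = (((n : ℝ) + 1 : ℝ) : ℂ) := by push_cast; rfl
  rw [h1, Complex.norm_cpow_eq_rpow_re_of_pos (by positivity), ← Real.rpow_natCast]
  gcongr
  · linarith [(Nat.cast_nonneg n : (0:ℝ) ≤ n)]
  · exact_mod_cast hs2

lemma XX_growth : ∃ K : ℝ, 0 < K ∧ ∀ z : ℂ,
    ‖XX z‖ ≤ Real.exp (K + (‖z‖ + 4) * Real.log (‖z‖ + 2)) := by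
  obtain ⟨B, hB, hB'⟩ := zeta0_strip
  obtain ⟨D, hD, hD'⟩ := zeta_bound
  have aux : ∀ z : ℂ, 1 / 2 ≤ z.re →
      ‖XX z‖ ≤ (B + D + 1) * ((‖z‖ + 1) ^ 2 * Real.exp ((‖z‖ + 1) * Real.log (‖z‖ + 1))) := by
    intro z hz
    have hzn := norm_nonneg z
    have hl : 0 ≤ Real.log (‖z‖ + 1) := Real.log_nonneg (by linarith)
    have he : 1 ≤ Real.exp ((‖z‖ + 1) * Real.log (‖z‖ + 1)) := Real.one_le_exp (by positivity)
    have h1z : ‖1 - z‖ ≤ ‖z‖ + 1 := by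
      have := norm_sub_le (1:ℂ) z
      simp at this; linarith
    set E := Real.exp ((‖z‖ + 1) * Real.log (‖z‖ + 1))
    rcases le_total z.re 2 with h | h
    · have h1 := hB' z (by linarith) h
      have h2 : ‖XX z‖ ≤ 1 + (‖z‖ + 1) ^ 2 * B := by
        unfold XX
        refine (norm_sub_le _ _).trans ?_
        rw [norm_mul, norm_mul, norm_one]
        have : ‖z‖ * ‖1 - z‖ ≤ (‖z‖ + 1) ^ 2 := by nlinarith
        gcongr
      have h3 : (1:ℝ) ≤ (‖z‖ + 1) ^ 2 := by nlinarith
      have h4 : (1 + (‖z‖ + 1) ^ 2 * B) ≤ (B + D + 1) * (‖z‖ + 1) ^ 2 := by nlinarith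
      calc _ ≤ _ := h2
        _ ≤ _ := h4
        _ ≤ (B + D + 1) * (‖z‖ + 1) ^ 2 * E := le_mul_of_one_le_right (by positivity) he
        _ = _ := by ring
    · have h1 := hD' z h
      rw [XX_eq_zeta (by linarith) (by rintro rfl; norm_num at h), norm_mul, norm_mul, norm_mul]
      have h3 : (z / 2).re = z.re / 2 := by
        rw [show (2:ℂ) = ((2:ℝ):ℂ) by norm_num, Complex.div_ofReal_re]
      have hG : ‖Complex.Gammaℝ z‖ ≤ E := by
        rw [Complex.Gammaℝ, norm_mul]
        have h4 : ‖(Real.pi : ℂ) ^ (-z / 2)‖ ≤ 1 := by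
          rw [Complex.norm_cpow_eq_rpow_re_of_pos Real.pi_pos]
          apply Real.rpow_le_one_of_one_le_of_nonpos
          · linarith [Real.pi_gt_three]
          · rw [neg_div, Complex.neg_re, h3]; linarith
        have h5 : ‖Complex.Gamma (z / 2)‖ ≤ E := by
          refine (norm_Gamma_le (by rw [h3]; linarith)).trans ?_
          refine (Gamma_le_exp (by rw [h3]; linarith)).trans ?_
          rw [h3]
          apply Real.exp_le_exp.2
          have := Complex.re_le_norm z
          have h7 : Real.log (z.re / 2 + 1) ≤ Real.log (‖z‖ + 1) :=
            Real.log_le_log (by linarith) (by linarith)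
          have h8 : 0 ≤ Real.log (z.re / 2 + 1) := Real.log_nonneg (by linarith)
          gcongr
          linarith
        calc _ ≤ 1 * E := by gcongr
          _ = E := one_mul _
      have h1z' : ‖z - 1‖ ≤ ‖z‖ + 1 := by rw [norm_sub_rev]; exact h1z
      calc ‖z‖ * ‖z - 1‖ * ‖Complex.Gammaℝ z‖ * ‖riemannZeta z‖ ≤
          (‖z‖ + 1) * (‖z‖ + 1) * E * (B + D + 1) := by gcongr <;> linarith
        _ = _ := by ring
  refine ⟨Real.log (B + D + 2), Real.log_pos (by linarith), ?_⟩
  have aux2 : ∀ z w : ℂ, ‖w‖ ≤ ‖z‖ + 1 → 1/2 ≤ w.re →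
      ‖XX w‖ ≤ Real.exp (Real.log (B + D + 2) + (‖z‖ + 4) * Real.log (‖z‖ + 2)) := by
    intro z w h1 h2
    refine (aux w h2).trans ?_
    have hw := norm_nonneg w
    have hl : Real.log (‖w‖ + 1) ≤ Real.log (‖z‖ + 2) := Real.log_le_log (by linarith) (by linarith)
    have hl0 : 0 ≤ Real.log (‖w‖ + 1) := Real.log_nonneg (by linarith)
    rw [Real.exp_add, Real.exp_log (by linarith)]
    have h3 : (‖w‖ + 1) ^ 2 = Real.exp (2 * Real.log (‖w‖ + 1)) := by
      rw [two_mul, Real.exp_add, Real.exp_log (by linarith)]; ring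
    rw [h3, ← Real.exp_add]
    gcongr
    · linarith
    · nlinarith
  intro z
  rcases le_total (1/2) z.re with h | h
  · exact aux2 z z (by linarith) h
  · rw [← XX_symm]
    refine aux2 z (1 - z) ?_ (by simp; linarith)
    have := norm_sub_le (1:ℂ) z
    simp at this; linarith


lemma slit_of_re {z : ℂ} (hz : 0 < z.re) : z ∈ Complex.slitPlane := Or.inl hz

lemma norm_add_nat_ge {z : ℂ} (hz : 0 < z.re) {x : ℝ} (hx : 0 ≤ x) :
    (‖z‖ + x) ^ 2 ≤ 2 * ‖z + x‖ ^ 2 := by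
  have h1 : ‖z‖ ^ 2 = z.re ^ 2 + z.im ^ 2 := by rw [Complex.sq_norm, Complex.normSq_apply]; ring
  have h2 : ‖z + x‖ ^ 2 = (z.re + x) ^ 2 + z.im ^ 2 := by
    rw [Complex.sq_norm, Complex.normSq_apply]; simp; ring
  nlinarith [sq_nonneg (‖z‖ - x), mul_nonneg hz.le hx]

lemma log_step {z : ℂ} (hz : 0 < z.re) :
    ‖Complex.log (z + 1) - Complex.log z - 1 / z‖ ≤ 1 / ‖z‖ ^ 2 := by
  have hz0 : z ≠ 0 := by rintro rfl; simp at hz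
  have key := norm_image_sub_le_of_norm_deriv_le_segment_01' (E := ℂ)
    (f := fun τ : ℝ => Complex.log (z + τ) - τ / z) (f' := fun τ : ℝ => 1 / (z + τ) - 1 / z)
    (C := 1 / ‖z‖ ^ 2) ?_ ?_
  · rw [sub_right_comm]
    simpa using key
  · intro τ hτ
    apply HasDerivAt.hasDerivWithinAt
    have h1 : HasDerivAt (fun τ : ℝ => z + (τ : ℂ)) 1 τ := by
      simpa using (Complex.ofRealCLM.hasDerivAt (x := τ)).const_add z
    have h2 := h1.clog_real (x := τ) (slit_of_re (by simp; linarith [hτ.1]))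
    have h3 : HasDerivAt (fun τ : ℝ => (τ : ℂ) / z) (1 / z) τ := by
      simpa using (Complex.ofRealCLM.hasDerivAt (x := τ)).div_const z
    exact h2.sub h3
  · intro τ hτ
    have h4 : ‖z‖ ≤ ‖z + τ‖ := by
      rw [← sq_le_sq₀ (norm_nonneg _) (norm_nonneg _), Complex.sq_norm, Complex.sq_norm,
        Complex.normSq_apply, Complex.normSq_apply]
      simp
      nlinarith [hτ.1]
    have hn : 0 < ‖z‖ := norm_pos_iff.2 hz0
    have h5 : z + τ ≠ 0 := norm_pos_iff.1 (by linarith)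
    have : 1 / (z + τ) - 1 / z = -τ / ((z + τ) * z) := by field_simp; ring
    rw [this, norm_div, norm_mul, norm_neg, Complex.norm_real, Real.norm_eq_abs, abs_of_nonneg hτ.1, sq]
    gcongr
    exact hτ.2.le

/-- terms of the logarithm of the Gamma function -/
noncomputable def lgt (k : ℕ) (z : ℂ) : ℂ :=
  z * (Real.log (k + 2) - Real.log (k + 1)) - (Complex.log (z + (k + 1)) - Real.log (k + 1))

lemma lgt_exp (n : ℕ) {z : ℂ} (hz : 0 < z.re) :
    Complex.exp (-Complex.log z + ∑ k ∈ Finset.range n, lgt k z) =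
      (((n + 1 : ℕ) : ℝ) : ℂ) ^ z * n.factorial / ∏ j ∈ Finset.range (n + 1), (z + j) := by
  have hz0 : z ≠ 0 := by rintro rfl; simp at hz
  induction n with
  | zero => simp [Complex.exp_neg, Complex.exp_log hz0]
  | succ n ih =>
    rw [Finset.sum_range_succ, ← add_assoc, Complex.exp_add, ih, Finset.prod_range_succ _ (n + 1)]
    have h1 : z + ((n : ℂ) + 1) ≠ 0 := by
      intro h
      have := congrArg Complex.re h
      simp at this
      have h5 : (0:ℝ) ≤ n := Nat.cast_nonneg n
      linarith
    have hpos : (0:ℝ) < n + 1 := by positivity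
    have hpos2 : (0:ℝ) < n + 2 := by positivity
    have h2 : Complex.exp (lgt n z) =
        ((n + 2 : ℝ) : ℂ) ^ z / ((n + 1 : ℝ) : ℂ) ^ z * ((n : ℂ) + 1) / (z + (n + 1)) := by
      unfold lgt
      rw [Complex.exp_sub, Complex.exp_sub, Complex.exp_log h1, ← Complex.ofReal_exp,
        Real.exp_log hpos, Complex.cpow_def_of_ne_zero (by exact_mod_cast hpos2.ne'),
        Complex.cpow_def_of_ne_zero (by exact_mod_cast hpos.ne'), ← Complex.exp_sub,
        ← Complex.ofReal_log hpos.le, ← Complex.ofReal_log hpos2.le]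
      rw [show z * ((Real.log (n + 2) : ℂ) - Real.log (n + 1)) = Real.log (n + 2) * z - Real.log (n+1) * z by ring]
      push_cast
      field_simp
    rw [h2]
    have h3 : ((n + 1 : ℝ) : ℂ) ^ z ≠ 0 := by
      rw [Complex.cpow_ne_zero_iff]; left; exact_mod_cast hpos.ne'
    have h4 : (∏ j ∈ Finset.range (n + 1), (z + (j : ℂ))) ≠ 0 := by
      refine Finset.prod_ne_zero_iff.2 fun j _ h => ?_
      have := congrArg Complex.re h
      simp at this
      have h5 : (0:ℝ) ≤ j := Nat.cast_nonneg j
      linarith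
    rw [Nat.factorial_succ]
    push_cast at h3 h1 ⊢
    rw [show (n : ℂ) + 1 + 1 = n + 2 by ring]
    field_simp

lemma lgt_deriv (k : ℕ) {z : ℂ} (hz : 0 < z.re) : HasDerivAt (lgt k)
    ((Real.log (k + 2) - Real.log (k + 1)) - 1 / (z + (k + 1))) z := by
  have h1 : HasDerivAt (fun z : ℂ => z + ((k : ℂ) + 1)) 1 z := (hasDerivAt_id z).add_const _
  have h2 := h1.clog (slit_of_re (by simp; positivity))
  have h3 := ((hasDerivAt_id z).mul_const ((Real.log (k + 2) : ℂ) - Real.log (k + 1)))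
  have h4 := h3.sub (h2.sub_const (Real.log (k + 1) : ℂ))
  simp only [one_mul] at h4
  exact h4

lemma lgt_deriv_bound (k : ℕ) {z : ℂ} (hz : 0 < z.re) :
    ‖((Real.log (k + 2) - Real.log (k + 1)) - 1 / (z + (k + 1)) : ℂ)‖ ≤ (1 + ‖z‖) * (1 / ((k:ℝ) + 1) ^ 2) := by
  have h1 := log_step (z := ((k + 1 : ℝ) : ℂ)) (by simp; positivity)
  have hk : (0:ℝ) < k + 1 := by positivity
  have hk2 : (0:ℝ) < k + 2 := by positivity
  have e1 : Complex.log (((k + 1 : ℝ) : ℂ) + 1) = Real.log (k + 2) := by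
    rw [Complex.ofReal_log hk2.le]; congr 1; push_cast; ring
  rw [e1, ← Complex.ofReal_log hk.le, Complex.norm_real, Real.norm_eq_abs, abs_of_pos hk] at h1
  have hkc : ((k : ℂ) + 1) ≠ 0 := by exact_mod_cast hk.ne'
  have hzk : (k + 1 : ℝ) ≤ ‖z + (k + 1)‖ := by
    refine le_trans ?_ (Complex.re_le_norm _)
    simp; linarith
  have hzk0 : z + ((k : ℂ) + 1) ≠ 0 := norm_pos_iff.1 (by linarith)
  have e2 : ((Real.log (k + 2) - Real.log (k + 1)) - 1 / (z + (k + 1)) : ℂ) =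
      ((Real.log (k + 2) - Real.log (k + 1)) - 1 / ((k + 1 : ℝ) : ℂ)) + z / (((k:ℂ) + 1) * (z + (k + 1))) := by
    push_cast; field_simp; ring
  rw [e2]
  refine (norm_add_le _ _).trans ?_
  rw [add_mul 1 ‖z‖, one_mul]
  refine add_le_add h1 ?_
  rw [norm_div, norm_mul, mul_one_div, sq]
  have e3 : ‖(k:ℂ) + 1‖ = k + 1 := by
    rw [show (k:ℂ) + 1 = ((k + 1 : ℝ) : ℂ) by push_cast; rfl, Complex.norm_real, Real.norm_eq_abs, abs_of_pos hk]
  rw [e3]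
  gcongr

lemma summable_sq1 : Summable fun k : ℕ => 1 / ((k:ℝ) + 1) ^ 2 := by
  have := (summable_nat_add_iff 1).2 (Real.summable_one_div_nat_pow.2 (show 1 < 2 by norm_num))
  simpa using this

lemma digamma_eq {z : ℂ} (hz : 0 < z.re) : logDeriv Complex.Gamma z =
    -1 / z + ∑' k : ℕ, ((Real.log (k + 2) - Real.log (k + 1)) - 1 / (z + (k + 1)) : ℂ) := by
  set U : Set ℂ := {z | 0 < z.re} ∩ Metric.ball 0 (‖z‖ + 2) with hU
  have hUo : IsOpen U := (isOpen_lt continuous_const Complex.continuous_re).inter Metric.isOpen_ball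
  have hUc : IsPreconnected U :=
    ((convex_halfSpace_re_gt 0).inter (convex_ball _ _)).isPreconnected
  have hzU : z ∈ U := ⟨hz, by simp⟩
  have h1U : (1:ℂ) ∈ U := ⟨by simp, by simp only [Metric.mem_ball, dist_zero_right, norm_one]; linarith [norm_nonneg z]⟩
  have hsum : Summable fun k : ℕ => (1 + (‖z‖ + 2)) * (1 / ((k:ℝ) + 1) ^ 2) :=
    summable_sq1.mul_left _
  have hd : ∀ n, ∀ y ∈ U, HasDerivAt (lgt n)
    ((Real.log (n + 2) - Real.log (n + 1)) - 1 / (y + (n + 1))) y := fun n y hy => lgt_deriv n hy.1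
  have hb : ∀ (n : ℕ), ∀ y ∈ U,
    ‖((Real.log (n + 2) - Real.log (n + 1)) - 1 / (y + (n + 1)) : ℂ)‖ ≤
      (1 + (‖z‖ + 2)) * (1 / ((n:ℝ) + 1) ^ 2) := by
    intro n y hy
    refine (lgt_deriv_bound n hy.1).trans ?_
    have : ‖y‖ < ‖z‖ + 2 := by simpa using hy.2
    gcongr
  have h0 : Summable fun n => lgt n 1 := by
    have : (fun n => lgt n 1) = fun _ => 0 := by
      ext n
      have hk2 : (0:ℝ) ≤ n + 2 := by positivity
      unfold lgt
      rw [Complex.ofReal_log hk2]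
      push_cast
      rw [show (1:ℂ) + (n + 1) = n + 2 by ring]; ring
    rw [this]; exact summable_zero
  have key : ∀ y ∈ U, HasDerivAt (fun y => ∑' n, lgt n y)
      (∑' n : ℕ, ((Real.log (n + 2) - Real.log (n + 1)) - 1 / (y + (n + 1)) : ℂ)) y := fun y hy =>
    hasDerivAt_tsum_of_isPreconnected hsum hUo hUc hd hb h1U h0 hy
  have hexp : ∀ y ∈ U, Complex.exp (-Complex.log y + ∑' n, lgt n y) = Complex.Gamma y := by
    intro y hy
    have hs : Summable fun n => lgt n y :=
      summable_of_summable_hasDerivAt_of_isPreconnected hsum hUo hUc hd hb h1U h0 hy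
    have t1 := ((Complex.continuous_exp.tendsto _).comp
      ((hs.hasSum.tendsto_sum_nat).const_add (-Complex.log y)))
    have t2 := Complex.GammaSeq_tendsto_Gamma y
    have t3 : Tendsto (fun n : ℕ => Complex.GammaSeq y (n + 1) * ((y + (n + 1)) / (n + 1))) atTop
        (𝓝 (Complex.Gamma y * 1)) := by
      refine ((tendsto_add_atTop_iff_nat 1).2 t2).mul ?_
      have e : ∀ n : ℕ, y * (1 / ((n:ℝ) + 1) : ℝ) + 1 = (y + (n + 1)) / ((n:ℂ) + 1) := by
        intro n
        have : ((n:ℂ) + 1) ≠ 0 := by exact_mod_cast Nat.succ_ne_zero n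
        push_cast
        field_simp
      have t4 : Tendsto (fun n : ℕ => y * (1 / ((n:ℝ) + 1) : ℝ) + 1) atTop (𝓝 (y * (0:ℝ) + 1)) :=
        ((Complex.continuous_ofReal.tendsto _).comp tendsto_one_div_add_atTop_nhds_zero_nat).const_mul y |>.add_const 1
      simp only [e, Complex.ofReal_zero, mul_zero, zero_add] at t4
      exact t4
    rw [mul_one] at t3
    refine tendsto_nhds_unique t1 (t3.congr fun n => ?_)
    simp only [Function.comp]
    rw [lgt_exp n hy.1, Complex.GammaSeq, Finset.prod_range_succ _ (n + 1), Nat.factorial_succ]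
    have h4 : y + ((n:ℂ) + 1) ≠ 0 := by
      intro h
      have := congrArg Complex.re h
      simp at this
      have h5 : (0:ℝ) ≤ n := Nat.cast_nonneg n
      have := hy.1
      simp only [mem_ofPred_eq] at this
      linarith
    have : ((n:ℂ) + 1) ≠ 0 := by exact_mod_cast Nat.succ_ne_zero n
    push_cast
    field_simp
  have hz0 : z ≠ 0 := by rintro rfl; simp at hz
  have hder : HasDerivAt (fun y => Complex.exp (-Complex.log y + ∑' n, lgt n y))
      (Complex.exp (-Complex.log z + ∑' n, lgt n z) * (-z⁻¹ +
        ∑' n : ℕ, ((Real.log (n + 2) - Real.log (n + 1)) - 1 / (z + (n + 1)) : ℂ))) z :=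
    ((Complex.hasDerivAt_log (slit_of_re hz)).neg.add (key z hzU)).cexp
  have hev : Complex.Gamma =ᶠ[𝓝 z] fun y => Complex.exp (-Complex.log y + ∑' n, lgt n y) := by
    filter_upwards [hUo.mem_nhds hzU] with y hy
    exact (hexp y hy).symm
  rw [logDeriv_apply, hev.deriv_eq, hder.deriv, ← hexp z hzU,
    mul_div_cancel_left₀ _ (Complex.exp_ne_zero _)]
  ring

lemma digamma_bound {z : ℂ} (hz : 1 / 2 ≤ z.re) :
    ‖logDeriv Complex.Gamma z - Complex.log z‖ ≤ 6 / ‖z‖ := by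
  have hz' : 0 < z.re := by linarith
  have hn : 1 / 2 ≤ ‖z‖ := hz.trans (Complex.re_le_norm z)
  have hz0 : z ≠ 0 := norm_pos_iff.1 (by linarith)
  have hs : Summable fun k : ℕ => ((Real.log (k + 2) - Real.log (k + 1)) - 1 / (z + (k + 1)) : ℂ) :=
    Summable.of_norm_bounded (summable_sq1.mul_left _) fun k => lgt_deriv_bound k hz'
  have t1 := (hs.hasSum.tendsto_sum_nat).const_add (-1 / z)
  rw [← digamma_eq hz'] at t1
  have t2 : Tendsto (fun n : ℕ => Complex.log (z + (n + 1)) - Real.log (n + 1)) atTop (𝓝 0) := by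
    rw [tendsto_zero_iff_norm_tendsto_zero]
    have t4 : Tendsto (fun n : ℕ => ‖Complex.log (1 + z * (1 / ((n:ℝ) + 1) : ℝ))‖) atTop (𝓝 0) := by
      have t5 : Tendsto (fun n : ℕ => 1 + z * (1 / ((n:ℝ) + 1) : ℝ)) atTop (𝓝 (1 + z * (0:ℝ))) :=
        ((Complex.continuous_ofReal.tendsto _).comp tendsto_one_div_add_atTop_nhds_zero_nat).const_mul z |>.const_add 1
      simp only [Complex.ofReal_zero, mul_zero, add_zero] at t5
      have := (t5.clog (by simp)).norm
      simpa using this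
    refine t4.congr fun n => ?_
    have hpos : (0:ℝ) < n + 1 := by positivity
    have hc : ((n:ℂ) + 1) ≠ 0 := by exact_mod_cast hpos.ne'
    congr 1
    have h7 : (1 + z * ((1 / ((n:ℝ) + 1) : ℝ) : ℂ)) ≠ 0 := by
      intro h
      have := congrArg Complex.re h
      rw [Complex.add_re, Complex.re_mul_ofReal] at this
      simp at this
      have : 0 < z.re * ((n:ℝ) + 1)⁻¹ := by positivity
      linarith
    have e : z + (n + 1) = ((n + 1 : ℝ) : ℂ) * (1 + z * ((1 / ((n:ℝ) + 1) : ℝ) : ℂ)) := by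
      push_cast; field_simp; ring
    rw [e, Complex.log_ofReal_mul hpos h7]
    ring
  have t3 := (t1.add t2).sub_const (Complex.log z)
  rw [add_zero] at t3
  refine le_of_tendsto t3.norm (Eventually.of_forall fun n => ?_)
  have e : (-1 / z + ∑ k ∈ Finset.range n, ((Real.log (k + 2) - Real.log (k + 1)) - 1 / (z + (k + 1)) : ℂ)) +
      (Complex.log (z + (n + 1)) - Real.log (n + 1)) - Complex.log z =
      ∑ k ∈ Finset.range (n + 1), (Complex.log (z + k + 1) - Complex.log (z + k) - 1 / (z + k)) := by
    induction n with
    | zero => simp; ring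
    | succ n ih =>
      rw [Finset.sum_range_succ _ (n + 1), ← ih, Finset.sum_range_succ]
      push_cast
      rw [show ((n:ℝ) + 1 + 1) = n + 2 by ring, show z + ((n:ℂ) + 1) + 1 = z + (n + 1 + 1) by ring]
      ring
  rw [e]
  refine (norm_sum_le _ _).trans ?_
  have hpos : 0 < ‖z‖ := by linarith
  have hstep : ∀ k : ℕ, ‖Complex.log (z + k + 1) - Complex.log (z + k) - 1 / (z + k)‖ ≤
      6 * (1 / (‖z‖ + k) - 1 / (‖z‖ + k + 1)) := by
    intro k
    have hk : (0:ℝ) ≤ k := Nat.cast_nonneg k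
    refine (log_step (z := z + k) (by simp; linarith)).trans ?_
    have h1 := norm_add_nat_ge hz' hk
    rw [Complex.ofReal_natCast] at h1
    have h2 : 1 / (‖z‖ + k) - 1 / (‖z‖ + k + 1) = 1 / ((‖z‖ + k) * (‖z‖ + k + 1)) := by field_simp; ring
    rw [h2, mul_one_div, div_le_div_iff₀ (by nlinarith [sq_nonneg (‖z‖ + k)]) (by positivity)]
    nlinarith
  refine (Finset.sum_le_sum fun k _ => hstep k).trans ?_
  rw [← Finset.mul_sum]
  have tel : ∑ k ∈ Finset.range (n + 1), (1 / (‖z‖ + k) - 1 / (‖z‖ + k + 1)) = 1 / ‖z‖ - 1 / (‖z‖ + (n + 1)) := by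
    have := Finset.sum_range_sub' (fun k : ℕ => 1 / (‖z‖ + (k:ℝ))) (n + 1)
    simp only [Nat.cast_add, Nat.cast_one, Nat.cast_zero, add_zero, ← add_assoc] at this ⊢
    exact this
  rw [tel]
  have : 0 ≤ 1 / (‖z‖ + (n + 1)) := by positivity
  rw [show 6 / ‖z‖ = 6 * (1 / ‖z‖) by ring]
  nlinarith


/-- archimedean part of the logarithmic derivative -/
noncomputable def Gpart (s : ℂ) : ℂ :=
  1 / s + 1 / (s - 1) - Real.log Real.pi / 2 + logDeriv Complex.Gamma (s / 2) / 2

/-- Dirichlet series of von Mangoldt -/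
noncomputable def LLam (s : ℂ) : ℂ := LSeries (fun n => (ArithmeticFunction.vonMangoldt n : ℂ)) s

lemma half_re (s : ℂ) : (s / 2).re = s.re / 2 := by
  rw [show (2:ℂ) = ((2:ℝ):ℂ) by norm_num, Complex.div_ofReal_re]

lemma gamma_diffAt {s : ℂ} (hs : 0 < s.re) : DifferentiableAt ℂ Complex.Gamma s := by
  refine Complex.differentiableAt_Gamma _ ?_
  intro m hm
  have := congrArg Complex.re hm
  simp at this
  have h5 : (0:ℝ) ≤ m := Nat.cast_nonneg m
  linarith

lemma logDeriv_XX {s : ℂ} (hs : 1 < s.re) : logDeriv XX s = Gpart s - LLam s := by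
  have h0 : s ≠ 0 := by rintro rfl; simp at hs; linarith
  have h1 : s ≠ 1 := by rintro rfl; simp at hs
  have h1' : s - 1 ≠ 0 := sub_ne_zero.2 h1
  have hs2 : 0 < (s / 2).re := by rw [half_re]; linarith
  have hev : XX =ᶠ[𝓝 s] fun s => ((s * (s - 1)) * (((Real.pi : ℂ) ^ (-s / 2)) * Complex.Gamma (s / 2))) * riemannZeta s := by
    have hopen : IsOpen {s : ℂ | 0 < s.re ∧ s ≠ 1} :=
      (isOpen_lt continuous_const Complex.continuous_re).inter isOpen_ne
    filter_upwards [hopen.mem_nhds ⟨by linarith, h1⟩] with z hz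
    rw [XX_eq_zeta hz.1 hz.2, Complex.Gammaℝ]
  have hpi : (Real.pi : ℂ) ≠ 0 := by exact_mod_cast Real.pi_ne_zero
  have d1 : HasDerivAt (fun s : ℂ => s * (s - 1)) (1 * (s - 1) + s * 1) s :=
    (hasDerivAt_id s).mul ((hasDerivAt_id s).sub_const 1)
  have d2 : HasDerivAt (fun s : ℂ => (Real.pi : ℂ) ^ (-s / 2))
      ((Real.pi : ℂ) ^ (-s / 2) * Complex.log Real.pi * (-1 / 2)) s :=
    ((hasDerivAt_id s).neg.div_const 2).const_cpow (Or.inl hpi)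
  have d3 : DifferentiableAt ℂ (fun s : ℂ => Complex.Gamma (s / 2)) s :=
    DifferentiableAt.comp s (gamma_diffAt hs2) (by fun_prop)
  have d4 : DifferentiableAt ℂ riemannZeta s := differentiableAt_riemannZeta h1
  have n1 : s * (s - 1) ≠ 0 := mul_ne_zero h0 h1'
  have n2 : (Real.pi : ℂ) ^ (-s / 2) ≠ 0 := by rw [Complex.cpow_ne_zero_iff]; exact Or.inl hpi
  have n3 : Complex.Gamma (s / 2) ≠ 0 := Complex.Gamma_ne_zero_of_re_pos hs2
  have n4 : riemannZeta s ≠ 0 := riemannZeta_ne_zero_of_one_le_re hs.le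
  have e0 : logDeriv XX s = logDeriv (fun s => ((s * (s - 1)) * (((Real.pi : ℂ) ^ (-s / 2)) * Complex.Gamma (s / 2))) * riemannZeta s) s := by
    rw [logDeriv_apply, logDeriv_apply, hev.deriv_eq, hev.eq_of_nhds]
  rw [e0, logDeriv_mul (f := fun s => (s * (s - 1)) * (((Real.pi : ℂ) ^ (-s / 2)) * Complex.Gamma (s / 2))) s (mul_ne_zero n1 (mul_ne_zero n2 n3)) n4
      (d1.differentiableAt.mul (d2.differentiableAt.mul d3)) d4,
    logDeriv_mul (f := fun s => s * (s - 1))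
      (g := fun s => ((Real.pi : ℂ) ^ (-s / 2)) * Complex.Gamma (s / 2)) s n1 (mul_ne_zero n2 n3) d1.differentiableAt (d2.differentiableAt.mul d3),
    logDeriv_mul (f := fun s => ((Real.pi : ℂ) ^ (-s / 2))) (g := fun s => Complex.Gamma (s / 2)) s n2 n3 d2.differentiableAt d3]
  have e1 : logDeriv (fun s : ℂ => s * (s - 1)) s = 1 / s + 1 / (s - 1) := by
    rw [logDeriv_apply, d1.deriv]; field_simp
  have e2 : logDeriv (fun s : ℂ => (Real.pi : ℂ) ^ (-s / 2)) s = -Real.log Real.pi / 2 := by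
    rw [logDeriv_apply, d2.deriv, Complex.ofReal_log Real.pi_pos.le]; field_simp
  have e3 : logDeriv (fun s : ℂ => Complex.Gamma (s / 2)) s = logDeriv Complex.Gamma (s / 2) / 2 := by
    have := logDeriv_comp (f := Complex.Gamma) (g := fun s : ℂ => s / 2) (x := s) (gamma_diffAt hs2) (by fun_prop)
    rw [Function.comp_def] at this
    rw [this]
    have : deriv (fun s : ℂ => s / 2) s = 1 / 2 := ((hasDerivAt_id s).div_const 2).deriv
    rw [this]; ring
  have e4 : logDeriv riemannZeta s = - LLam s := by
    rw [LLam, ArithmeticFunction.LSeries_vonMangoldt_eq_deriv_riemannZeta_div hs, logDeriv_apply]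
    ring
  rw [e1, e2, e3, e4, Gpart]
  ring

lemma LLam_bound : ∃ B : ℝ, 0 ≤ B ∧ ∀ s : ℂ, 3 / 2 ≤ s.re → ‖LLam s‖ ≤ B := by
  have hs : LSeriesSummable (fun n => (ArithmeticFunction.vonMangoldt n : ℂ)) ((3 / 2 : ℝ) : ℂ) :=
    ArithmeticFunction.LSeriesSummable_vonMangoldt (by norm_num)
  refine ⟨∑' n, ‖LSeries.term (fun n => (ArithmeticFunction.vonMangoldt n : ℂ)) ((3 / 2 : ℝ) : ℂ) n‖,
    tsum_nonneg fun n => norm_nonneg _, fun s h => ?_⟩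
  refine tsum_of_norm_bounded hs.norm.hasSum fun n => ?_
  exact LSeries.norm_term_le_of_re_le_re _ (by simpa using h) n

lemma norm_clog_le {z : ℂ} (hz : 1 / 2 ≤ ‖z‖) : ‖Complex.log z‖ ≤ Real.log (‖z‖ + 2) + 5 := by
  have h1 : ‖Complex.log z‖ ≤ |(Complex.log z).re| + |(Complex.log z).im| := Complex.norm_le_abs_re_add_abs_im _
  rw [Complex.log_re, Complex.log_im] at h1
  have h2 := Complex.abs_arg_le_pi z
  have h3 := Real.pi_lt_d2
  have h4 : Real.log ‖z‖ ≤ Real.log (‖z‖ + 2) := Real.log_le_log (by linarith) (by linarith)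
  have h5 : Real.log (1 / 2) ≤ Real.log ‖z‖ := Real.log_le_log (by norm_num) hz
  have h6 : Real.log (1 / 2) = - Real.log 2 := by rw [one_div, Real.log_inv]
  have h7 := Real.log_two_lt_d9
  have h8 : 0 ≤ Real.log (‖z‖ + 2) := Real.log_nonneg (by linarith)
  have : |Real.log ‖z‖| ≤ Real.log (‖z‖ + 2) + 1 := abs_le.2 ⟨by linarith, by linarith⟩
  linarith

lemma Gpart_bound : ∃ B : ℝ, 0 ≤ B ∧ ∀ s : ℂ, 3 / 2 ≤ s.re → ‖Gpart s‖ ≤ B + Real.log (‖s‖ + 2) := by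
  refine ⟨1 + 2 + |Real.log Real.pi| + 20, by positivity, fun s hs => ?_⟩
  have hn : 3 / 2 ≤ ‖s‖ := hs.trans (Complex.re_le_norm s)
  have hn1 : 1 / 2 ≤ ‖s - 1‖ := by
    refine le_trans ?_ (Complex.re_le_norm _)
    simp; linarith
  have hh : ‖s / 2‖ = ‖s‖ / 2 := by simp
  have hd := digamma_bound (z := s / 2) (by rw [half_re]; linarith)
  have hl := norm_clog_le (z := s / 2) (by rw [hh]; linarith)
  rw [hh] at hd hl
  have h6 : 6 / (‖s‖ / 2) ≤ 8 := by rw [div_le_iff₀ (by linarith)]; linarith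
  have hlog : Real.log (‖s‖ / 2 + 2) ≤ Real.log (‖s‖ + 2) := Real.log_le_log (by linarith) (by linarith)
  have hd2 : ‖logDeriv Complex.Gamma (s / 2)‖ ≤ Real.log (‖s‖ + 2) + 13 := by
    have := norm_add_le (logDeriv Complex.Gamma (s / 2) - Complex.log (s / 2)) (Complex.log (s / 2))
    rw [sub_add_cancel] at this
    linarith
  have a1 : ‖1 / s‖ ≤ 1 := by
    rw [norm_div, norm_one, div_le_one (by linarith)]; linarith
  have a2 : ‖1 / (s - 1)‖ ≤ 2 := by
    rw [norm_div, norm_one, div_le_iff₀ (by linarith)]; linarith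
  have a3 : ‖(Real.log Real.pi / 2 : ℂ)‖ ≤ |Real.log Real.pi| := by
    rw [norm_div, Complex.norm_real, Real.norm_eq_abs, Complex.norm_ofNat]
    linarith [abs_nonneg (Real.log Real.pi)]
  have a4 : ‖logDeriv Complex.Gamma (s / 2) / 2‖ ≤ Real.log (‖s‖ + 2) + 13 := by
    rw [norm_div]; simp
    linarith [norm_nonneg (logDeriv Complex.Gamma (s / 2))]
  have := norm_add_le (1 / s + 1 / (s - 1) - Real.log Real.pi / 2) (logDeriv Complex.Gamma (s / 2) / 2)
  have b2 := norm_sub_le (1 / s + 1 / (s - 1)) (Real.log Real.pi / 2 : ℂ)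
  have b3 := norm_add_le (1 / s) (1 / (s - 1))
  unfold Gpart
  linarith

/-- the type of nontrivial zeros -/
abbrev Zr := {ρ : ℂ // XX ρ = 0}

/-- multiplicity -/
noncomputable def mu (ρ : Zr) : ℝ := (analyticOrderNatAt XX (ρ : ℂ) : ℝ)

lemma mu_nonneg (ρ : Zr) : 0 ≤ mu ρ := Nat.cast_nonneg _

lemma Zr_re (ρ : Zr) : 0 < (ρ : ℂ).re ∧ (ρ : ℂ).re < 1 := ((XX_zero_iff ρ).1 ρ.2).2

lemma Zr_finite (R : ℝ) : {ρ : ℂ | XX ρ = 0 ∧ ‖ρ‖ ≤ R}.Finite := by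
  refine ((isCompact_closedBall (0:ℂ) R).inter_riemannZetaZeros_finite).subset ?_
  rintro ρ ⟨h1, h2⟩
  exact ⟨by simpa using h2, ((XX_zero_iff ρ).1 h1).1⟩

instance : Countable Zr := by
  have : {ρ : ℂ | XX ρ = 0} = ⋃ n : ℕ, {ρ : ℂ | XX ρ = 0 ∧ ‖ρ‖ ≤ n} := by
    ext ρ
    simp only [mem_ofPred_eq, mem_iUnion, exists_and_left]
    exact ⟨fun h => ⟨h, exists_nat_ge _⟩, fun h => h.1⟩
  have h2 : {ρ : ℂ | XX ρ = 0}.Countable := by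
    rw [this]; exact countable_iUnion fun n => (Zr_finite n).countable
  exact h2.to_subtype

lemma Zr_finite' (R : ℝ) : {ρ : Zr | ‖(ρ : ℂ)‖ ≤ R}.Finite := by
  refine Finite.of_finite_image (f := Subtype.val) ((Zr_finite R).subset ?_) Subtype.val_injective.injOn
  rintro _ ⟨ρ, h, rfl⟩
  exact ⟨ρ.2, h⟩

/-- zeros in a ball -/
noncomputable def SR (R : ℝ) : Finset Zr := (Zr_finite' R).toFinset

lemma mem_SR {R : ℝ} {ρ : Zr} : ρ ∈ SR R ↔ ‖(ρ : ℂ)‖ ≤ R := by simp [SR]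

lemma SR_tendsto : Tendsto SR atTop atTop := by
  refine tendsto_atTop_finset_of_monotone ?_ fun ρ => ⟨_, mem_SR.2 le_rfl⟩
  intro a b hab ρ h
  exact mem_SR.2 ((mem_SR.1 h).trans hab)

lemma log_quot_tendsto (K : ℝ) : Tendsto (fun R : ℝ => 128 * (K + (2 * R + 4) * Real.log (2 * R + 2)) / R ^ 2)
    atTop (𝓝 0) := by
  have h1 : Tendsto (fun R : ℝ => 2 * R + 2) atTop atTop :=
    tendsto_atTop_add_const_right _ _ (tendsto_id.const_mul_atTop (by norm_num))
  have h2 := (Real.tendsto_pow_log_div_mul_add_atTop (1/2) (-1) 1 (by norm_num)).comp h1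
  have h3 : Tendsto (fun R : ℝ => R⁻¹) atTop (𝓝 0) := tendsto_inv_atTop_zero
  have h4 := ((h3.mul h3).const_mul (128 * K)).add (((h3.const_mul 4).const_add 2).mul (h2.const_mul 128))
  simp only [mul_zero, add_zero] at h4
  refine h4.congr' ?_
  filter_upwards [eventually_gt_atTop 0] with R hR
  have e : 1 / 2 * (2 * R + 2) + -1 = R := by ring
  simp only [Function.comp, pow_one, e]
  field_simp

lemma mu_pos (ρ : Zr) : 1 ≤ mu ρ := by
  have h : analyticOrderNatAt XX (ρ : ℂ) ≠ 0 := by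
    intro h0
    have h1 : analyticOrderAt XX (ρ : ℂ) = 0 := by
      rw [← Nat.cast_analyticOrderNatAt (XX_order_ne_top ρ), h0]; rfl
    exact ((XX_diff.analyticAt _).analyticOrderAt_eq_zero.1 h1) ρ.2
  unfold mu
  exact_mod_cast Nat.one_le_iff_ne_zero.2 h

lemma D_tendsto {s t : ℂ} (hs : XX s ≠ 0) (ht : XX t ≠ 0) :
    Tendsto (fun R : ℝ => ∑ ρ ∈ SR R, (mu ρ : ℂ) * (1 / (s - ρ) - 1 / (t - ρ))) atTop
      (𝓝 (logDeriv XX s - logDeriv XX t)) := by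
  obtain ⟨K, hK, hg⟩ := XX_growth
  rw [tendsto_iff_norm_sub_tendsto_zero]
  have h0 := (log_quot_tendsto K).mul_const ‖s - t‖
  rw [zero_mul] at h0
  refine squeeze_zero' (Eventually.of_forall fun _ => norm_nonneg _) ?_ h0
  filter_upwards [eventually_ge_atTop (8 * ‖s‖), eventually_ge_atTop (8 * ‖t‖), eventually_ge_atTop 1]
    with R h1 h2 h3
  have hA : 0 < K + (2 * R + 4) * Real.log (2 * R + 2) := by
    have : 0 ≤ Real.log (2 * R + 2) := Real.log_nonneg (by linarith)
    positivity
  have key := D_finite XX_diff XX_order_ne_top XX_zero (R := R) (by linarith) hA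
    (fun z hz => by simpa [hz] using hg z) ((SR R).map (Function.Embedding.subtype _))
    (by
      intro ρ
      simp only [Finset.mem_map, Function.Embedding.subtype_apply, mem_SR]
      constructor
      · rintro ⟨a, h, rfl⟩; exact ⟨a.2, h⟩
      · rintro ⟨h, h'⟩; exact ⟨⟨ρ, h⟩, h', rfl⟩) (s := s) (t := t) (by linarith) (by linarith) hs ht
  rw [Finset.sum_map, norm_sub_rev] at key
  exact key

lemma XX_ne_of_re {s : ℂ} (h : 1 ≤ s.re ∨ s.re ≤ 0) : XX s ≠ 0 := by
  intro h0
  have := (XX_zero_iff s).1 h0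
  rcases h with h | h
  · linarith [this.2.2]
  · linarith [this.2.1]

lemma logDeriv_XX_symm (s : ℂ) : logDeriv XX (1 - s) = - logDeriv XX s := by
  have h1 : HasDerivAt (fun z => XX (1 - z)) (deriv XX (1 - s) * (-1)) s := by
    have h2 : HasDerivAt XX (deriv XX (1 - s)) (1 - s) := XX_diff.differentiableAt.hasDerivAt
    have h3 : HasDerivAt (fun z : ℂ => 1 - z) (-1) s := (hasDerivAt_id s).const_sub 1
    exact h2.comp s h3
  have h4 : (fun z => XX (1 - z)) = XX := funext XX_symm
  rw [h4] at h1
  rw [logDeriv_apply, logDeriv_apply, h1.deriv, XX_symm]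
  ring

/-- the basic weight -/
noncomputable def wt (ρ : Zr) (τ : ℝ) : ℝ := mu ρ / (1 + ((ρ : ℂ).im - τ) ^ 2)

lemma wt_nonneg (ρ : Zr) (τ : ℝ) : 0 ≤ wt ρ τ := div_nonneg (mu_nonneg ρ) (by positivity)

lemma inv_re_lower {z : ℂ} (h1 : 1 ≤ z.re) (h2 : z.re ≤ 2) : 1 / 4 * (1 / (1 + z.im ^ 2)) ≤ (1 / z).re := by
  rw [one_div z, Complex.inv_re, Complex.normSq_apply, mul_one_div,
    div_le_div_iff₀ (by positivity) (by nlinarith [mul_self_nonneg z.im])]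
  nlinarith [mul_self_nonneg z.im, mul_nonneg (sub_nonneg.2 h1) (mul_self_nonneg z.im)]

lemma wt_sum_bound : ∃ C : ℝ, 0 < C ∧ ∀ τ : ℝ, Summable (fun ρ => wt ρ τ) ∧
    ∑' ρ, wt ρ τ ≤ C * Real.log (|τ| + 2) := by
  obtain ⟨B1, hB1, h1⟩ := LLam_bound
  obtain ⟨B2, hB2, h2⟩ := Gpart_bound
  have hl2 : (1:ℝ) / 2 < Real.log 2 := by linarith [Real.log_two_gt_d9]
  refine ⟨4 * (2 * (B1 + B2) + 4), by positivity, fun τ => ?_⟩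
  set s : ℂ := 2 + τ * Complex.I with hs
  set s' : ℂ := 2 - τ * Complex.I with hs'
  have hre : s.re = 2 := by simp [hs]
  have hre' : s'.re = 2 := by simp [hs']
  have hb : ∀ z : ℂ, z.re = 2 → ‖z‖ ≤ |τ| + 2 → ‖logDeriv XX z‖ ≤ B1 + B2 + 2 * Real.log (|τ| + 2) := by
    intro z hz hz2
    rw [logDeriv_XX (by linarith)]
    have a := norm_sub_le (Gpart z) (LLam z)
    have b := h1 z (by linarith)
    have c := h2 z (by linarith)
    have d : Real.log (‖z‖ + 2) ≤ 2 * Real.log (|τ| + 2) := by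
      rw [two_mul, ← Real.log_mul (by positivity) (by positivity)]
      refine Real.log_le_log (by positivity) ?_
      nlinarith [abs_nonneg τ]
    linarith
  have hn : ‖s‖ ≤ |τ| + 2 := by
    have := norm_add_le (2:ℂ) (τ * Complex.I)
    simp at this; linarith
  have hn' : ‖s'‖ ≤ |τ| + 2 := by
    have := norm_sub_le (2:ℂ) (τ * Complex.I)
    simp at this; linarith
  have hst : (1 - s').re = -1 := by simp [hs']; norm_num
  have him : s.im = τ := by simp [hs]
  have him' : (1 - s').im = τ := by simp [hs']
  have t1 := D_tendsto (s := s) (t := 1 - s') (XX_ne_of_re (by left; linarith)) (XX_ne_of_re (by right; linarith))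
  have t2 := (Complex.continuous_re.tendsto _).comp t1
  have hlim : (logDeriv XX s - logDeriv XX (1 - s')).re ≤ (2 * (B1 + B2) + 4) * (2 * Real.log (|τ| + 2)) := by
    refine (Complex.re_le_norm _).trans ?_
    rw [logDeriv_XX_symm]
    refine (norm_sub_le _ _).trans ?_
    rw [norm_neg]
    have a := hb s hre hn
    have b := hb s' hre' hn'
    have c : Real.log 2 ≤ Real.log (|τ| + 2) := Real.log_le_log (by norm_num) (by linarith [abs_nonneg τ])
    have : 0 ≤ B1 + B2 := by positivity
    nlinarith
  have hterm : ∀ ρ : Zr, 1 / 2 * wt ρ τ ≤ ((mu ρ : ℂ) * (1 / (s - ρ) - 1 / (1 - s' - ρ))).re := by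
    intro ρ
    obtain ⟨r1, r2⟩ := Zr_re ρ
    rw [Complex.re_ofReal_mul]
    have a := inv_re_lower (z := s - ρ) (by rw [Complex.sub_re]; linarith) (by rw [Complex.sub_re]; linarith)
    have b := inv_re_lower (z := ρ - (1 - s')) (by rw [Complex.sub_re]; linarith) (by rw [Complex.sub_re]; linarith)
    rw [Complex.sub_im, him] at a
    rw [Complex.sub_im, him'] at b
    have c : (1 / (s - ρ) - 1 / (1 - s' - ρ)) = 1 / (s - ρ) + 1 / (ρ - (1 - s')) := by
      rw [← neg_sub (ρ : ℂ) (1 - s'), one_div_neg_eq_neg_one_div]; ring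
    rw [c, Complex.add_re, wt]
    have e : (τ - (ρ:ℂ).im) ^ 2 = ((ρ:ℂ).im - τ) ^ 2 := by ring
    rw [e] at a
    have : 1 / 2 * (mu ρ / (1 + ((ρ:ℂ).im - τ) ^ 2)) = mu ρ * (1 / 2 * (1 / (1 + ((ρ:ℂ).im - τ) ^ 2))) := by ring
    rw [this]
    exact mul_le_mul_of_nonneg_left (by linarith) (mu_nonneg ρ)
  have hfin : ∀ F : Finset Zr, ∑ ρ ∈ F, wt ρ τ ≤ 4 * (2 * (B1 + B2) + 4) * Real.log (|τ| + 2) := by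
    intro F
    have h5 : ∀ᶠ R in atTop, ∑ ρ ∈ F, 1 / 2 * wt ρ τ ≤ (Complex.re ∘ fun R : ℝ => ∑ ρ ∈ SR R, (mu ρ : ℂ) * (1 / (s - ρ) - 1 / (1 - s' - ρ))) R := by
      filter_upwards [SR_tendsto.eventually_ge_atTop F] with R hR
      simp only [Function.comp, Complex.re_sum]
      refine (Finset.sum_le_sum_of_subset_of_nonneg hR fun ρ _ _ => ?_).trans (Finset.sum_le_sum fun ρ _ => hterm ρ)
      have := wt_nonneg ρ τ
      positivity
    have h6 := ge_of_tendsto t2 h5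
    rw [← Finset.mul_sum] at h6
    linarith
  have hsum := summable_of_sum_le (fun ρ => wt_nonneg ρ τ) hfin
  exact ⟨hsum, hsum.tsum_le_of_sum_le hfin⟩

lemma norm_ge_wt {z : ℂ} {γ : ℝ} (h : 1 / 2 ≤ |z.re|) (hz : z.im ^ 2 = γ ^ 2) : Real.sqrt (1 + γ ^ 2) ≤ 2 * ‖z‖ := by
  rw [Real.sqrt_le_left (by positivity), mul_pow, Complex.sq_norm, Complex.normSq_apply]
  nlinarith [sq_abs z.re]

lemma pair_bound {w x : ℂ} (hw : w.re = 1) (hx : |x.re| ≤ 1 / 2) :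
    ‖1 / (w - x) + 1 / (w + x)‖ ≤ 16 * ‖w‖ ^ 3 * (1 / (1 + x.im ^ 2)) := by
  obtain ⟨x1, x2⟩ := abs_le.1 hx
  have a1 : 1 / 2 ≤ (w - x).re := by rw [Complex.sub_re, hw]; linarith
  have a2 : 1 / 2 ≤ (w + x).re := by rw [Complex.add_re, hw]; linarith
  have n1 : 1 / 2 ≤ ‖w - x‖ := a1.trans (Complex.re_le_norm _)
  have n2 : 1 / 2 ≤ ‖w + x‖ := a2.trans (Complex.re_le_norm _)
  have z1 : w - x ≠ 0 := norm_pos_iff.1 (by linarith)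
  have z2 : w + x ≠ 0 := norm_pos_iff.1 (by linarith)
  have b1 := norm_ge_wt (z := w - x) (γ := w.im - x.im) (a1.trans (le_abs_self _)) (by simp)
  have b2 := norm_ge_wt (z := w + x) (γ := w.im + x.im) (a2.trans (le_abs_self _)) (by simp)
  have hw2 : ‖w‖ ^ 2 = 1 + w.im ^ 2 := by rw [Complex.sq_norm, Complex.normSq_apply, hw]; ring
  have c : 1 + x.im ^ 2 ≤ 2 * (1 + w.im ^ 2) * (Real.sqrt (1 + (w.im - x.im) ^ 2) * Real.sqrt (1 + (w.im + x.im) ^ 2)) := by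
    rw [← Real.sqrt_mul (by positivity)]
    have : (1 + x.im ^ 2) / (2 * (1 + w.im ^ 2)) ≤ Real.sqrt ((1 + (w.im - x.im) ^ 2) * (1 + (w.im + x.im) ^ 2)) := by
      apply Real.le_sqrt_of_sq_le
      rw [div_pow, div_le_iff₀ (by positivity)]
      have h1 : 1 + x.im ^ 2 ≤ 2 * (1 + w.im ^ 2) * (1 + (w.im - x.im) ^ 2) := by
        nlinarith [sq_nonneg (x.im - 2 * w.im), sq_nonneg (w.im * (w.im - x.im))]
      have h2 : 1 + x.im ^ 2 ≤ 2 * (1 + w.im ^ 2) * (1 + (w.im + x.im) ^ 2) := by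
        nlinarith [sq_nonneg (x.im + 2 * w.im), sq_nonneg (w.im * (w.im + x.im))]
      calc (1 + x.im ^ 2) ^ 2 = (1 + x.im ^ 2) * (1 + x.im ^ 2) := by ring
        _ ≤ (2 * (1 + w.im ^ 2) * (1 + (w.im - x.im) ^ 2)) * (2 * (1 + w.im ^ 2) * (1 + (w.im + x.im) ^ 2)) := by gcongr
        _ = _ := by ring
    rw [div_le_iff₀ (by positivity)] at this
    linarith
  have e : 1 / (w - x) + 1 / (w + x) = 2 * w / ((w - x) * (w + x)) := by field_simp; ring
  have d : Real.sqrt (1 + (w.im - x.im) ^ 2) * Real.sqrt (1 + (w.im + x.im) ^ 2) ≤ 4 * (‖w - x‖ * ‖w + x‖) := by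
    calc _ ≤ (2 * ‖w - x‖) * (2 * ‖w + x‖) := by gcongr
      _ = _ := by ring
  rw [e, norm_div, norm_mul, norm_mul, mul_one_div, div_le_div_iff₀ (by positivity) (by positivity)]
  simp only [Complex.norm_ofNat]
  have hp := norm_nonneg w
  have f : 1 + x.im ^ 2 ≤ 8 * ‖w‖ ^ 2 * (‖w - x‖ * ‖w + x‖) := by
    rw [← hw2] at c
    calc _ ≤ _ := c
      _ ≤ 2 * ‖w‖ ^ 2 * (4 * (‖w - x‖ * ‖w + x‖)) := by gcongr
      _ = _ := by ring
  calc 2 * ‖w‖ * (1 + x.im ^ 2) ≤ 2 * ‖w‖ * (8 * ‖w‖ ^ 2 * (‖w - x‖ * ‖w + x‖)) := by gcongr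
    _ = _ := by ring

/-- shifted zero -/
noncomputable def wz (ρ : Zr) (t : ℝ) : ℂ := (ρ : ℂ) - 1 / 2 - t * Complex.I

lemma wz_re (ρ : Zr) (t : ℝ) : (wz ρ t).re = (ρ : ℂ).re - 1 / 2 := by simp [wz]
lemma wz_im (ρ : Zr) (t : ℝ) : (wz ρ t).im = (ρ : ℂ).im - t := by simp [wz]
lemma wz_abs (ρ : Zr) (t : ℝ) : |(wz ρ t).re| ≤ 1 / 2 := by
  rw [wz_re, abs_le]
  constructor <;> linarith [(Zr_re ρ).1, (Zr_re ρ).2]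

lemma pair_bound_mu {w : ℂ} (hw : w.re = 1) (ρ : Zr) (t : ℝ) :
    ‖(mu ρ : ℂ) * (1 / (w - wz ρ t) + 1 / (w + wz ρ t))‖ ≤ 16 * ‖w‖ ^ 3 * wt ρ t := by
  rw [norm_mul, Complex.norm_real, Real.norm_eq_abs, abs_of_nonneg (mu_nonneg ρ), wt, div_eq_mul_one_div (mu ρ),
    mul_left_comm]
  refine mul_le_mul_of_nonneg_left ?_ (mu_nonneg ρ)
  have := pair_bound hw (wz_abs ρ t)
  rwa [wz_im] at this

lemma D_hasSum (t : ℝ) {w : ℂ} (hw : w.re = 1) :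
    HasSum (fun ρ : Zr => (mu ρ : ℂ) * (1 / (w - wz ρ t) + 1 / (w + wz ρ t)))
      (logDeriv XX (1 / 2 + t * Complex.I + w) + logDeriv XX (1 / 2 - t * Complex.I + w)) := by
  obtain ⟨C, hC, h⟩ := wt_sum_bound
  have hs : Summable (fun ρ : Zr => (mu ρ : ℂ) * (1 / (w - wz ρ t) + 1 / (w + wz ρ t))) :=
    Summable.of_norm_bounded ((h t).1.mul_left _) fun ρ => pair_bound_mu hw ρ t
  have t1 := hs.hasSum.comp SR_tendsto
  have t2 := D_tendsto (s := 1 / 2 + t * Complex.I + w) (t := 1 - (1 / 2 - t * Complex.I + w))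
    (XX_ne_of_re (by left; simp [hw])) (XX_ne_of_re (by right; simp [hw]))
  rw [logDeriv_XX_symm, sub_neg_eq_add] at t2
  have e : ∀ ρ : Zr, (mu ρ : ℂ) * (1 / ((1 / 2 + t * Complex.I + w) - ρ) - 1 / (1 - (1 / 2 - t * Complex.I + w) - ρ)) =
      (mu ρ : ℂ) * (1 / (w - wz ρ t) + 1 / (w + wz ρ t)) := by
    intro ρ
    have e1 : (1 / 2 + t * Complex.I + w) - ρ = w - wz ρ t := by rw [wz]; ring
    have e2 : 1 - (1 / 2 - t * Complex.I + w) - ρ = - (w + wz ρ t) := by rw [wz]; ring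
    rw [e1, e2, one_div_neg_eq_neg_one_div, sub_neg_eq_add]
  simp only [e] at t2
  rw [tendsto_nhds_unique t2 t1]
  exact hs.hasSum

open scoped ContDiff FourierTransform

/-- test functions -/
structure TF (g : ℝ → ℝ) : Prop where
  smooth : ContDiff ℝ ∞ g
  cpt : HasCompactSupport g

/-- Two-sided Laplace transform -/
noncomputable def Lap (g : ℝ → ℝ) (w : ℂ) : ℂ := ∫ u : ℝ, (g u : ℂ) * Complex.exp (w * u)

lemma TF.cont {g : ℝ → ℝ} (h : TF g) : Continuous g := h.smooth.continuous

lemma TF.deriv {g : ℝ → ℝ} (h : TF g) : TF (deriv g) :=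
  ⟨(contDiff_infty_iff_deriv.1 h.smooth).2, h.cpt.deriv⟩

lemma TF.iter {g : ℝ → ℝ} (h : TF g) (k : ℕ) : TF (_root_.deriv^[k] g) := by
  induction k with
  | zero => exact h
  | succ k ih => rw [Function.iterate_succ_apply']; exact ih.deriv

lemma TF.integrable_mul {g : ℝ → ℝ} (h : TF g) {f : ℝ → ℂ} (hf : Continuous f) :
    Integrable (fun u : ℝ => (g u : ℂ) * f u) := by
  refine Continuous.integrable_of_hasCompactSupport ?_ ?_
  · exact (Complex.continuous_ofReal.comp h.cont).mul hf
  · refine (HasCompactSupport.comp_left (g := fun x : ℝ => (x : ℂ)) h.cpt (by simp)).mul_right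

lemma TF.integrable {g : ℝ → ℝ} (h : TF g) : Integrable g :=
  h.cont.integrable_of_hasCompactSupport h.cpt

lemma TF.lap_int {g : ℝ → ℝ} (h : TF g) (w : ℂ) :
    Integrable (fun u : ℝ => (g u : ℂ) * Complex.exp (w * u)) := h.integrable_mul (by fun_prop)

lemma lap_deriv {g : ℝ → ℝ} (h : TF g) (w : ℂ) : Lap (deriv g) w = - w * Lap g w := by
  have hd : ∀ u, HasDerivAt (fun u : ℝ => (g u : ℂ) * Complex.exp (w * u))
      (((deriv g u : ℝ) : ℂ) * Complex.exp (w * u) + (g u : ℂ) * (Complex.exp (w * u) * w)) u := by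
    intro u
    have h1 : HasDerivAt (fun u : ℝ => (g u : ℂ)) ((deriv g u : ℝ) : ℂ) u :=
      ((h.smooth.differentiable (by simp)) u).hasDerivAt.ofReal_comp
    have h2 : HasDerivAt (fun u : ℝ => Complex.exp (w * u)) (Complex.exp (w * u) * w) u := by
      have : HasDerivAt (fun u : ℝ => w * (u : ℂ)) w u := by
        simpa using (Complex.ofRealCLM.hasDerivAt (x := u)).const_mul w
      exact this.cexp
    exact h1.mul h2
  have i1 := h.deriv.lap_int w
  have i2 : Integrable (fun u : ℝ => (g u : ℂ) * (Complex.exp (w * u) * w)) := h.integrable_mul (by fun_prop)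
  have key := integral_eq_zero_of_hasDerivAt_of_integrable hd (i1.add i2) (h.lap_int w)
  rw [integral_add i1 i2] at key
  simp only [← mul_assoc] at key
  rw [integral_mul_const] at key
  unfold Lap
  linear_combination key

lemma lap_iter {g : ℝ → ℝ} (h : TF g) (w : ℂ) (k : ℕ) : Lap (deriv^[k] g) w = (- w) ^ k * Lap g w := by
  induction k with
  | zero => simp
  | succ k ih => rw [Function.iterate_succ_apply', lap_deriv (h.iter k), ih]; ring

lemma lap_bound0 {g : ℝ → ℝ} (h : TF g) {A : ℝ} (hA : ∀ u, A < |u| → g u = 0) (w : ℂ) :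
    ‖Lap g w‖ ≤ (∫ u, |g u|) * Real.exp (A * |w.re|) := by
  unfold Lap
  rw [← integral_mul_const]
  refine norm_integral_le_of_norm_le (h.integrable.abs.mul_const _) (Eventually.of_forall fun u => ?_)
  rw [norm_mul, Complex.norm_real, Real.norm_eq_abs, Complex.norm_exp]
  by_cases hu : A < |u|
  · simp [hA u hu]
  · gcongr
    rw [Complex.re_mul_ofReal]
    refine (le_abs_self _).trans ?_
    rw [abs_mul, mul_comm]
    gcongr
    exact not_lt.1 hu

lemma deriv_supp {g : ℝ → ℝ} {A : ℝ} (hA : ∀ u, A < |u| → g u = 0) : ∀ u, A < |u| → deriv g u = 0 := by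
  intro u hu
  have : g =ᶠ[𝓝 u] fun _ => 0 := by
    filter_upwards [(isOpen_lt continuous_const continuous_abs).mem_nhds hu] with x hx using hA x hx
  rw [this.deriv_eq]; simp

lemma iter_supp {g : ℝ → ℝ} {A : ℝ} (hA : ∀ u, A < |u| → g u = 0) (k : ℕ) :
    ∀ u, A < |u| → (deriv^[k] g) u = 0 := by
  induction k with
  | zero => exact hA
  | succ k ih => rw [Function.iterate_succ_apply']; exact deriv_supp ih

lemma lap_decay {g : ℝ → ℝ} (h : TF g) {A : ℝ} (hA : ∀ u, A < |u| → g u = 0) (k : ℕ) :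
    ∃ C : ℝ, 0 < C ∧ ∀ w : ℂ, ‖Lap g w‖ * (1 + ‖w‖) ^ k ≤ C * Real.exp (A * |w.re|) := by
  refine ⟨2 ^ k * ((∫ u, |g u|) + ∫ u, |(deriv^[k] g) u|) + 1, ?_, fun w => ?_⟩
  · have a1 : 0 ≤ ∫ u, |g u| := integral_nonneg fun u => abs_nonneg _
    have a2 : 0 ≤ ∫ u, |(deriv^[k] g) u| := integral_nonneg fun u => abs_nonneg _
    positivity
  have h0 := lap_bound0 h hA w
  have h1 := lap_bound0 (h.iter k) (iter_supp hA k) w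
  rw [lap_iter h, norm_mul, norm_pow, norm_neg] at h1
  have h2 : (1 + ‖w‖) ^ k ≤ 2 ^ k * (1 + ‖w‖ ^ k) := by
    have hw := norm_nonneg w
    rcases le_total ‖w‖ 1 with h3 | h3
    · calc (1 + ‖w‖) ^ k ≤ 2 ^ k := by gcongr; linarith
        _ ≤ _ := le_mul_of_one_le_right (by positivity) (by linarith [pow_nonneg hw k])
    · calc (1 + ‖w‖) ^ k ≤ (2 * ‖w‖) ^ k := by gcongr; linarith
        _ = 2 ^ k * ‖w‖ ^ k := by rw [mul_pow]
        _ ≤ _ := by gcongr; linarith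
  calc ‖Lap g w‖ * (1 + ‖w‖) ^ k ≤ ‖Lap g w‖ * (2 ^ k * (1 + ‖w‖ ^ k)) := by gcongr
    _ = 2 ^ k * (‖Lap g w‖ + ‖w‖ ^ k * ‖Lap g w‖) := by ring
    _ ≤ 2 ^ k * ((∫ u, |g u|) * Real.exp (A * |w.re|) + (∫ u, |(deriv^[k] g) u|) * Real.exp (A * |w.re|)) := by gcongr
    _ = (2 ^ k * ((∫ u, |g u|) + ∫ u, |(deriv^[k] g) u|)) * Real.exp (A * |w.re|) := by ring
    _ ≤ _ := by gcongr; linarith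

lemma TF.supp {g : ℝ → ℝ} (h : TF g) : ∃ A : ℝ, 0 < A ∧ ∀ u, A < |u| → g u = 0 := by
  obtain ⟨A, hA⟩ := h.cpt.isCompact.isBounded.subset_closedBall (0:ℝ)
  refine ⟨max A 1, by positivity, fun u hu => ?_⟩
  by_contra h0
  have := hA (subset_tsupport g h0)
  simp at this
  have := le_max_left A 1
  linarith

lemma lap_cont {g : ℝ → ℝ} (h : TF g) : Continuous (Lap g) := by
  unfold Lap
  obtain ⟨A, hA0, hA⟩ := h.supp
  have : (fun w : ℂ => ∫ u : ℝ, (g u : ℂ) * Complex.exp (w * u)) =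
      fun w : ℂ => ∫ u in (-A)..A, (g u : ℂ) * Complex.exp (w * u) := by
    ext w
    rw [intervalIntegral.integral_of_le (by linarith), ← integral_Icc_eq_integral_Ioc,
      setIntegral_eq_integral_of_forall_compl_eq_zero]
    intro u hu
    rw [hA u, Complex.ofReal_zero, zero_mul]
    by_contra hc
    exact hu (abs_le.1 (not_lt.1 hc))
  rw [this]
  refine intervalIntegral.continuous_parametric_intervalIntegral_of_continuous' ?_ _ _
  have := h.cont
  fun_prop

lemma int_pow_bound (k : ℕ) (hk : 2 ≤ k) : Integrable (fun v : ℝ => 1 / (1 + |v|) ^ k) := by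
  have h2 := integrable_one_add_norm (E := ℝ) (μ := volume) (r := k) (by
    simp; exact_mod_cast (by omega : 1 < k))
  refine h2.congr (Eventually.of_forall fun v => ?_)
  simp only [Real.norm_eq_abs]
  rw [Real.rpow_neg (by positivity), Real.rpow_natCast, one_div]

lemma lap_vert_bound {g : ℝ → ℝ} (h : TF g) (a : ℂ) (k : ℕ) : ∃ C : ℝ, 0 < C ∧ ∀ v : ℝ,
    ‖Lap g (a + v * Complex.I)‖ * (1 + ‖a + v * Complex.I‖) ^ k ≤ C := by
  obtain ⟨A, hA0, hA⟩ := h.supp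
  obtain ⟨C, hC, hb⟩ := lap_decay h hA k
  refine ⟨C * Real.exp (A * |a.re|), by positivity, fun v => ?_⟩
  have := hb (a + v * Complex.I)
  simpa using this

lemma lap_vert_bound' {g : ℝ → ℝ} (h : TF g) (a : ℂ) (k : ℕ) : ∃ C : ℝ, 0 < C ∧ ∀ v : ℝ,
    ‖Lap g (a + v * Complex.I)‖ * ‖a + v * Complex.I‖ ^ k ≤ C * (1 / (1 + |v|) ^ 2) := by
  obtain ⟨C, hC, hb⟩ := lap_vert_bound h a (k + 2)
  refine ⟨C * (1 + ‖a‖) ^ 2, by positivity, fun v => ?_⟩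
  have h1 : 1 + |v| ≤ (1 + ‖a‖) * (1 + ‖a + v * Complex.I‖) := by
    have : ‖(v * Complex.I : ℂ)‖ ≤ ‖a + v * Complex.I‖ + ‖a‖ := by
      have := norm_sub_le (a + v * Complex.I) a
      simpa using this
    simp at this
    nlinarith [norm_nonneg a, norm_nonneg (a + v * Complex.I)]
  rw [mul_one_div, le_div_iff₀ (by positivity)]
  have h2 := hb v
  set y := ‖a + v * Complex.I‖
  have hy : 0 ≤ y := norm_nonneg _
  calc ‖Lap g (a + v * Complex.I)‖ * y ^ k * (1 + |v|) ^ 2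
      ≤ ‖Lap g (a + v * Complex.I)‖ * (1 + y) ^ k * ((1 + ‖a‖) * (1 + y)) ^ 2 := by
        gcongr; linarith
    _ = (‖Lap g (a + v * Complex.I)‖ * (1 + y) ^ (k + 2)) * (1 + ‖a‖) ^ 2 := by ring
    _ ≤ _ := by gcongr

lemma lap_vert_int {g : ℝ → ℝ} (h : TF g) (a : ℂ) (k : ℕ) :
    Integrable (fun v : ℝ => ‖Lap g (a + v * Complex.I)‖ * ‖a + v * Complex.I‖ ^ k) := by
  obtain ⟨C, hC, hb⟩ := lap_vert_bound' h a k
  have hc := lap_cont h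
  refine ((int_pow_bound 2 le_rfl).const_mul C).mono' (Continuous.aestronglyMeasurable (by fun_prop))
    (Eventually.of_forall fun v => ?_)
  rw [Real.norm_eq_abs, abs_of_nonneg (by positivity)]
  exact hb v

lemma lap_vert_int0 {g : ℝ → ℝ} (h : TF g) (a : ℂ) :
    Integrable (fun v : ℝ => Lap g (a + v * Complex.I)) := by
  have hc := lap_cont h
  have := lap_vert_int h a 0
  simp only [pow_zero, mul_one] at this
  exact (integrable_norm_iff (Continuous.aestronglyMeasurable (by fun_prop))).1 this

lemma lap_inv {g : ℝ → ℝ} (h : TF g) (a : ℂ) (x : ℝ) :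
    ∫ v : ℝ, Lap g (a + v * Complex.I) * Complex.exp (-(a + v * Complex.I) * x) = 2 * Real.pi * g x := by
  set f : ℝ → ℂ := fun u => (g u : ℂ) * Complex.exp (a * u) with hf
  have hfc : Continuous f := by have := h.cont; fun_prop
  have hF : ∀ ξ : ℝ, 𝓕 f ξ = Lap g (a + (-(2 * Real.pi) * ξ : ℝ) * Complex.I) := by
    intro ξ
    rw [Real.fourier_eq']
    unfold Lap
    congr 1
    ext u
    rw [smul_eq_mul, hf, mul_left_comm]
    congr 1
    rw [← Complex.exp_add]
    congr 1
    simp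
    ring
  have hint := lap_vert_int0 h a
  have hFi : Integrable (𝓕 f) := by
    have : 𝓕 f = fun ξ : ℝ => Lap g (a + (-(2 * Real.pi) * ξ : ℝ) * Complex.I) := funext hF
    rw [this]
    exact hint.comp_mul_left' (by simp [Real.pi_ne_zero])
  have key := congrFun (Continuous.fourierInv_fourier_eq hfc (h.lap_int a) hFi) x
  rw [Real.fourierInv_eq'] at key
  simp only [hF, smul_eq_mul] at key
  have cv := MeasureTheory.Measure.integral_comp_mul_left
    (fun v : ℝ => Complex.exp (-(v * Complex.I) * x) * Lap g (a + v * Complex.I)) (-(2 * Real.pi))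
  have e1 : ∀ ξ : ℝ, Complex.exp (-(((-(2 * Real.pi) * ξ : ℝ) : ℂ) * Complex.I) * x) =
      Complex.exp (((2 * Real.pi * (inner ℝ ξ x) : ℝ) : ℂ) * Complex.I) := by
    intro ξ
    congr 1
    simp
    ring
  simp only [e1] at cv
  rw [cv] at key
  have e2 : (fun v : ℝ => Lap g (a + v * Complex.I) * Complex.exp (-(a + v * Complex.I) * x)) =
      fun v : ℝ => (Complex.exp (-(v * Complex.I) * x) * Lap g (a + v * Complex.I)) * Complex.exp (-a * x) := by
    ext v
    rw [show -(a + v * Complex.I) * x = -(v * Complex.I) * x + -a * x by ring, Complex.exp_add]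
    ring
  rw [e2, integral_mul_const]
  have hpi : |(-(2 * Real.pi))⁻¹| = (2 * Real.pi)⁻¹ := by
    rw [abs_inv, abs_neg, abs_of_pos (by positivity)]
  rw [hpi, hf] at key
  have hp0 : (Real.pi : ℂ) ≠ 0 := by exact_mod_cast Real.pi_ne_zero
  have key2 : ∫ v : ℝ, (Complex.exp (-(v * Complex.I) * x) * Lap g (a + v * Complex.I)) =
      2 * Real.pi * ((g x : ℂ) * Complex.exp (a * x)) := by
    beta_reduce at key
    rw [← key, Complex.real_smul]
    generalize (∫ v : ℝ, (Complex.exp (-(v * Complex.I) * x) * Lap g (a + v * Complex.I))) = J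
    push_cast
    field_simp
  rw [key2, neg_mul, Complex.exp_neg]
  field_simp


/-- half-line Laplace transform from the vertical-line integral -/
lemma lap_half {g : ℝ → ℝ} (h : TF g) {c a : ℂ} (hac : a.re < c.re) :
    ∫ v : ℝ, Lap g (c + v * Complex.I) * (1 / (c + v * Complex.I - a)) =
      2 * Real.pi * ∫ u in Ioi (0:ℝ), (g u : ℂ) * Complex.exp (a * u) := by
  have hc := lap_cont h
  have e1 : ∀ v : ℝ, 1 / (c + v * Complex.I - a) =
      ∫ x in Ioi (0:ℝ), Complex.exp (-(c + v * Complex.I - a) * x) := by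
    intro v
    have := integral_exp_mul_complex_Ioi (a := -(c + v * Complex.I - a)) (by simp; linarith) 0
    rw [this, neg_div_neg_eq]
    simp
  have hint : Integrable (Function.uncurry fun (v x : ℝ) => Lap g (c + v * Complex.I) *
      Complex.exp (-(c + v * Complex.I - a) * x)) (volume.prod (volume.restrict (Ioi 0))) := by
    have h1 := (lap_vert_int0 h c).norm
    have h2 : Integrable (fun x : ℝ => Real.exp ((a.re - c.re) * x)) (volume.restrict (Ioi 0)) := by
      have := integrableOn_exp_mul_Ioi (a := a.re - c.re) (by linarith) 0
      exact this
    refine (h1.mul_prod h2).mono' (Continuous.aestronglyMeasurable (by unfold Function.uncurry; fun_prop)) ?_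
    refine Eventually.of_forall fun p => ?_
    simp only [Function.uncurry, norm_mul, Complex.norm_exp]
    rw [Complex.re_mul_ofReal]
    simp
  calc ∫ v : ℝ, Lap g (c + v * Complex.I) * (1 / (c + v * Complex.I - a))
      = ∫ v : ℝ, ∫ x in Ioi (0:ℝ), Lap g (c + v * Complex.I) * Complex.exp (-(c + v * Complex.I - a) * x) := by
        congr 1; ext v; rw [e1, integral_const_mul]
    _ = ∫ x in Ioi (0:ℝ), ∫ v : ℝ, Lap g (c + v * Complex.I) * Complex.exp (-(c + v * Complex.I - a) * x) :=
        integral_integral_swap hint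
    _ = ∫ x in Ioi (0:ℝ), 2 * Real.pi * ((g x : ℂ) * Complex.exp (a * x)) := by
        congr 1; ext x
        have e2 : (fun v : ℝ => Lap g (c + v * Complex.I) * Complex.exp (-(c + v * Complex.I - a) * x)) =
            fun v : ℝ => (Lap g (c + v * Complex.I) * Complex.exp (-(c + v * Complex.I) * x)) * Complex.exp (a * x) := by
          ext v
          rw [mul_assoc, ← Complex.exp_add]; congr 2; ring
        rw [e2, integral_mul_const, lap_inv h]; ring
    _ = _ := by rw [integral_const_mul]

lemma lap_pair {g : ℝ → ℝ} (h : TF g) (heven : ∀ u, g (-u) = g u) {c a : ℂ} (h1 : a.re < c.re) (h2 : -a.re < c.re) :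
    ∫ v : ℝ, Lap g (c + v * Complex.I) * (1 / (c + v * Complex.I - a) + 1 / (c + v * Complex.I + a)) =
      2 * Real.pi * Lap g a := by
  have k1 := lap_half h h1
  have k2 := lap_half h (c := c) (a := -a) (by simpa using h2)
  have hneg : ∫ u in Ioi (0:ℝ), (g u : ℂ) * Complex.exp (-a * u) = ∫ u in Iic (0:ℝ), (g u : ℂ) * Complex.exp (a * u) := by
    have := integral_comp_neg_Ioi (0:ℝ) (fun u : ℝ => (g u : ℂ) * Complex.exp (a * u))
    rw [neg_zero] at this
    rw [← this]
    congr 1; ext u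
    rw [heven]; congr 2; push_cast; ring
  have hsplit : Lap g a = (∫ u in Iic (0:ℝ), (g u : ℂ) * Complex.exp (a * u)) +
      ∫ u in Ioi (0:ℝ), (g u : ℂ) * Complex.exp (a * u) :=
    (intervalIntegral.integral_Iic_add_Ioi (h.lap_int a).integrableOn (h.lap_int a).integrableOn).symm
  have hi : ∀ b : ℂ, b.re < c.re → Integrable (fun v : ℝ => Lap g (c + v * Complex.I) * (1 / (c + v * Complex.I - b))) := by
    intro b hb
    have hne : ∀ v : ℝ, c + v * Complex.I - b ≠ 0 := by
      intro v h0
      have := congrArg Complex.re h0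
      simp at this; linarith
    refine Integrable.mul_bdd (c := 1 / (c.re - b.re)) (lap_vert_int0 h c) ?_ (Eventually.of_forall fun v => ?_)
    · refine Continuous.aestronglyMeasurable (Continuous.div continuous_const (by fun_prop) hne)
    · rw [norm_div, norm_one]
      have : c.re - b.re ≤ ‖c + v * Complex.I - b‖ := by
        refine le_trans ?_ (Complex.re_le_norm _)
        simp
      have h0 : 0 < c.re - b.re := by linarith
      gcongr
  have e : (fun v : ℝ => Lap g (c + v * Complex.I) * (1 / (c + v * Complex.I - a) + 1 / (c + v * Complex.I + a))) =
    fun v : ℝ => Lap g (c + v * Complex.I) * (1 / (c + v * Complex.I - a)) +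
      Lap g (c + v * Complex.I) * (1 / (c + v * Complex.I - -a)) := by
    ext v; rw [sub_neg_eq_add]; ring
  rw [e, integral_add (hi a h1) (hi (-a) (by simpa using h2)), k1, k2, hneg, hsplit]
  ring

/-- Parseval -/
lemma lap_parseval {g1 g2 : ℝ → ℝ} (h1 : TF g1) (h2 : TF g2) (a b : ℂ) :
    ∫ t : ℝ, Lap g1 (a - t * Complex.I) * Lap g2 (b - t * Complex.I) =
      2 * Real.pi * ∫ u : ℝ, (g1 (-u) : ℂ) * g2 u * Complex.exp ((b - a) * u) := by
  have hc := lap_cont h1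
  have hg2 := h2.cont
  have i1 : Integrable fun t : ℝ => Lap g1 (a - t * Complex.I) := by
    have := (lap_vert_int0 h1 a).comp_neg
    simpa [sub_eq_add_neg] using this
  have hint : Integrable (Function.uncurry fun (t u : ℝ) => Lap g1 (a - t * Complex.I) *
      ((g2 u : ℂ) * Complex.exp ((b - t * Complex.I) * u))) (volume.prod volume) := by
    refine (i1.norm.mul_prod (h2.lap_int b).norm).mono' (Continuous.aestronglyMeasurable (by unfold Function.uncurry; fun_prop)) ?_
    refine Eventually.of_forall fun p => ?_
    simp only [Function.uncurry, norm_mul, Complex.norm_exp]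
    rw [Complex.re_mul_ofReal, Complex.re_mul_ofReal]
    simp
  calc ∫ t : ℝ, Lap g1 (a - t * Complex.I) * Lap g2 (b - t * Complex.I)
      = ∫ t : ℝ, ∫ u : ℝ, Lap g1 (a - t * Complex.I) * ((g2 u : ℂ) * Complex.exp ((b - t * Complex.I) * u)) := by
        congr 1; ext t; rw [integral_const_mul]; rfl
    _ = ∫ u : ℝ, ∫ t : ℝ, Lap g1 (a - t * Complex.I) * ((g2 u : ℂ) * Complex.exp ((b - t * Complex.I) * u)) :=
        integral_integral_swap hint
    _ = ∫ u : ℝ, 2 * Real.pi * ((g1 (-u) : ℂ) * g2 u * Complex.exp ((b - a) * u)) := by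
        congr 1; ext u
        have k := lap_inv h1 a (-u)
        rw [← integral_neg_eq_self] at k
        have e : (fun t : ℝ => Lap g1 (a - t * Complex.I) * ((g2 u : ℂ) * Complex.exp ((b - t * Complex.I) * u))) =
            fun t : ℝ => (Lap g1 (a + (-t : ℝ) * Complex.I) * Complex.exp (-(a + (-t : ℝ) * Complex.I) * (-u : ℝ))) *
              ((g2 u : ℂ) * Complex.exp ((b - a) * u)) := by
          ext t
          have e1 : Complex.exp ((b - t * Complex.I) * u) =
              Complex.exp (-(a + (-t : ℝ) * Complex.I) * (-u : ℝ)) * Complex.exp ((b - a) * u) := by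
            rw [← Complex.exp_add]; congr 1; push_cast; ring
          rw [e1]
          rw [show a + ((-t : ℝ) : ℂ) * Complex.I = a - t * Complex.I by push_cast; ring]; ring
        rw [e, integral_mul_const, k]; ring
    _ = _ := by rw [integral_const_mul]

/-- zero sum -/
noncomputable def HH (g : ℝ → ℝ) (t : ℝ) : ℂ := ∑' ρ : Zr, (mu ρ : ℂ) * Lap g (wz ρ t)

lemma explicit1 {g : ℝ → ℝ} (h : TF g) (heven : ∀ u, g (-u) = g u) (t : ℝ) :
    HasSum (fun ρ : Zr => 2 * Real.pi * ((mu ρ : ℂ) * Lap g (wz ρ t)))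
      (∫ v : ℝ, Lap g (1 + v * Complex.I) * (logDeriv XX (1 / 2 + t * Complex.I + (1 + v * Complex.I)) +
        logDeriv XX (1 / 2 - t * Complex.I + (1 + v * Complex.I)))) := by
  obtain ⟨C, hC, hw⟩ := wt_sum_bound
  have hc := lap_cont h
  have hre : ∀ v : ℝ, (1 + v * Complex.I : ℂ).re = 1 := by intro v; simp
  have hne : ∀ (ρ : Zr) (v : ℝ), 1 + v * Complex.I - wz ρ t ≠ 0 ∧ 1 + v * Complex.I + wz ρ t ≠ 0 := by
    intro ρ v
    have := abs_le.1 (wz_abs ρ t)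
    constructor
    · intro h0
      have := congrArg Complex.re h0
      simp at this; linarith
    · intro h0
      have := congrArg Complex.re h0
      simp at this; linarith
  have hmeas : ∀ ρ : Zr, Continuous (fun v : ℝ => Lap g (1 + v * Complex.I) *
      ((mu ρ : ℂ) * (1 / (1 + v * Complex.I - wz ρ t) + 1 / (1 + v * Complex.I + wz ρ t)))) := by
    intro ρ
    have c1 : Continuous fun v : ℝ => 1 / (1 + v * Complex.I - wz ρ t) :=
      Continuous.div continuous_const (by fun_prop) fun v => (hne ρ v).1
    have c2 : Continuous fun v : ℝ => 1 / (1 + v * Complex.I + wz ρ t) :=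
      Continuous.div continuous_const (by fun_prop) fun v => (hne ρ v).2
    fun_prop
  have hi := lap_vert_int h 1 3
  have hbd : ∀ (ρ : Zr) (v : ℝ), ‖Lap g (1 + v * Complex.I) *
      ((mu ρ : ℂ) * (1 / (1 + v * Complex.I - wz ρ t) + 1 / (1 + v * Complex.I + wz ρ t)))‖ ≤
      (‖Lap g (1 + v * Complex.I)‖ * ‖1 + v * Complex.I‖ ^ 3) * (16 * wt ρ t) := by
    intro ρ v
    rw [norm_mul]
    calc _ ≤ ‖Lap g (1 + v * Complex.I)‖ * (16 * ‖1 + v * Complex.I‖ ^ 3 * wt ρ t) := by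
          gcongr; exact pair_bound_mu (hre v) ρ t
      _ = _ := by ring
  have hint : ∀ ρ : Zr, Integrable (fun v : ℝ => Lap g (1 + v * Complex.I) *
      ((mu ρ : ℂ) * (1 / (1 + v * Complex.I - wz ρ t) + 1 / (1 + v * Complex.I + wz ρ t)))) := fun ρ =>
    (hi.mul_const _).mono' (hmeas ρ).aestronglyMeasurable (Eventually.of_forall (hbd ρ))
  have hsum : Summable fun ρ : Zr => ∫ v : ℝ, ‖Lap g (1 + v * Complex.I) *
      ((mu ρ : ℂ) * (1 / (1 + v * Complex.I - wz ρ t) + 1 / (1 + v * Complex.I + wz ρ t)))‖ := by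
    refine Summable.of_nonneg_of_le (fun ρ => integral_nonneg fun v => norm_nonneg _)
      (fun ρ => integral_mono (hint ρ).norm (hi.mul_const _) (hbd ρ)) ?_
    simp_rw [integral_mul_const]
    exact ((hw t).1.mul_left 16).mul_left _
  have key := hasSum_integral_of_summable_integral_norm hint hsum
  have e1 : ∀ ρ : Zr, ∫ v : ℝ, Lap g (1 + v * Complex.I) *
      ((mu ρ : ℂ) * (1 / (1 + v * Complex.I - wz ρ t) + 1 / (1 + v * Complex.I + wz ρ t))) =
      2 * Real.pi * ((mu ρ : ℂ) * Lap g (wz ρ t)) := by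
    intro ρ
    have := abs_le.1 (wz_abs ρ t)
    have k := lap_pair h heven (c := 1) (a := wz ρ t) (by simp; linarith) (by simp; linarith)
    simp_rw [mul_left_comm _ (mu ρ : ℂ)]
    rw [integral_const_mul, k]
  have e2 : ∀ v : ℝ, ∑' ρ : Zr, Lap g (1 + v * Complex.I) *
      ((mu ρ : ℂ) * (1 / (1 + v * Complex.I - wz ρ t) + 1 / (1 + v * Complex.I + wz ρ t))) =
      Lap g (1 + v * Complex.I) * (logDeriv XX (1 / 2 + t * Complex.I + (1 + v * Complex.I)) +
        logDeriv XX (1 / 2 - t * Complex.I + (1 + v * Complex.I))) := by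
    intro v
    exact ((D_hasSum t (hre v)).mul_left _).tsum_eq
  simp only [e1, e2] at key
  exact key


lemma log_shift {t : ℝ} (ht : t ≠ 0) {a : ℂ} (ha : ‖a‖ ≤ |t| / 2) :
    ‖Complex.log ((a + t * Complex.I) / 2) - Complex.log (t * Complex.I / 2)‖ ≤ 3 / 2 * (‖a‖ / |t|) := by
  have htc : (t : ℂ) ≠ 0 := by exact_mod_cast ht
  have h0 : (t * Complex.I / 2 : ℂ) ≠ 0 := by simp [htc]
  set z : ℂ := a / (t * Complex.I) with hz
  have hzn : ‖z‖ = ‖a‖ / |t| := by rw [hz, norm_div]; simp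
  have hz2 : ‖z‖ ≤ 1 / 2 := by
    rw [hzn, div_le_iff₀ (abs_pos.2 ht)]; linarith
  have hre : 0 < (1 + z).re := by
    have := (abs_le.1 (Complex.abs_re_le_norm z)).1
    simp; linarith
  have h1 : 1 + z ≠ 0 := by intro h; rw [h] at hre; simp at hre
  have e : (a + t * Complex.I) / 2 = (t * Complex.I / 2) * (1 + z) := by
    rw [hz]; field_simp; ring
  have a1 : |Complex.arg (t * Complex.I / 2)| ≤ Real.pi / 2 := by
    rw [Complex.abs_arg_le_pi_div_two_iff, half_re]; simp
  have a2 : |Complex.arg (1 + z)| < Real.pi / 2 := by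
    rw [Complex.abs_arg_lt_pi_div_two_iff]; exact Or.inl hre
  rw [e, Complex.log_mul h0 h1 (by
    rw [abs_le] at a1; rw [abs_lt] at a2
    constructor <;> linarith [a1.1, a1.2, a2.1, a2.2])]
  rw [add_sub_cancel_left, ← hzn]
  exact Complex.norm_log_one_add_half_le_self hz2

lemma log_pm {t : ℝ} (ht : 0 < t) :
    Complex.log (t * Complex.I / 2) + Complex.log ((-t : ℝ) * Complex.I / 2) = 2 * (Real.log (t / 2) : ℝ) := by
  have e : ((-t : ℝ) * Complex.I / 2 : ℂ) = (starRingEnd ℂ) (t * Complex.I / 2) := by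
    simp [Complex.conj_ofNat]
  have harg : Complex.arg (t * Complex.I / 2) ≠ Real.pi := by
    have a1 : |Complex.arg (t * Complex.I / 2)| ≤ Real.pi / 2 := by
      rw [Complex.abs_arg_le_pi_div_two_iff, half_re]; simp
    intro h
    rw [h, abs_of_pos Real.pi_pos] at a1
    linarith [Real.pi_pos]
  rw [e, Complex.log_conj _ harg, Complex.add_conj, Complex.log_re]
  simp [abs_of_pos ht]

lemma Gpart_log {s : ℂ} (hs : 3 / 2 ≤ s.re) :
    ‖Gpart s - (-(Real.log Real.pi : ℂ) / 2 + Complex.log (s / 2) / 2)‖ ≤ 12 / ‖s‖ := by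
  have hn : 3 / 2 ≤ ‖s‖ := hs.trans (Complex.re_le_norm s)
  have hn1 : ‖s‖ / 3 ≤ ‖s - 1‖ := by
    have := norm_sub_norm_le s 1
    rw [norm_one] at this; linarith
  have hd := digamma_bound (z := s / 2) (by rw [half_re]; linarith)
  have e : Gpart s - (-(Real.log Real.pi : ℂ) / 2 + Complex.log (s / 2) / 2) =
      1 / s + 1 / (s - 1) + (logDeriv Complex.Gamma (s / 2) - Complex.log (s / 2)) / 2 := by
    unfold Gpart; ring
  rw [e]
  have hs0 : 0 < ‖s‖ := by linarith
  have n1 : ‖1 / s‖ = 1 / ‖s‖ := by simp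
  have n2 : ‖1 / (s - 1)‖ ≤ 3 / ‖s‖ := by
    rw [norm_div, norm_one, div_le_div_iff₀ (by linarith) hs0]; linarith
  have n3 : ‖(logDeriv Complex.Gamma (s / 2) - Complex.log (s / 2)) / 2‖ ≤ 6 / ‖s‖ := by
    rw [norm_div, Complex.norm_ofNat]
    have : ‖s / 2‖ = ‖s‖ / 2 := by simp
    rw [this] at hd
    have : 6 / (‖s‖ / 2) = 12 / ‖s‖ := by field_simp; ring
    rw [this] at hd
    have : 12 / ‖s‖ = 2 * (6 / ‖s‖) := by ring
    linarith
  calc _ ≤ ‖1 / s‖ + ‖1 / (s - 1)‖ + ‖(logDeriv Complex.Gamma (s / 2) - Complex.log (s / 2)) / 2‖ := norm_add₃_le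
    _ ≤ 1 / ‖s‖ + 3 / ‖s‖ + 6 / ‖s‖ := by rw [n1]; gcongr
    _ = 10 / ‖s‖ := by ring
    _ ≤ _ := by gcongr; norm_num

lemma Gpart_pair : ∃ C : ℝ, 0 < C ∧ ∀ t : ℝ, 1 ≤ t → ∀ w : ℂ, w.re = 1 →
    ‖Gpart (1 / 2 + t * Complex.I + w) + Gpart (1 / 2 - t * Complex.I + w) - (Real.log (t / (2 * Real.pi)) : ℝ)‖
      ≤ C * ‖w‖ ^ 2 / t := by
  obtain ⟨B, hB, hG⟩ := Gpart_bound
  refine ⟨4 * (2 * B + 30) + 100, by positivity, fun t ht w hw => ?_⟩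
  have ht0 : 0 < t := by linarith
  have hw1 : 1 ≤ ‖w‖ := by have := Complex.re_le_norm w; rwa [hw] at this
  set a : ℂ := 1 / 2 + w with ha
  have han : ‖a‖ ≤ 2 * ‖w‖ := by
    have := norm_add_le (1 / 2 : ℂ) w
    norm_num at this
    simp only [ha]; norm_num; linarith
  have hr1 : (3 / 2 : ℝ) ≤ (1 / 2 + t * Complex.I + w).re := by simp [hw]; norm_num
  have hr2 : (3 / 2 : ℝ) ≤ (1 / 2 - t * Complex.I + w).re := by simp [hw]; norm_num
  have hlog : Real.log (t / (2 * Real.pi)) = Real.log (t / 2) - Real.log Real.pi := by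
    rw [← div_div, Real.log_div (by positivity) (by positivity)]
  by_cases hc : ‖a‖ ≤ t / 2
  · have e1 : (1 / 2 + t * Complex.I + w) = a + t * Complex.I := by rw [ha]; ring
    have e2 : (1 / 2 - t * Complex.I + w) = a + (-t : ℝ) * Complex.I := by rw [ha]; push_cast; ring
    have g1 := Gpart_log hr1
    have g2 := Gpart_log hr2
    rw [e1] at g1 ⊢
    rw [e2] at g2 ⊢
    have s1 := log_shift (t := t) ht0.ne' (a := a) (by rwa [abs_of_pos ht0])
    have s2 := log_shift (t := -t) (by linarith) (a := a) (by rwa [abs_neg, abs_of_pos ht0])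
    rw [abs_of_pos ht0] at s1
    rw [abs_neg, abs_of_pos ht0] at s2
    have hp := log_pm ht0
    have lower : ∀ τ : ℝ, |τ| = t → t / 2 ≤ ‖a + τ * Complex.I‖ := by
      intro τ hτ
      have := norm_sub_norm_le (τ * Complex.I : ℂ) (-a)
      rw [norm_neg] at this
      have h2 : ‖(τ * Complex.I : ℂ)‖ = t := by simp [hτ]
      rw [h2] at this
      rw [sub_neg_eq_add, add_comm] at this
      linarith
    have l1 := lower t (abs_of_pos ht0)
    have l2 := lower (-t) (by rw [abs_neg, abs_of_pos ht0])
    have b1 : 12 / ‖a + t * Complex.I‖ ≤ 24 / t := by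
      rw [div_le_div_iff₀ (by linarith) ht0]; linarith
    have b2 : 12 / ‖a + (-t : ℝ) * Complex.I‖ ≤ 24 / t := by
      rw [div_le_div_iff₀ (by linarith) ht0]; linarith
    set G1 := Gpart (a + t * Complex.I)
    set G2 := Gpart (a + (-t : ℝ) * Complex.I)
    set L1 := Complex.log ((a + t * Complex.I) / 2)
    set L2 := Complex.log ((a + (-t : ℝ) * Complex.I) / 2)
    have e : G1 + G2 - (Real.log (t / (2 * Real.pi)) : ℝ) =
        (G1 - (-(Real.log Real.pi : ℂ) / 2 + L1 / 2)) + (G2 - (-(Real.log Real.pi : ℂ) / 2 + L2 / 2)) +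
        (1 / 2 * (L1 - Complex.log (t * Complex.I / 2)) + 1 / 2 * (L2 - Complex.log ((-t : ℝ) * Complex.I / 2))) := by
      rw [hlog]; push_cast at hp ⊢; linear_combination (1 / 2) * hp
    rw [e]
    have n3 : ‖1 / 2 * (L1 - Complex.log (t * Complex.I / 2)) + 1 / 2 * (L2 - Complex.log ((-t : ℝ) * Complex.I / 2))‖
        ≤ 3 / 2 * (‖a‖ / t) := by
      refine (norm_add_le _ _).trans ?_
      rw [norm_mul, norm_mul, show ‖(1 / 2 : ℂ)‖ = 1 / 2 by norm_num]
      linarith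
    calc _ ≤ 24 / t + 24 / t + 3 / 2 * (‖a‖ / t) := by
            refine (norm_add₃_le).trans ?_
            gcongr
            · exact g1.trans b1
            · exact g2.trans b2
      _ = (48 + 3 / 2 * ‖a‖) / t := by ring
      _ ≤ _ := by
          gcongr
          nlinarith
  · push Not at hc
    have nb : ∀ τ : ℂ, ‖τ‖ = t → ‖1 / 2 + τ + w‖ ≤ 6 * ‖w‖ := by
      intro τ hτ
      have : 1 / 2 + τ + w = a + τ := by rw [ha]; ring
      rw [this]
      have := norm_add_le a τ
      linarith
    have n1 := nb (t * Complex.I) (by simp [abs_of_pos ht0])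
    have n2 := nb (-(t * Complex.I)) (by simp [abs_of_pos ht0])
    rw [← sub_eq_add_neg] at n2
    have lg : ∀ x : ℝ, 0 ≤ x → x ≤ 6 * ‖w‖ → Real.log (x + 2) ≤ 7 * ‖w‖ := by
      intro x hx h
      have := Real.log_le_sub_one_of_pos (show 0 < x + 2 by linarith)
      linarith
    have m1 := (hG _ hr1).trans (add_le_add_right (lg _ (norm_nonneg _) n1) B)
    have m2 := (hG _ hr2).trans (add_le_add_right (lg _ (norm_nonneg _) n2) B)
    have m3 : |Real.log (t / (2 * Real.pi))| ≤ 4 * ‖w‖ + 6 := by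
      rw [Real.log_div ht0.ne' (by positivity)]
      have h1 : 0 ≤ Real.log t := Real.log_nonneg ht
      have h2 := Real.log_le_sub_one_of_pos ht0
      have h3 : 0 ≤ Real.log (2 * Real.pi) := Real.log_nonneg (by linarith [Real.pi_gt_three])
      have h4 := Real.log_le_sub_one_of_pos (show 0 < 2 * Real.pi by positivity)
      rw [abs_le]; constructor <;> linarith [Real.pi_lt_d2]
    have tot : ‖Gpart (1 / 2 + t * Complex.I + w) + Gpart (1 / 2 - t * Complex.I + w) - (Real.log (t / (2 * Real.pi)) : ℝ)‖
        ≤ (2 * B + 30) * ‖w‖ := by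
      refine (norm_sub_le _ _).trans ?_
      rw [Complex.norm_real, Real.norm_eq_abs]
      have := norm_add_le (Gpart (1 / 2 + t * Complex.I + w)) (Gpart (1 / 2 - t * Complex.I + w))
      nlinarith
    refine tot.trans ?_
    rw [le_div_iff₀ ht0]
    have h5 : t ≤ 4 * ‖w‖ := by linarith
    have h6 : (2 * B + 30) * ‖w‖ * t ≤ (2 * B + 30) * ‖w‖ * (4 * ‖w‖) := by gcongr
    nlinarith [sq_nonneg ‖w‖]

/-- prime sum -/
noncomputable def PP (g : ℝ → ℝ) (N : ℕ) (t : ℝ) : ℝ :=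
  ∑ n ∈ Finset.range N, ArithmeticFunction.vonMangoldt n / √n * g (Real.log n) * (2 * Real.cos (t * Real.log n))

lemma prime_side {g : ℝ → ℝ} (h : TF g) {N : ℕ} (hN : ∀ n : ℕ, N ≤ n → g (Real.log n) = 0) (t : ℝ) :
    ∫ v : ℝ, Lap g (1 + v * Complex.I) * LLam (1 / 2 + t * Complex.I + (1 + v * Complex.I)) =
      2 * Real.pi * ∑ n ∈ Finset.range N, ((ArithmeticFunction.vonMangoldt n / √n * g (Real.log n) : ℝ) : ℂ) *
        Complex.exp (-(t * Real.log n : ℝ) * Complex.I) := by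
  have hs : LSeriesSummable (fun n => (ArithmeticFunction.vonMangoldt n : ℂ)) ((3 / 2 : ℝ) : ℂ) :=
    ArithmeticFunction.LSeriesSummable_vonMangoldt (by norm_num)
  have hc := lap_cont h
  set f := fun n => (ArithmeticFunction.vonMangoldt n : ℂ)
  have tm : ∀ (n : ℕ) (v : ℝ), LSeries.term f (1 / 2 + t * Complex.I + (1 + v * Complex.I)) n =
      ((ArithmeticFunction.vonMangoldt n / √n : ℝ) : ℂ) * Complex.exp (-(t * Real.log n : ℝ) * Complex.I) *
        Complex.exp (-(1 + v * Complex.I) * (Real.log n : ℝ)) := by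
    intro n v
    rcases Nat.eq_zero_or_pos n with rfl | hn
    · simp
    rw [LSeries.term_of_ne_zero hn.ne']
    have hn0 : (n : ℂ) ≠ 0 := by exact_mod_cast hn.ne'
    have hnp : (0 : ℝ) < n := by exact_mod_cast hn
    have sq : ((√n : ℝ) : ℂ) = Complex.exp (Complex.log n / 2) := by
      have : √(n : ℝ) = Real.exp (Real.log n / 2) := by
        rw [Real.exp_half, Real.exp_log hnp]
      rw [this]; push_cast; rfl
    rw [Complex.cpow_def_of_ne_zero hn0]
    push_cast
    simp only [f]
    rw [sq, div_eq_mul_inv, div_eq_mul_inv (ArithmeticFunction.vonMangoldt n : ℂ) (Complex.exp _),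
      ← Complex.exp_neg, ← Complex.exp_neg]
    rw [mul_assoc, mul_assoc, ← Complex.exp_add, ← Complex.exp_add]
    congr 2
    ring
  have hb : ∀ (n : ℕ) (v : ℝ), ‖LSeries.term f (1 / 2 + t * Complex.I + (1 + v * Complex.I)) n‖ ≤
      ‖LSeries.term f ((3 / 2 : ℝ) : ℂ) n‖ := fun n v =>
    LSeries.norm_term_le_of_re_le_re _ (by simp; norm_num) n
  have hi := (lap_vert_int0 h 1)
  have hint : ∀ n : ℕ, Integrable (fun v : ℝ => Lap g (1 + v * Complex.I) *
      LSeries.term f (1 / 2 + t * Complex.I + (1 + v * Complex.I)) n) := by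
    intro n
    refine hi.mul_bdd (c := ‖LSeries.term f ((3 / 2 : ℝ) : ℂ) n‖) ?_ (Eventually.of_forall (hb n))
    simp_rw [tm]
    exact Continuous.aestronglyMeasurable (by fun_prop)
  have hsum : Summable fun n : ℕ => ∫ v : ℝ, ‖Lap g (1 + v * Complex.I) *
      LSeries.term f (1 / 2 + t * Complex.I + (1 + v * Complex.I)) n‖ := by
    refine Summable.of_nonneg_of_le (fun n => integral_nonneg fun v => norm_nonneg _)
      (fun n => integral_mono (hint n).norm (hi.norm.mul_const ‖LSeries.term f ((3 / 2 : ℝ) : ℂ) n‖) fun v => ?_) ?_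
    · simp only [norm_mul]; gcongr; exact hb n v
    · simp_rw [integral_mul_const]
      exact hs.norm.mul_left _
  have key := hasSum_integral_of_summable_integral_norm hint hsum
  have e1 : ∀ n : ℕ, ∫ v : ℝ, Lap g (1 + v * Complex.I) *
      LSeries.term f (1 / 2 + t * Complex.I + (1 + v * Complex.I)) n =
      2 * Real.pi * (((ArithmeticFunction.vonMangoldt n / √n * g (Real.log n) : ℝ) : ℂ) *
        Complex.exp (-(t * Real.log n : ℝ) * Complex.I)) := by
    intro n
    have k := lap_inv h 1 (Real.log n)
    simp_rw [tm, mul_left_comm (Lap g _)]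
    rw [integral_const_mul, k]
    push_cast; ring
  have e2 : ∀ v : ℝ, ∑' n : ℕ, Lap g (1 + v * Complex.I) *
      LSeries.term f (1 / 2 + t * Complex.I + (1 + v * Complex.I)) n =
      Lap g (1 + v * Complex.I) * LLam (1 / 2 + t * Complex.I + (1 + v * Complex.I)) := by
    intro v
    rw [tsum_mul_left]; rfl
  simp only [e1, e2] at key
  rw [Finset.mul_sum, ← key.tsum_eq]
  refine tsum_eq_sum fun n hn => ?_
  rw [hN n (by simpa using hn)]; simp


lemma LLam_diffOn : DifferentiableOn ℂ LLam {s : ℂ | 5 / 4 < s.re} := by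
  have hs : LSeriesSummable (fun n => (ArithmeticFunction.vonMangoldt n : ℂ)) ((5 / 4 : ℝ) : ℂ) :=
    ArithmeticFunction.LSeriesSummable_vonMangoldt (by norm_num)
  refine (LSeries_differentiableOn (fun n => (ArithmeticFunction.vonMangoldt n : ℂ))).mono fun s h => ?_
  refine lt_of_le_of_lt hs.abscissaOfAbsConv_le ?_
  simpa using h

lemma Gpart_diffOn : DifferentiableOn ℂ Gpart {s : ℂ | 5 / 4 < s.re} := by
  intro s hs
  have hs' : 5 / 4 < s.re := hs
  have h0 : s ≠ 0 := by rintro rfl; simp at hs'; linarith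
  have h1 : s - 1 ≠ 0 := by
    intro h
    rw [sub_eq_zero] at h
    rw [h] at hs'; norm_num at hs'
  have hs2 : 0 < (s / 2).re := by rw [half_re]; linarith
  have hop : IsOpen {s : ℂ | 0 < s.re} := isOpen_lt continuous_const Complex.continuous_re
  have hG : DifferentiableOn ℂ Complex.Gamma {s : ℂ | 0 < s.re} := fun z hz =>
    (gamma_diffAt hz).differentiableWithinAt
  have hG' := (hG.deriv hop).differentiableAt (hop.mem_nhds hs2)
  have hl : DifferentiableAt ℂ (logDeriv Complex.Gamma) (s / 2) :=
    hG'.div (gamma_diffAt hs2) (Complex.Gamma_ne_zero_of_re_pos hs2)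
  have hl2 : DifferentiableAt ℂ (fun s => logDeriv Complex.Gamma (s / 2)) s :=
    DifferentiableAt.comp (g := logDeriv Complex.Gamma) (f := fun s : ℂ => s / 2) s hl (by fun_prop)
  refine DifferentiableAt.differentiableWithinAt ?_
  unfold Gpart
  fun_prop (disch := assumption)

lemma vert_cont {f : ℂ → ℂ} (hf : DifferentiableOn ℂ f {s : ℂ | 5 / 4 < s.re}) (t : ℝ) :
    Continuous fun v : ℝ => f (1 / 2 + t * Complex.I + (1 + v * Complex.I)) := by
  refine continuous_iff_continuousAt.2 fun v => ?_
  have hop : IsOpen {s : ℂ | 5 / 4 < s.re} := isOpen_lt continuous_const Complex.continuous_re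
  have h1 : ContinuousAt f (1 / 2 + t * Complex.I + (1 + v * Complex.I)) :=
    (hf.differentiableAt (hop.mem_nhds (by simp; norm_num))).continuousAt
  exact ContinuousAt.comp (f := fun v : ℝ => (1 / 2 + t * Complex.I + (1 + v * Complex.I) : ℂ)) h1 (by fun_prop)

lemma explicit2 : ∃ C : ℝ, 0 < C ∧ ∀ g : ℝ → ℝ, TF g → (∀ u, g (-u) = g u) → ∀ N : ℕ,
    (∀ n : ℕ, N ≤ n → g (Real.log n) = 0) → ∀ t : ℝ, 1 ≤ t →
    ‖HH g t - ((g 0 * Real.log (t / (2 * Real.pi)) - PP g N t : ℝ) : ℂ)‖ ≤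
      C / t * ∫ v : ℝ, ‖Lap g (1 + v * Complex.I)‖ * ‖1 + v * Complex.I‖ ^ 2 := by
  obtain ⟨C, hC, hG⟩ := Gpart_pair
  obtain ⟨B, hB, hL⟩ := LLam_bound
  refine ⟨C, hC, fun g h heven N hN t ht => ?_⟩
  have hc := lap_cont h
  have ht0 : 0 < t := by linarith
  have hi := lap_vert_int0 h 1
  have hi2 := lap_vert_int h 1 2
  have key := (explicit1 h heven t).tsum_eq
  rw [tsum_mul_left] at key
  have em : ∀ v : ℝ, (1 / 2 - t * Complex.I + (1 + v * Complex.I) : ℂ) =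
      1 / 2 + (-t : ℝ) * Complex.I + (1 + v * Complex.I) := by intro v; push_cast; ring
  have p1 := prime_side h hN t
  have p2 := prime_side h hN (-t)
  have iL : ∀ t : ℝ, Integrable fun v : ℝ => Lap g (1 + v * Complex.I) *
      LLam (1 / 2 + t * Complex.I + (1 + v * Complex.I)) := by
    intro t
    refine hi.mul_bdd (c := B) (vert_cont LLam_diffOn t).aestronglyMeasurable (Eventually.of_forall fun v => ?_)
    exact hL _ (by simp; norm_num)
  set ℓ : ℂ := ((Real.log (t / (2 * Real.pi)) : ℝ) : ℂ) with hℓ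
  set R : ℝ → ℂ := fun v => Gpart (1 / 2 + t * Complex.I + (1 + v * Complex.I)) +
    Gpart (1 / 2 - t * Complex.I + (1 + v * Complex.I)) - ℓ with hR
  have hRb : ∀ v : ℝ, ‖Lap g (1 + v * Complex.I) * R v‖ ≤
      C / t * (‖Lap g (1 + v * Complex.I)‖ * ‖1 + v * Complex.I‖ ^ 2) := by
    intro v
    rw [norm_mul]
    have := hG t ht (1 + v * Complex.I) (by simp)
    calc _ ≤ ‖Lap g (1 + v * Complex.I)‖ * (C * ‖1 + v * Complex.I‖ ^ 2 / t) := by gcongr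
      _ = _ := by ring
  have iR : Integrable fun v : ℝ => Lap g (1 + v * Complex.I) * R v := by
    refine (hi2.const_mul (C / t)).mono' (Continuous.aestronglyMeasurable ?_) (Eventually.of_forall hRb)
    have c1 := vert_cont Gpart_diffOn t
    have c2 := vert_cont Gpart_diffOn (-t)
    simp_rw [← em] at c2
    fun_prop
  have dec : ∀ v : ℝ, Lap g (1 + v * Complex.I) * (logDeriv XX (1 / 2 + t * Complex.I + (1 + v * Complex.I)) +
        logDeriv XX (1 / 2 - t * Complex.I + (1 + v * Complex.I))) =
      (Lap g (1 + v * Complex.I) * R v + Lap g (1 + v * Complex.I) * ℓ) -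
      (Lap g (1 + v * Complex.I) * LLam (1 / 2 + t * Complex.I + (1 + v * Complex.I)) +
       Lap g (1 + v * Complex.I) * LLam (1 / 2 + (-t : ℝ) * Complex.I + (1 + v * Complex.I))) := by
    intro v
    rw [logDeriv_XX (s := 1 / 2 + t * Complex.I + (1 + v * Complex.I)) (by simp), logDeriv_XX (s := 1 / 2 - t * Complex.I + (1 + v * Complex.I)) (by simp), ← em, hR]
    ring
  simp_rw [dec] at key
  have ia : Integrable fun v : ℝ => Lap g (1 + v * Complex.I) * R v + Lap g (1 + v * Complex.I) * ℓ :=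
    iR.add (hi.mul_const ℓ)
  have ib : Integrable fun v : ℝ => Lap g (1 + v * Complex.I) * LLam (1 / 2 + t * Complex.I + (1 + v * Complex.I)) +
       Lap g (1 + v * Complex.I) * LLam (1 / 2 + (-t : ℝ) * Complex.I + (1 + v * Complex.I)) := (iL t).add (iL (-t))
  rw [integral_sub ia ib, integral_add iR (hi.mul_const ℓ),
    integral_add (iL t) (iL (-t)), p1, p2, integral_mul_const] at key
  have k0 := lap_inv h 1 0
  simp only [Complex.ofReal_zero, mul_zero, Complex.exp_zero, mul_one] at k0
  rw [k0] at key
  have hcos : (∑ n ∈ Finset.range N, ((ArithmeticFunction.vonMangoldt n / √n * g (Real.log n) : ℝ) : ℂ) *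
        Complex.exp (-(t * Real.log n : ℝ) * Complex.I)) +
      (∑ n ∈ Finset.range N, ((ArithmeticFunction.vonMangoldt n / √n * g (Real.log n) : ℝ) : ℂ) *
        Complex.exp (-((-t) * Real.log n : ℝ) * Complex.I)) = (PP g N t : ℂ) := by
    rw [← Finset.sum_add_distrib, PP, Complex.ofReal_sum]
    refine Finset.sum_congr rfl fun n _ => ?_
    rw [Complex.ofReal_mul _ (2 * Real.cos _), Complex.ofReal_mul 2, Complex.ofReal_cos, Complex.cos]
    push_cast
    rw [show -(-(t : ℂ) * Complex.log n) * Complex.I = t * Complex.log n * Complex.I by ring, neg_mul]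
    ring
  have hpi : (Real.pi : ℂ) ≠ 0 := by exact_mod_cast Real.pi_ne_zero
  have fin : HH g t - ((g 0 * Real.log (t / (2 * Real.pi)) - PP g N t : ℝ) : ℂ) =
      (1 / (2 * Real.pi)) * ∫ v : ℝ, Lap g (1 + v * Complex.I) * R v := by
    have : HH g t = ∑' ρ : Zr, (mu ρ : ℂ) * Lap g (wz ρ t) := rfl
    rw [← this] at key
    rw [Complex.ofReal_sub, ← hcos, Complex.ofReal_mul, ← hℓ]
    generalize (∫ v : ℝ, Lap g (1 + v * Complex.I) * R v) = J at key ⊢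
    rw [one_div, eq_inv_mul_iff_mul_eq₀ (by simp [hpi])]
    linear_combination key
  rw [fin, norm_mul]
  have hp1 : ‖(1 / (2 * Real.pi) : ℂ)‖ ≤ 1 := by
    rw [norm_div, norm_mul, norm_one, Complex.norm_real, Complex.norm_ofNat, Real.norm_eq_abs, abs_of_pos Real.pi_pos,
      div_le_one (by positivity)]
    linarith [Real.pi_gt_three]
  have hI : ‖∫ v : ℝ, Lap g (1 + v * Complex.I) * R v‖ ≤
      C / t * ∫ v : ℝ, ‖Lap g (1 + v * Complex.I)‖ * ‖1 + v * Complex.I‖ ^ 2 := by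
    rw [← integral_const_mul]
    exact norm_integral_le_of_norm_le (hi2.const_mul _) (Eventually.of_forall hRb)
  calc _ ≤ 1 * ‖∫ v : ℝ, Lap g (1 + v * Complex.I) * R v‖ := by gcongr
    _ ≤ _ := by rw [one_mul]; exact hI

/-- scaled test function -/
noncomputable def sc (r : ℝ → ℝ) (L : ℝ) (u : ℝ) : ℝ := r (u / L)

lemma sc_TF {r : ℝ → ℝ} (h : TF r) {L : ℝ} (hL : 0 < L) : TF (sc r L) := by
  constructor
  · have := h.smooth
    unfold sc
    fun_prop
  · have := h.cpt.comp_homeomorph (Homeomorph.mulRight₀ L⁻¹ (by positivity))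
    exact this

lemma sc_lap (r : ℝ → ℝ) {L : ℝ} (hL : 0 < L) (w : ℂ) : Lap (sc r L) w = L * Lap r (L * w) := by
  unfold Lap sc
  have := MeasureTheory.Measure.integral_comp_div (fun u : ℝ => (r u : ℂ) * Complex.exp (L * w * u)) L
  rw [abs_of_pos hL, Complex.real_smul] at this
  rw [← this]
  have hLc : (L : ℂ) ≠ 0 := by exact_mod_cast hL.ne'
  congr 1; ext u
  congr 2
  push_cast
  field_simp

lemma sc_lap_decay {r : ℝ → ℝ} (h : TF r) {A : ℝ} (hA : ∀ u, A < |u| → r u = 0) (k : ℕ) :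
    ∃ C : ℝ, 0 < C ∧ ∀ L : ℝ, 1 ≤ L → ∀ w : ℂ,
      ‖Lap (sc r L) w‖ * (1 + ‖w‖) ^ k ≤ C * L * Real.exp (A * (L * |w.re|)) := by
  obtain ⟨C, hC, hb⟩ := lap_decay h hA k
  refine ⟨C, hC, fun L hL w => ?_⟩
  have hL0 : 0 < L := by linarith
  have := hb (L * w)
  rw [sc_lap r hL0, norm_mul, Complex.norm_real, Real.norm_eq_abs, abs_of_pos hL0]
  rw [Complex.re_ofReal_mul, abs_mul, abs_of_pos hL0, norm_mul, Complex.norm_real, Real.norm_eq_abs, abs_of_pos hL0] at this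
  have h2 : (1 + ‖w‖) ^ k ≤ (1 + L * ‖w‖) ^ k := by
    gcongr
    nlinarith [norm_nonneg w]
  calc L * ‖Lap r (L * w)‖ * (1 + ‖w‖) ^ k ≤ L * (‖Lap r (L * w)‖ * (1 + L * ‖w‖) ^ k) := by
        rw [mul_assoc]; gcongr
    _ ≤ L * (C * Real.exp (A * (L * |w.re|))) := by gcongr
    _ = _ := by ring

lemma sc_int_bound {r : ℝ → ℝ} (h : TF r) {A : ℝ} (hA : ∀ u, A < |u| → r u = 0) :
    ∃ C : ℝ, 0 < C ∧ ∀ L : ℝ, 1 ≤ L →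
      ∫ v : ℝ, ‖Lap (sc r L) (1 + v * Complex.I)‖ * ‖1 + v * Complex.I‖ ^ 2 ≤ C * L * Real.exp (A * L) := by
  obtain ⟨C, hC, hb⟩ := sc_lap_decay h hA 4
  have hI := int_pow_bound 2 le_rfl
  have hJ : 0 ≤ ∫ v : ℝ, 1 / (1 + |v|) ^ 2 := integral_nonneg fun v => by positivity
  refine ⟨C * ((∫ v : ℝ, 1 / (1 + |v|) ^ 2) + 1), by positivity, fun L hL => ?_⟩
  have hL0 : 0 < L := by linarith
  have b : ∀ v : ℝ, ‖Lap (sc r L) (1 + v * Complex.I)‖ * ‖1 + v * Complex.I‖ ^ 2 ≤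
      (C * L * Real.exp (A * L)) * (1 / (1 + |v|) ^ 2) := by
    intro v
    have h1 := hb L hL (1 + v * Complex.I)
    have hre : (1 + v * Complex.I : ℂ).re = 1 := by simp
    rw [hre, abs_one, mul_one] at h1
    have hv : |v| ≤ ‖(1 + v * Complex.I : ℂ)‖ := by
      have := Complex.abs_im_le_norm (1 + v * Complex.I : ℂ)
      simpa using this
    rw [mul_one_div, le_div_iff₀ (by positivity)]
    refine le_trans ?_ h1
    rw [mul_assoc]
    gcongr
    calc ‖(1 + v * Complex.I : ℂ)‖ ^ 2 * (1 + |v|) ^ 2 ≤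
        (1 + ‖(1 + v * Complex.I : ℂ)‖) ^ 2 * (1 + ‖(1 + v * Complex.I : ℂ)‖) ^ 2 := by
          gcongr
          linarith
      _ = _ := by ring
  calc _ ≤ ∫ v : ℝ, (C * L * Real.exp (A * L)) * (1 / (1 + |v|) ^ 2) :=
        integral_mono (lap_vert_int (sc_TF h hL0) 1 2) (hI.const_mul _) b
    _ = (C * L * Real.exp (A * L)) * ∫ v : ℝ, 1 / (1 + |v|) ^ 2 := integral_const_mul _ _
    _ ≤ (C * L * Real.exp (A * L)) * ((∫ v : ℝ, 1 / (1 + |v|) ^ 2) + 1) := by gcongr; linarith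
    _ = _ := by ring

/-- main term on the prime side -/
noncomputable def MM (r : ℝ → ℝ) (N : ℕ) (L t : ℝ) : ℝ := r 0 * Real.log (t / (2 * Real.pi)) - PP (sc r L) N t

lemma explicit3 {r : ℝ → ℝ} (h : TF r) (heven : ∀ u, r (-u) = r u) {A : ℝ} (hA : ∀ u, A < |u| → r u = 0) :
    ∃ C : ℝ, 0 < C ∧ ∀ L : ℝ, 1 ≤ L → ∀ N : ℕ, Real.exp (A * L) < N → ∀ t : ℝ, Real.exp L ≤ t →
      ‖HH (sc r L) t - (MM r N L t : ℝ)‖ ≤ C * L * Real.exp ((A - 1) * L) := by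
  obtain ⟨C1, hC1, h1⟩ := explicit2
  obtain ⟨C2, hC2, h2⟩ := sc_int_bound h hA
  refine ⟨C1 * C2, by positivity, fun L hL N hN t ht => ?_⟩
  have hL0 : 0 < L := by linarith
  have ht1 : 1 ≤ t := by
    have := Real.add_one_le_exp L; linarith
  have := h1 (sc r L) (sc_TF h hL0) (fun u => by unfold sc; rw [neg_div, heven]) N (by
    intro n hn
    refine hA _ ?_
    have : Real.exp (A * L) < n := lt_of_lt_of_le hN (by exact_mod_cast hn)
    have h3 := (Real.lt_log_iff_exp_lt (by linarith [Real.exp_pos (A * L)])).2 this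
    refine lt_of_lt_of_le ?_ (le_abs_self _)
    rwa [lt_div_iff₀ hL0]) t ht1
  have e : sc r L 0 = r 0 := by simp [sc]
  rw [e] at this
  refine this.trans ?_
  calc _ ≤ C1 / Real.exp L * (C2 * L * Real.exp (A * L)) := by
        gcongr
        exact h2 L hL
    _ = _ := by
        rw [show (A - 1) * L = A * L - L by ring, Real.exp_sub]; field_simp


lemma cos_int {x : ℝ} (hx : x ≠ 0) (S T : ℝ) : |∫ t in S..T, Real.cos (t * x)| ≤ 2 / |x| := by
  rw [intervalIntegral.integral_comp_mul_right _ hx, integral_cos, smul_eq_mul, abs_mul, abs_inv, inv_mul_eq_div]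
  gcongr
  have h1 := Real.abs_sin_le_one (T * x)
  have h2 := Real.abs_sin_le_one (S * x)
  have := abs_sub (Real.sin (T * x)) (Real.sin (S * x))
  linarith

lemma log_cos_int {x T : ℝ} (hx : 0 < x) (hT : 2 * Real.pi ≤ T) :
    |∫ t in T..(2 * T), Real.log (t / (2 * Real.pi)) * Real.cos (t * x)| ≤ (2 * Real.log T + 1) / x := by
  have hp := Real.pi_gt_three
  have hT0 : 0 < T := by linarith
  have hpos : ∀ t ∈ uIcc T (2 * T), 0 < t := by
    intro t ht
    rw [uIcc_of_le (by linarith)] at ht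
    linarith [ht.1]
  have hd : ∀ t ∈ uIcc T (2 * T), HasDerivAt (fun t => Real.log (t / (2 * Real.pi)) * (Real.sin (t * x) / x))
      (1 / t * (Real.sin (t * x) / x) + Real.log (t / (2 * Real.pi)) * Real.cos (t * x)) t := by
    intro t ht
    have h0 := hpos t ht
    have d1 : HasDerivAt (fun t => Real.log (t / (2 * Real.pi))) (1 / t) t := by
      have := ((hasDerivAt_id' t).div_const (2 * Real.pi)).log (by simp [h0.ne'])
      convert this using 1
      field_simp
    have d2 : HasDerivAt (fun t => Real.sin (t * x) / x) (Real.cos (t * x)) t := by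
      have := (((hasDerivAt_id' t).mul_const x).sin).div_const x
      rwa [one_mul, mul_div_assoc, div_self hx.ne', mul_one] at this
    exact d1.mul d2
  have c1 : ContinuousOn (fun t : ℝ => 1 / t * (Real.sin (t * x) / x)) (uIcc T (2 * T)) := by
    refine ContinuousOn.mul (continuousOn_const.div continuousOn_id fun t ht => (hpos t ht).ne') ?_
    fun_prop
  have c2 : ContinuousOn (fun t : ℝ => Real.log (t / (2 * Real.pi)) * Real.cos (t * x)) (uIcc T (2 * T)) := by
    refine ContinuousOn.mul (ContinuousOn.log (by fun_prop) fun t ht => ?_) (by fun_prop)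
    have := hpos t ht
    positivity
  have key := intervalIntegral.integral_eq_sub_of_hasDerivAt hd (c1.add c2).intervalIntegrable
  rw [intervalIntegral.integral_add c1.intervalIntegrable c2.intervalIntegrable] at key
  have b1 : ‖∫ t in T..(2 * T), 1 / t * (Real.sin (t * x) / x)‖ ≤ (1 / T * (1 / x)) * |2 * T - T| := by
    refine intervalIntegral.norm_integral_le_of_norm_le_const fun t ht => ?_
    rw [uIoc_of_le (by linarith)] at ht
    rw [Real.norm_eq_abs, abs_mul, abs_div, abs_div, abs_of_pos hx, abs_one, abs_of_pos (by linarith [ht.1] : 0 < t)]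
    gcongr
    · exact ht.1.le
    · exact Real.abs_sin_le_one _
  have b2 : (1 / T * (1 / x)) * |2 * T - T| = 1 / x := by
    rw [show 2 * T - T = T by ring, abs_of_pos hT0]; field_simp
  rw [b2, Real.norm_eq_abs] at b1
  have lg : ∀ t, T ≤ t → t ≤ 2 * T → |Real.log (t / (2 * Real.pi)) * (Real.sin (t * x) / x)| ≤ Real.log T / x := by
    intro t h1 h2
    have g1 : 0 ≤ Real.log (t / (2 * Real.pi)) := Real.log_nonneg (by rw [le_div_iff₀ (by positivity)]; linarith)
    have g2 : Real.log (t / (2 * Real.pi)) ≤ Real.log T := by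
      refine Real.log_le_log (div_pos (by linarith) (by positivity)) ?_
      rw [div_le_iff₀ (by positivity)]; nlinarith
    rw [abs_mul, abs_div, abs_of_pos hx, abs_of_nonneg g1]
    calc _ ≤ Real.log T * (1 / x) := by
          gcongr
          · exact g1.trans g2
          · exact Real.abs_sin_le_one _
      _ = _ := by ring
  have l1 := lg T le_rfl (by linarith)
  have l2 := lg (2 * T) (by linarith) le_rfl
  have e : (2 * Real.log T + 1) / x = Real.log T / x + Real.log T / x + 1 / x := by ring
  rw [e]
  rw [abs_le] at *
  constructor <;> linarith [l1.1, l1.2, l2.1, l2.2, b1.1, b1.2]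

lemma sum_inv_sqrt (N : ℕ) : ∑ n ∈ Finset.range N, 1 / √(n : ℝ) ≤ 2 * √N := by
  have h : ∀ N : ℕ, ∑ n ∈ Finset.range (N + 1), 1 / √(n : ℝ) ≤ 2 * √N := by
    intro N
    induction N with
    | zero => simp
    | succ N ih =>
      rw [Finset.sum_range_succ]
      have h1 : 0 < √((N + 1 : ℕ) : ℝ) := Real.sqrt_pos.2 (by positivity)
      have h2 : √((N + 1 : ℕ) : ℝ) ^ 2 = N + 1 := by rw [Real.sq_sqrt (by positivity)]; push_cast; rfl
      have h3 : √(N : ℝ) ^ 2 = N := Real.sq_sqrt (by positivity)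
      have h4 : 1 / √((N + 1 : ℕ) : ℝ) ≤ 2 * √((N + 1 : ℕ) : ℝ) - 2 * √(N : ℝ) := by
        rw [div_le_iff₀ h1]
        nlinarith [sq_nonneg (√((N + 1 : ℕ) : ℝ) - √(N : ℝ))]
      linarith
  refine le_trans ?_ (h N)
  rw [Finset.sum_range_succ]
  have : 0 ≤ 1 / √(N : ℝ) := by positivity
  linarith

lemma sum_inv_diff (N : ℕ) : ∑ n ∈ Finset.range N, ∑ m ∈ Finset.range N,
    (if n = m then 0 else 1 / |(n : ℝ) - m|) ≤ 2 * N * (1 + Real.log N) := by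
  have hh : ∀ N : ℕ, ∑ m ∈ Finset.range N, 1 / |(N : ℝ) - m| ≤ 1 + Real.log N := by
    intro N
    have h1 := harmonic_le_one_add_log N
    refine le_trans (le_of_eq ?_) h1
    rw [harmonic, ← Finset.sum_range_reflect]
    push_cast
    refine Finset.sum_congr rfl fun m hm => ?_
    have hm' : m < N := by simpa using hm
    rw [Nat.cast_sub (by omega), Nat.cast_sub (by omega), one_div]
    congr 1
    rw [abs_of_nonneg (by push_cast; linarith)]
    push_cast; ring
  induction N with
  | zero => simp
  | succ N ih =>
    rw [Finset.sum_range_succ]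
    simp_rw [Finset.sum_range_succ _ N]
    rw [Finset.sum_add_distrib]
    have e1 : ∑ x ∈ Finset.range N, (if x = N then (0:ℝ) else 1 / |(x : ℝ) - N|) = ∑ m ∈ Finset.range N, 1 / |(N : ℝ) - m| := by
      refine Finset.sum_congr rfl fun m hm => ?_
      have hm' : m < N := by simpa using hm
      rw [if_neg (by omega), abs_sub_comm]
    have e2 : ∑ x ∈ Finset.range N, (if N = x then (0:ℝ) else 1 / |(N : ℝ) - x|) = ∑ m ∈ Finset.range N, 1 / |(N : ℝ) - m| := by
      refine Finset.sum_congr rfl fun m hm => ?_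
      have hm' : m < N := by simpa using hm
      rw [if_neg (by omega)]
    rw [e1, e2]
    simp only [if_true]
    have h0 := hh N
    rcases Nat.eq_zero_or_pos N with rfl | hN
    · simp
    have hl : Real.log N ≤ Real.log ((N + 1 : ℕ) : ℝ) :=
      Real.log_le_log (by exact_mod_cast hN) (by push_cast; linarith)
    have hN0 : (0 : ℝ) ≤ N := by positivity
    push_cast at hl ⊢
    nlinarith

lemma pair_aux {n m : ℝ} (hm : 1 ≤ m) (hmn : m < n) :
    1 / √n * (1 / √m) * (1 / |Real.log n - Real.log m|) ≤ 1 / |n - m| + 1 / √n * (1 / √m) := by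
  have hm0 : 0 < m := by linarith
  have hn0 : 0 < n := by linarith
  have hp : 0 < √n := Real.sqrt_pos.2 hn0
  have hq : 0 < √m := Real.sqrt_pos.2 hm0
  have hp2 : √n ^ 2 = n := Real.sq_sqrt hn0.le
  have hq2 : √m ^ 2 = m := Real.sq_sqrt hm0.le
  have hqp : √m ≤ √n := Real.sqrt_le_sqrt hmn.le
  have hd : 0 < n - m := by linarith
  have hlog : (n - m) / n ≤ Real.log n - Real.log m := by
    have := Real.one_sub_inv_le_log_of_pos (show 0 < n / m by positivity)
    rw [Real.log_div hn0.ne' hm0.ne'] at this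
    refine le_trans (le_of_eq ?_) this
    field_simp
  have hlp : 0 < (n - m) / n := by positivity
  rw [abs_of_pos (hlp.trans_le hlog), abs_of_pos hd]
  calc 1 / √n * (1 / √m) * (1 / (Real.log n - Real.log m)) ≤ 1 / √n * (1 / √m) * (1 / ((n - m) / n)) := by gcongr
    _ ≤ _ := by
      have e : 1 / √n * (1 / √m) * (1 / ((n - m) / n)) = n / (√n * √m * (n - m)) := by field_simp
      have e2 : 1 / (n - m) + 1 / √n * (1 / √m) = (√n * √m + (n - m)) / (√n * √m * (n - m)) := by field_simp
      rw [e, e2]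
      gcongr
      nlinarith

lemma pair_aux2 {n m : ℕ} (hn : 1 ≤ n) (hm : 1 ≤ m) (hne : n ≠ m) :
    1 / √(n:ℝ) * (1 / √(m:ℝ)) * (1 / |Real.log n - Real.log m|) ≤ 1 / |(n:ℝ) - m| + 1 / √(n:ℝ) * (1 / √(m:ℝ)) := by
  have hn' : (1:ℝ) ≤ n := by exact_mod_cast hn
  have hm' : (1:ℝ) ≤ m := by exact_mod_cast hm
  rcases lt_or_gt_of_ne hne with h | h
  · have := pair_aux (n := m) (m := n) hn' (by exact_mod_cast h)
    rw [abs_sub_comm (Real.log n), abs_sub_comm (n:ℝ), mul_comm (1 / √(n:ℝ))]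
    exact this
  · exact pair_aux hm' (by exact_mod_cast h)

/-- Dirichlet polynomial -/
noncomputable def Pn (a : ℕ → ℝ) (N : ℕ) (t : ℝ) : ℝ := ∑ n ∈ Finset.range N, a n * (2 * Real.cos (t * Real.log n))

lemma Pn_cont (a : ℕ → ℝ) (N : ℕ) : Continuous (Pn a N) := by unfold Pn; fun_prop

structure CB (a : ℕ → ℝ) (K : ℝ) : Prop where
  K0 : 0 ≤ K
  z0 : a 0 = 0
  z1 : a 1 = 0
  bd : ∀ n, |a n| ≤ K * (1 / √(n:ℝ))

lemma log_nat_ge {n : ℕ} (hn : 2 ≤ n) : 1 / 2 ≤ Real.log n := by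
  have : Real.log 2 ≤ Real.log n := Real.log_le_log (by norm_num) (by exact_mod_cast hn)
  linarith [Real.log_two_gt_d9]

lemma coscos_int {n m : ℕ} (hn : 2 ≤ n) (hm : 2 ≤ m) {T : ℝ} (hT : 0 < T) :
    |(∫ t in T..(2 * T), (2 * Real.cos (t * Real.log n)) * (2 * Real.cos (t * Real.log m))) - (if n = m then 2 * T else 0)|
      ≤ 4 + (if n = m then 0 else 4 / |Real.log n - Real.log m|) := by
  have e : ∀ t : ℝ, (2 * Real.cos (t * Real.log n)) * (2 * Real.cos (t * Real.log m)) =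
      2 * Real.cos (t * (Real.log n + Real.log m)) + 2 * Real.cos (t * (Real.log n - Real.log m)) := by
    intro t
    rw [mul_add t, mul_sub t, Real.cos_add, Real.cos_sub]; ring
  simp_rw [e]
  rw [intervalIntegral.integral_add (Continuous.intervalIntegrable (by fun_prop) _ _)
    (Continuous.intervalIntegrable (by fun_prop) _ _), intervalIntegral.integral_const_mul,
    intervalIntegral.integral_const_mul]
  have l1 := log_nat_ge hn
  have l2 := log_nat_ge hm
  have c1 := cos_int (x := Real.log n + Real.log m) (by linarith) T (2 * T)
  have c1' : 2 / |Real.log n + Real.log m| ≤ 2 := by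
    rw [abs_of_pos (by linarith), div_le_iff₀ (by linarith)]; linarith
  have c2 := abs_le.1 (c1.trans c1')
  by_cases h : n = m
  · subst h
    simp only [sub_self, mul_zero, Real.cos_zero, if_true]
    rw [intervalIntegral.integral_const]
    simp only [smul_eq_mul]
    rw [abs_le]
    constructor <;> linarith [c2.1, c2.2]
  · rw [if_neg h, if_neg h]
    have hne : Real.log n - Real.log m ≠ 0 := by
      intro h0
      have : Real.log n = Real.log m := by linarith
      have := Real.log_injOn_pos (show (0:ℝ) < n by positivity) (show (0:ℝ) < m by positivity) this
      exact h (by exact_mod_cast this)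
    have c3 := abs_le.1 (cos_int hne T (2 * T))
    have e4 : 4 / |Real.log n - Real.log m| = 2 * (2 / |Real.log n - Real.log m|) := by ring
    rw [e4, abs_le]
    constructor <;> linarith [c2.1, c2.2, c3.1, c3.2]

lemma mean_value {a b : ℕ → ℝ} {K1 K2 : ℝ} (ha : CB a K1) (hb : CB b K2) (N : ℕ) {T : ℝ} (hT : 0 < T) :
    |(∫ t in T..(2 * T), Pn a N t * Pn b N t) - 2 * T * ∑ n ∈ Finset.range N, a n * b n| ≤
      K1 * K2 * (100 * N * (1 + Real.log N)) := by
  have hK1 := ha.K0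
  have hK2 := hb.K0
  have e1 : (∫ t in T..(2 * T), Pn a N t * Pn b N t) = ∑ n ∈ Finset.range N, ∑ m ∈ Finset.range N,
      a n * b m * ∫ t in T..(2 * T), (2 * Real.cos (t * Real.log n)) * (2 * Real.cos (t * Real.log m)) := by
    have : ∀ t, Pn a N t * Pn b N t = ∑ n ∈ Finset.range N, ∑ m ∈ Finset.range N,
        a n * b m * ((2 * Real.cos (t * Real.log n)) * (2 * Real.cos (t * Real.log m))) := by
      intro t
      rw [Pn, Pn, Finset.sum_mul_sum]
      refine Finset.sum_congr rfl fun n _ => Finset.sum_congr rfl fun m _ => ?_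
      ring
    simp_rw [this]
    rw [intervalIntegral.integral_finsetSum fun n _ => Continuous.intervalIntegrable (by fun_prop) _ _]
    refine Finset.sum_congr rfl fun n _ => ?_
    rw [intervalIntegral.integral_finsetSum fun n _ => Continuous.intervalIntegrable (by fun_prop) _ _]
    refine Finset.sum_congr rfl fun m _ => ?_
    rw [intervalIntegral.integral_const_mul]
  have e2 : 2 * T * ∑ n ∈ Finset.range N, a n * b n = ∑ n ∈ Finset.range N, ∑ m ∈ Finset.range N,
      a n * b m * (if n = m then 2 * T else 0) := by
    rw [Finset.mul_sum]
    refine Finset.sum_congr rfl fun n hn => ?_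
    simp only [mul_ite, mul_zero]
    rw [Finset.sum_ite_eq, if_pos hn]; ring
  rw [e1, e2, ← Finset.sum_sub_distrib]
  simp_rw [← Finset.sum_sub_distrib, ← mul_sub]
  have bd : ∀ n m : ℕ, |a n * b m * ((∫ t in T..(2 * T), (2 * Real.cos (t * Real.log n)) * (2 * Real.cos (t * Real.log m))) - (if n = m then 2 * T else 0))| ≤
      K1 * K2 * (8 * (1 / √(n:ℝ) * (1 / √(m:ℝ))) + 4 * (if n = m then 0 else 1 / |(n:ℝ) - m|)) := by
    intro n m
    have rhs0 : 0 ≤ K1 * K2 * (8 * (1 / √(n:ℝ) * (1 / √(m:ℝ))) + 4 * (if n = m then 0 else 1 / |(n:ℝ) - m|)) := by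
      have : (0:ℝ) ≤ (if n = m then 0 else 1 / |(n:ℝ) - m|) := by split_ifs <;> positivity
      positivity
    by_cases hn : n < 2
    · have : a n = 0 := by interval_cases n; exacts [ha.z0, ha.z1]
      rw [this]; simpa using rhs0
    by_cases hm : m < 2
    · have : b m = 0 := by interval_cases m; exacts [hb.z0, hb.z1]
      rw [this]; simpa using rhs0
    push Not at hn hm
    rw [abs_mul, abs_mul]
    have h1 := ha.bd n
    have h2 := hb.bd m
    have h3 := coscos_int hn hm hT
    calc _ ≤ (K1 * (1 / √(n:ℝ))) * (K2 * (1 / √(m:ℝ))) * (4 + (if n = m then 0 else 4 / |Real.log n - Real.log m|)) := by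
          gcongr
      _ ≤ _ := by
          have : (K1 * (1 / √(n:ℝ))) * (K2 * (1 / √(m:ℝ))) * (4 + (if n = m then 0 else 4 / |Real.log n - Real.log m|)) =
            K1 * K2 * (4 * (1 / √(n:ℝ) * (1 / √(m:ℝ))) + 4 * (if n = m then 0 else 1 / √(n:ℝ) * (1 / √(m:ℝ)) * (1 / |Real.log n - Real.log m|))) := by
            split_ifs <;> ring
          rw [this]
          gcongr ?_ * ?_
          split_ifs with h
          · have : 0 ≤ 1 / √(n:ℝ) * (1 / √(m:ℝ)) := by positivity
            linarith
          · have := pair_aux2 (by omega) (by omega) h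
            linarith
  refine (Finset.abs_sum_le_sum_abs _ _).trans ?_
  have s1 : ∀ n ∈ Finset.range N, |∑ m ∈ Finset.range N, a n * b m * ((∫ t in T..(2 * T), (2 * Real.cos (t * Real.log n)) * (2 * Real.cos (t * Real.log m))) - (if n = m then 2 * T else 0))| ≤
     ∑ m ∈ Finset.range N, K1 * K2 * (8 * (1 / √(n:ℝ) * (1 / √(m:ℝ))) + 4 * (if n = m then 0 else 1 / |(n:ℝ) - m|)) :=
    fun n _ => (Finset.abs_sum_le_sum_abs _ _).trans (Finset.sum_le_sum fun m _ => bd n m)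
  refine (Finset.sum_le_sum s1).trans ?_
  simp_rw [← Finset.mul_sum, Finset.sum_add_distrib, ← Finset.mul_sum]
  rw [← Finset.sum_mul]
  gcongr ?_ * ?_
  have q1 := sum_inv_sqrt N
  have q2 := sum_inv_diff N
  have q0 : 0 ≤ ∑ n ∈ Finset.range N, 1 / √(n : ℝ) := Finset.sum_nonneg fun n _ => by positivity
  have q3 : (∑ n ∈ Finset.range N, 1 / √(n : ℝ)) * (∑ n ∈ Finset.range N, 1 / √(n : ℝ)) ≤ 4 * N := by
    have h3 : √(N : ℝ) ^ 2 = N := Real.sq_sqrt (by positivity)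
    calc _ ≤ (2 * √N) * (2 * √N) := by gcongr
      _ = 4 * N := by linear_combination 4 * h3
  have hl : 0 ≤ Real.log N := Real.log_natCast_nonneg N
  have hN0 : (0:ℝ) ≤ N := by positivity
  nlinarith [mul_nonneg hN0 hl]

lemma log_mean {a : ℕ → ℝ} {K : ℝ} (ha : CB a K) (N : ℕ) {T : ℝ} (hT : 2 * Real.pi ≤ T) :
    |∫ t in T..(2 * T), Real.log (t / (2 * Real.pi)) * Pn a N t| ≤ K * (8 * (2 * Real.log T + 1) * √N) := by
  have hK := ha.K0
  have hp := Real.pi_gt_three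
  have hT0 : 0 < T := by linarith
  have hlog : 0 ≤ Real.log T := Real.log_nonneg (by linarith)
  have cl : ContinuousOn (fun t : ℝ => Real.log (t / (2 * Real.pi))) (uIcc T (2 * T)) := by
    refine ContinuousOn.log (by fun_prop) fun t ht => ?_
    rw [uIcc_of_le (by linarith)] at ht
    have := ht.1
    have : 0 < t := by linarith
    positivity
  have e1 : (∫ t in T..(2 * T), Real.log (t / (2 * Real.pi)) * Pn a N t) = ∑ n ∈ Finset.range N,
      2 * a n * ∫ t in T..(2 * T), Real.log (t / (2 * Real.pi)) * Real.cos (t * Real.log n) := by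
    have : ∀ t, Real.log (t / (2 * Real.pi)) * Pn a N t = ∑ n ∈ Finset.range N,
        2 * a n * (Real.log (t / (2 * Real.pi)) * Real.cos (t * Real.log n)) := by
      intro t
      rw [Pn, Finset.mul_sum]
      refine Finset.sum_congr rfl fun n _ => ?_
      ring
    simp_rw [this]
    rw [intervalIntegral.integral_finsetSum fun n _ => ContinuousOn.intervalIntegrable (by fun_prop)]
    refine Finset.sum_congr rfl fun n _ => ?_
    rw [intervalIntegral.integral_const_mul]
  rw [e1]
  refine (Finset.abs_sum_le_sum_abs _ _).trans ?_
  have q1 := sum_inv_sqrt N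
  calc _ ≤ ∑ n ∈ Finset.range N, K * (4 * (2 * Real.log T + 1)) * (1 / √(n:ℝ)) := by
        refine Finset.sum_le_sum fun n _ => ?_
        by_cases hn : n < 2
        · have : a n = 0 := by interval_cases n; exacts [ha.z0, ha.z1]
          rw [this, mul_zero, zero_mul, abs_zero]; positivity
        push Not at hn
        have l1 := log_nat_ge hn
        have h1 := log_cos_int (x := Real.log n) (by linarith) hT
        have h2 : (2 * Real.log T + 1) / Real.log n ≤ 2 * (2 * Real.log T + 1) := by
          rw [div_le_iff₀ (by linarith)]; nlinarith
        rw [abs_mul, abs_mul, abs_two]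
        calc _ ≤ 2 * (K * (1 / √(n:ℝ))) * (2 * (2 * Real.log T + 1)) := by
              gcongr
              · exact ha.bd n
              · exact h1.trans h2
          _ = _ := by ring
    _ = K * (4 * (2 * Real.log T + 1)) * ∑ n ∈ Finset.range N, (1 / √(n:ℝ)) := by rw [Finset.mul_sum]
    _ ≤ K * (4 * (2 * Real.log T + 1)) * (2 * √N) := by gcongr
    _ = _ := by ring

lemma one_mean {a : ℕ → ℝ} {K : ℝ} (ha : CB a K) (N : ℕ) (T : ℝ) :
    |∫ t in T..(2 * T), Pn a N t| ≤ K * (16 * √N) := by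
  have hK := ha.K0
  have e1 : (∫ t in T..(2 * T), Pn a N t) = ∑ n ∈ Finset.range N,
      2 * a n * ∫ t in T..(2 * T), Real.cos (t * Real.log n) := by
    have : ∀ t, Pn a N t = ∑ n ∈ Finset.range N, 2 * a n * (Real.cos (t * Real.log n)) := by
      intro t
      rw [Pn]
      refine Finset.sum_congr rfl fun n _ => ?_
      ring
    simp_rw [this]
    rw [intervalIntegral.integral_finsetSum fun n _ => Continuous.intervalIntegrable (by fun_prop) _ _]
    refine Finset.sum_congr rfl fun n _ => ?_
    rw [intervalIntegral.integral_const_mul]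
  rw [e1]
  refine (Finset.abs_sum_le_sum_abs _ _).trans ?_
  have q1 := sum_inv_sqrt N
  calc _ ≤ ∑ n ∈ Finset.range N, K * 8 * (1 / √(n:ℝ)) := by
        refine Finset.sum_le_sum fun n _ => ?_
        by_cases hn : n < 2
        · have : a n = 0 := by interval_cases n; exacts [ha.z0, ha.z1]
          rw [this, mul_zero, zero_mul, abs_zero]; positivity
        push Not at hn
        have l1 := log_nat_ge hn
        have h1 := cos_int (x := Real.log n) (by linarith) T (2 * T)
        have h2 : 2 / |Real.log n| ≤ 4 := by
          rw [abs_of_pos (by linarith), div_le_iff₀ (by linarith)]; linarith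
        rw [abs_mul, abs_mul, abs_two]
        calc _ ≤ 2 * (K * (1 / √(n:ℝ))) * 4 := by
              gcongr
              · exact ha.bd n
              · exact h1.trans h2
          _ = _ := by ring
    _ = K * 8 * ∑ n ∈ Finset.range N, (1 / √(n:ℝ)) := by rw [Finset.mul_sum]
    _ ≤ K * 8 * (2 * √N) := by gcongr
    _ = _ := by ring


lemma logfac (N : ℕ) : ∑ n ∈ Finset.Ioc 0 N, Real.log n ≤ N * Real.log N ∧
    N * Real.log N - N ≤ ∑ n ∈ Finset.Ioc 0 N, Real.log n := by
  constructor
  · calc _ ≤ ∑ n ∈ Finset.Ioc 0 N, Real.log N := by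
          refine Finset.sum_le_sum fun n hn => ?_
          rw [Finset.mem_Ioc] at hn
          exact Real.log_le_log (by exact_mod_cast hn.1) (by exact_mod_cast hn.2)
      _ = _ := by simp
  · induction N with
    | zero => simp
    | succ N ih =>
      rw [Finset.sum_Ioc_succ_top (Nat.zero_le N)]
      rcases Nat.eq_zero_or_pos N with rfl | hN
      · simp
      have hN' : (0:ℝ) < N := by exact_mod_cast hN
      have h := Real.log_le_sub_one_of_pos (show 0 < ((N + 1 : ℕ):ℝ) / N by positivity)
      rw [Real.log_div (by positivity) hN'.ne'] at h
      have h2 : (N:ℝ) * (((N + 1 : ℕ):ℝ) / N - 1) = 1 := by push_cast; field_simp; ring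
      have h3 := mul_le_mul_of_nonneg_left h hN'.le
      rw [h2] at h3
      push_cast at *
      linarith

lemma mertens : ∃ C : ℝ, 0 < C ∧ ∀ N : ℕ, 1 ≤ N →
    |∑ n ∈ Finset.Ioc 0 N, ArithmeticFunction.vonMangoldt n / n - Real.log N| ≤ C := by
  refine ⟨Real.log 4 + 4 + 1, by have := Real.log_nonneg (show (1:ℝ) ≤ 4 by norm_num); linarith, fun N hN => ?_⟩
  have hN' : (0:ℝ) < N := by exact_mod_cast hN
  have h1 := ArithmeticFunction.sum_Ioc_mul_zeta_eq_sum ArithmeticFunction.vonMangoldt N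
  rw [ArithmeticFunction.vonMangoldt_mul_zeta] at h1
  simp only [ArithmeticFunction.log_apply] at h1
  obtain ⟨l1, l2⟩ := logfac N
  have hpsi := Chebyshev.psi_le_const_mul_self (x := N) (by positivity)
  rw [Chebyshev.psi, Nat.floor_natCast] at hpsi
  have e : (N:ℝ) * ∑ n ∈ Finset.Ioc 0 N, ArithmeticFunction.vonMangoldt n / n = ∑ n ∈ Finset.Ioc 0 N, ArithmeticFunction.vonMangoldt n * ((N:ℝ) / n) := by
    rw [Finset.mul_sum]; exact Finset.sum_congr rfl fun n _ => by ring
  have u1 : ∑ n ∈ Finset.Ioc 0 N, ArithmeticFunction.vonMangoldt n * ((N / n : ℕ) : ℝ) ≤ (N:ℝ) * ∑ n ∈ Finset.Ioc 0 N, ArithmeticFunction.vonMangoldt n / n := by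
    rw [e]
    exact Finset.sum_le_sum fun n _ => mul_le_mul_of_nonneg_left Nat.cast_div_le ArithmeticFunction.vonMangoldt_nonneg
  have u2 : (N:ℝ) * ∑ n ∈ Finset.Ioc 0 N, ArithmeticFunction.vonMangoldt n / n ≤ ∑ n ∈ Finset.Ioc 0 N, ArithmeticFunction.vonMangoldt n * ((N / n : ℕ) : ℝ) + ∑ n ∈ Finset.Ioc 0 N, ArithmeticFunction.vonMangoldt n := by
    rw [e, ← Finset.sum_add_distrib]
    refine Finset.sum_le_sum fun n hn => ?_
    have hn0 : 0 < n := (Finset.mem_Ioc.1 hn).1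
    have : (N:ℝ) / n ≤ ((N / n : ℕ):ℝ) + 1 := by
      rw [div_le_iff₀ (by exact_mod_cast hn0)]
      have := Nat.lt_mul_div_succ N hn0
      rw [mul_comm] at this
      exact_mod_cast this.le
    nlinarith [ArithmeticFunction.vonMangoldt_nonneg (n := n)]
  rw [← h1] at u1 u2
  have v1 : (N:ℝ) * (∑ n ∈ Finset.Ioc 0 N, ArithmeticFunction.vonMangoldt n / n - Real.log N) ≤ N * (Real.log 4 + 4 + 1) := by nlinarith
  have v2 : (N:ℝ) * (-(Real.log 4 + 4 + 1)) ≤ (N:ℝ) * (∑ n ∈ Finset.Ioc 0 N, ArithmeticFunction.vonMangoldt n / n - Real.log N) := by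
    have := Real.log_nonneg (show (1:ℝ) ≤ 4 by norm_num)
    nlinarith
  rw [abs_le]
  exact ⟨le_of_mul_le_mul_left v2 hN', le_of_mul_le_mul_left v1 hN'⟩

lemma abel_lip {C M : ℝ} {c : ℕ → ℝ} (hM : 0 ≤ M) (hC : 0 ≤ C) (hc : ∀ N : ℕ, 1 ≤ N → |∑ n ∈ Finset.Ioc 0 N, c n - Real.log N| ≤ C)
    {φ : ℝ → ℝ} (hφc : Continuous φ) (hφ0 : φ 0 = 0) (hφ : ∀ u v, |φ u - φ v| ≤ M * |u - v|) (N : ℕ) (hN : 1 ≤ N) :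
    |∑ n ∈ Finset.Ioc 0 N, c n * φ (Real.log n) - (∫ u in (0:ℝ)..Real.log N, φ u) -
      (∑ n ∈ Finset.Ioc 0 N, c n - Real.log N) * φ (Real.log N)| ≤ (C + 1) * M * Real.log N := by
  induction N, hN using Nat.le_induction with
  | base => simp [hφ0]
  | succ N hN ih =>
    have hN' : (0:ℝ) < N := by exact_mod_cast hN
    have hcN := hc N hN
    rw [Finset.sum_Ioc_succ_top (Nat.zero_le N), Finset.sum_Ioc_succ_top (Nat.zero_le N)]
    rw [← intervalIntegral.integral_add_adjacent_intervals (hφc.intervalIntegrable 0 (Real.log N)) (hφc.intervalIntegrable _ _)]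
    have hl0 : Real.log N ≤ Real.log ((N + 1 : ℕ):ℝ) := Real.log_le_log hN' (by push_cast; linarith)
    have hl1 : Real.log ((N + 1 : ℕ):ℝ) - Real.log N ≤ 1 := by
      have h := Real.log_le_sub_one_of_pos (show 0 < ((N + 1 : ℕ):ℝ) / N by positivity)
      rw [Real.log_div (by positivity) hN'.ne'] at h
      have : ((N + 1 : ℕ):ℝ) / N ≤ 2 := by
        rw [div_le_iff₀ hN']; push_cast; have : (1:ℝ) ≤ N := by exact_mod_cast hN
        linarith
      linarith
    set a := Real.log N
    set b := Real.log ((N + 1 : ℕ):ℝ)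
    set S := ∑ n ∈ Finset.Ioc 0 N, c n
    set P := ∑ n ∈ Finset.Ioc 0 N, c n * φ (Real.log n)
    set I := ∫ u in (0:ℝ)..a, φ u
    have j : |(b - a) * φ b - ∫ u in a..b, φ u| ≤ M * (b - a) := by
      have e : (b - a) * φ b - ∫ u in a..b, φ u = ∫ u in a..b, (φ b - φ u) := by
        rw [intervalIntegral.integral_sub (by simp) (hφc.intervalIntegrable _ _), intervalIntegral.integral_const, smul_eq_mul]
      have := intervalIntegral.norm_integral_le_of_norm_le_const (a := a) (b := b) (C := M) (f := fun u => φ b - φ u) (by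
        intro u hu
        rw [uIoc_of_le hl0] at hu
        rw [Real.norm_eq_abs]
        refine (hφ b u).trans ?_
        have : |b - u| ≤ 1 := by rw [abs_of_nonneg (by linarith [hu.2])]; linarith [hu.1]
        nlinarith)
      rw [e]
      rwa [abs_of_nonneg (by linarith : 0 ≤ b - a)] at this
    have k : |(S - a) * (φ a - φ b)| ≤ C * (M * (b - a)) := by
      rw [abs_mul]
      have := hφ a b
      rw [abs_sub_comm a b, abs_of_nonneg (by linarith : 0 ≤ b - a)] at this
      gcongr
    have e : P + c (N + 1) * φ b - (I + ∫ u in a..b, φ u) - (S + c (N + 1) - b) * φ b =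
      (P - I - (S - a) * φ a) + ((b - a) * φ b - ∫ u in a..b, φ u) + (S - a) * (φ a - φ b) := by ring
    rw [e]
    have t1 := abs_add_three (P - I - (S - a) * φ a) ((b - a) * φ b - ∫ u in a..b, φ u) ((S - a) * (φ a - φ b))
    refine t1.trans ?_
    linarith

lemma TF.lip {g : ℝ → ℝ} (h : TF g) : ∃ M : ℝ, 0 ≤ M ∧ ∀ u v, |g u - g v| ≤ M * |u - v| := by
  obtain ⟨C, hC⟩ := (h.smooth.of_le (by simp : (1 : WithTop ℕ∞) ≤ ∞)).lipschitzWith_of_hasCompactSupport h.cpt (by simp)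
  refine ⟨C, C.2, fun u v => ?_⟩
  simpa [Real.dist_eq] using hC.dist_le_mul u v

lemma TF.bdd {g : ℝ → ℝ} (h : TF g) : ∃ M : ℝ, 0 < M ∧ ∀ u, |g u| ≤ M := by
  obtain ⟨C, hC⟩ := h.cpt.exists_bound_of_continuous h.smooth.continuous
  refine ⟨|C| + 1, by positivity, fun u => ?_⟩
  have := hC u
  rw [Real.norm_eq_abs] at this
  linarith [le_abs_self C]

lemma prime_sum {r : ℝ → ℝ} (h : TF r) (h0 : ∀ u, 0 ≤ r u) {A : ℝ} (hA : ∀ u, A < |u| → r u = 0) (hA1 : A ≤ 1) :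
    ∃ C : ℝ, 0 < C ∧ ∀ L : ℝ, 1 ≤ L → ∀ N : ℕ, Real.exp (A * L) < N → (N:ℝ) ≤ Real.exp L * 3 →
      ∑ n ∈ Finset.Ioc 0 N, ArithmeticFunction.vonMangoldt n ^ 2 / n * r (Real.log n / L) ≤
        L ^ 2 * (∫ u in (0:ℝ)..1, u * r u) + C * L := by
  obtain ⟨C, hC, hm⟩ := mertens
  have hψ : TF (fun u => u * r u) := ⟨contDiff_id.mul h.smooth, h.cpt.mul_left⟩
  obtain ⟨M, hM, hl⟩ := hψ.lip
  refine ⟨(C + 1) * M * 3 + 1, by positivity, fun L hL N hN hN3 => ?_⟩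
  have hL0 : 0 < L := by linarith
  have hN1 : 1 ≤ N := by
    by_contra hh
    have : N = 0 := by omega
    subst this
    have := Real.exp_pos (A * L)
    simp at hN; linarith
  have hN0 : (0:ℝ) < N := by exact_mod_cast hN1
  have hlogA : A * L < Real.log N := by rwa [Real.lt_log_iff_exp_lt hN0]
  have hlog0 : 0 ≤ Real.log N := Real.log_natCast_nonneg N
  have hlogL : Real.log N ≤ 3 * L := by
    have := Real.log_le_log hN0 hN3
    rw [Real.log_mul (by positivity) (by norm_num), Real.log_exp] at this
    have := Real.log_le_sub_one_of_pos (show (0:ℝ) < 3 by norm_num)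
    linarith
  have rz : ∀ u, A * L < u → r (u / L) = 0 := by
    intro u hu
    refine hA _ (lt_of_lt_of_le ?_ (le_abs_self _))
    rwa [lt_div_iff₀ hL0]
  set φ : ℝ → ℝ := fun u => L * ((u / L) * r (u / L)) with hφ
  have hφ' : ∀ u, φ u = u * r (u / L) := by intro u; simp only [hφ]; field_simp
  have hφc : Continuous φ := by
    have := h.smooth.continuous
    fun_prop
  have key := abel_lip hM hC.le hm hφc (by simp [hφ]) (by
    intro u v
    simp only [hφ]
    rw [← mul_sub, abs_mul, abs_of_pos hL0]
    have := hl (u / L) (v / L)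
    rw [← sub_div, abs_div, abs_of_pos hL0] at this
    calc _ ≤ L * (M * (|u - v| / L)) := by gcongr
      _ = _ := by field_simp) N hN1
  rw [hφ' (Real.log N), rz _ hlogA, mul_zero, mul_zero, sub_zero] at key
  have k2 := (abs_le.1 key).2
  have i1 : (∫ u in (0:ℝ)..Real.log N, φ u) = L ^ 2 * ∫ u in (0:ℝ)..(Real.log N / L), u * r u := by
    simp only [hφ]
    rw [intervalIntegral.integral_const_mul, intervalIntegral.integral_comp_div (fun u => u * r u) hL0.ne', zero_div, smul_eq_mul]
    ring
  have i2 : (∫ u in (0:ℝ)..(Real.log N / L), u * r u) = ∫ u in (0:ℝ)..1, u * r u := by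
    have cc : Continuous (fun u => u * r u) := hψ.smooth.continuous
    have := intervalIntegral.integral_interval_sub_left (cc.intervalIntegrable (μ := volume) 0 (Real.log N / L)) (cc.intervalIntegrable 0 1)
    have z : (∫ u in (1:ℝ)..(Real.log N / L), u * r u) = 0 := by
      have e : ∀ᵐ u, u ∈ uIoc (1:ℝ) (Real.log N / L) → u * r u = 0 := by
        filter_upwards with u hu
        rw [hA u, mul_zero]
        have h1 : A < Real.log N / L := by rwa [lt_div_iff₀ hL0]
        rw [uIoc, mem_Ioc] at hu
        refine lt_of_lt_of_le ?_ (le_abs_self u)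
        exact lt_of_le_of_lt (le_min hA1 h1.le) hu.1
      rw [intervalIntegral.integral_congr_ae (g := fun _ => 0) e]
      simp
    linarith
  rw [i1, i2] at k2
  have s1 : ∑ n ∈ Finset.Ioc 0 N, ArithmeticFunction.vonMangoldt n ^ 2 / n * r (Real.log n / L) ≤
      ∑ n ∈ Finset.Ioc 0 N, ArithmeticFunction.vonMangoldt n / n * φ (Real.log n) := by
    refine Finset.sum_le_sum fun n hn => ?_
    rw [hφ']
    have v0 := ArithmeticFunction.vonMangoldt_nonneg (n := n)
    have v1 := ArithmeticFunction.vonMangoldt_le_log (n := n)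
    have r0 := h0 (Real.log n / L)
    calc _ = ArithmeticFunction.vonMangoldt n / n * r (Real.log n / L) * ArithmeticFunction.vonMangoldt n := by ring
      _ ≤ ArithmeticFunction.vonMangoldt n / n * r (Real.log n / L) * Real.log n := by gcongr
      _ = _ := by ring
  have : (C + 1) * M * Real.log N ≤ (C + 1) * M * (3 * L) := by gcongr
  linarith


noncomputable def NN (A L : ℝ) : ℕ := ⌈Real.exp (A * L)⌉₊ + 1

lemma NN_gt (A L : ℝ) : Real.exp (A * L) < NN A L := by
  have := Nat.le_ceil (Real.exp (A * L))
  rw [NN]; push_cast; linarith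

lemma NN_le {A L : ℝ} (hA : 0 ≤ A) (hL : 0 ≤ L) : (NN A L : ℝ) ≤ 3 * Real.exp (A * L) := by
  have := (Nat.ceil_lt_add_one (Real.exp_pos (A * L)).le).le
  have h1 : 1 ≤ Real.exp (A * L) := Real.one_le_exp (by positivity)
  rw [NN]; push_cast; linarith

noncomputable def ca (r : ℝ → ℝ) (L : ℝ) (n : ℕ) : ℝ := ArithmeticFunction.vonMangoldt n / √(n:ℝ) * sc r L (Real.log n)

lemma PP_eq (r : ℝ → ℝ) (L : ℝ) (N : ℕ) (t : ℝ) : PP (sc r L) N t = Pn (ca r L) N t := rfl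

lemma ca_CB {r : ℝ → ℝ} {M A L : ℝ} (hM : ∀ u, |r u| ≤ M) (hA : ∀ u, A < |u| → r u = 0) (hA1 : A ≤ 1) (hL : 1 ≤ L) :
    CB (ca r L) (M * L) := by
  have hL0 : 0 < L := by linarith
  have hM0 : 0 ≤ M := (abs_nonneg _).trans (hM 0)
  refine ⟨by positivity, by simp [ca], by simp [ca], fun n => ?_⟩
  by_cases hn : A * L < Real.log n
  · have : ca r L n = 0 := by
      rw [ca, sc, hA, mul_zero]
      refine lt_of_lt_of_le ?_ (le_abs_self _)
      rwa [lt_div_iff₀ hL0]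
    rw [this, abs_zero]; positivity
  · push Not at hn
    have v0 := ArithmeticFunction.vonMangoldt_nonneg (n := n)
    have v1 := ArithmeticFunction.vonMangoldt_le_log (n := n)
    have v2 : ArithmeticFunction.vonMangoldt n ≤ L := by nlinarith
    rw [ca, sc, abs_mul, abs_div, abs_of_nonneg v0, abs_of_nonneg (Real.sqrt_nonneg _)]
    calc _ ≤ L / √(n:ℝ) * M := by gcongr; exact hM _
      _ = _ := by ring

lemma two_pi_le {L : ℝ} (hL : 2 ≤ L) : 2 * Real.pi ≤ Real.exp L := by
  have h1 : Real.exp 2 ≤ Real.exp L := Real.exp_le_exp.2 hL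
  have h2 : Real.exp 2 = Real.exp 1 * Real.exp 1 := by rw [← Real.exp_add]; norm_num
  have h3 := Real.exp_one_gt_d9
  have h4 := Real.pi_lt_d2
  nlinarith

lemma lg_cont {T : ℝ} (hT : 0 < T) : ContinuousOn (fun t : ℝ => Real.log (t / (2 * Real.pi))) (uIcc T (2 * T)) := by
  refine ContinuousOn.log (by fun_prop) fun t ht => ?_
  rw [uIcc_of_le (by linarith)] at ht
  have : 0 < t := by linarith [ht.1]
  positivity

lemma moment2 {r1 r2 : ℝ → ℝ} (h1 : TF r1) (h2 : TF r2) (h0 : ∀ u, 0 ≤ r1 u) {A : ℝ} (hA0 : 0 ≤ A) (hA1 : A ≤ 1)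
    (hr1 : ∀ u, A < |u| → r1 u = 0) (hr2 : ∀ u, A < |u| → r2 u = 0) (h20 : r2 0 = 1) (h12 : ∀ u, r1 u * r2 u = r1 u) :
    ∃ C : ℝ, 0 < C ∧ ∀ L : ℝ, 2 ≤ L →
      ∫ t in Real.exp L..(2 * Real.exp L), MM r1 (NN A L) L t * MM r2 (NN A L) L t ≤
        Real.exp L * L ^ 2 * (r1 0 + 2 * ∫ u in (0:ℝ)..1, u * r1 u) + C * (L * Real.exp L + L ^ 3 * Real.exp (A * L)) := by
  obtain ⟨M1, hM1, b1⟩ := h1.bdd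
  obtain ⟨M2, hM2, b2⟩ := h2.bdd
  obtain ⟨C, hC, hp⟩ := prime_sum h1 h0 hr1 hA1
  have hr0 := h0 0
  refine ⟨2 * C + r1 0 * (M2 * 72) + M1 * 72 + M1 * M2 * 1200, by positivity, fun L hL => ?_⟩
  have hL0 : 0 < L := by linarith
  have hL1 : 1 ≤ L := by linarith
  set T := Real.exp L with hT
  have hT0 : 0 < T := Real.exp_pos L
  have hTp : 2 * Real.pi ≤ T := two_pi_le hL
  have hlT : Real.log T = L := Real.log_exp L
  set N := NN A L with hN
  set E := Real.exp (A * L) with hE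
  have hE1 : 1 ≤ E := Real.one_le_exp (by positivity)
  have hNE : (N:ℝ) ≤ 3 * E := NN_le hA0 hL0.le
  have hNgt : E < N := NN_gt A L
  have hET : E ≤ T := Real.exp_le_exp.2 (by nlinarith)
  have c1 := ca_CB b1 hr1 hA1 hL1
  have c2 := ca_CB b2 hr2 hA1 hL1
  have hsq : √(N:ℝ) ≤ 3 * E := by
    refine (Real.sqrt_le_iff.2 ⟨by positivity, ?_⟩)
    nlinarith
  have hlogN : Real.log N ≤ 3 * L := by
    have := Real.log_le_log (by linarith) (hNE.trans (by linarith : 3 * E ≤ 3 * T))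
    rw [Real.log_mul (by norm_num) hT0.ne', hlT] at this
    have := Real.log_le_sub_one_of_pos (show (0:ℝ) < 3 by norm_num)
    linarith
  have m1 := mean_value c1 c2 N hT0
  have m2 := log_mean c1 N hTp
  have m3 := log_mean c2 N hTp
  rw [hlT] at m2 m3
  have s1 : ∑ n ∈ Finset.range N, ca r1 L n * ca r2 L n ≤ L ^ 2 * (∫ u in (0:ℝ)..1, u * r1 u) + C * L := by
    refine le_trans ?_ (hp L hL1 N hNgt (by linarith))
    have e : ∀ n : ℕ, ca r1 L n * ca r2 L n = ArithmeticFunction.vonMangoldt n ^ 2 / n * r1 (Real.log n / L) := by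
      intro n
      rw [ca, ca, sc, sc]
      have : √(n:ℝ) * √(n:ℝ) = n := Real.mul_self_sqrt (by positivity)
      calc _ = ArithmeticFunction.vonMangoldt n ^ 2 / (√(n:ℝ) * √(n:ℝ)) * (r1 (Real.log n / L) * r2 (Real.log n / L)) := by ring
        _ = _ := by rw [this, h12]
    simp_rw [e]
    calc _ ≤ ∑ n ∈ Finset.range (N + 1), ArithmeticFunction.vonMangoldt n ^ 2 / n * r1 (Real.log n / L) :=
          Finset.sum_le_sum_of_subset_of_nonneg (by simp) fun n _ _ => mul_nonneg (by positivity) (h0 _)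
      _ = _ := by
          rw [Finset.range_eq_Ico, Finset.sum_eq_sum_Ico_succ_bot (by omega)]
          simp only [CharP.cast_eq_zero, div_zero, zero_mul, zero_add]
          congr 1
  have cl := lg_cont hT0
  have cP1 : Continuous (Pn (ca r1 L) N) := Pn_cont _ _
  have cP2 : Continuous (Pn (ca r2 L) N) := Pn_cont _ _
  have i0 : IntervalIntegrable (fun t => Real.log (t / (2 * Real.pi)) ^ 2) volume T (2 * T) := (cl.pow 2).intervalIntegrable
  have i1 : IntervalIntegrable (fun t => Real.log (t / (2 * Real.pi)) * Pn (ca r1 L) N t) volume T (2 * T) := (cl.mul cP1.continuousOn).intervalIntegrable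
  have i2 : IntervalIntegrable (fun t => Real.log (t / (2 * Real.pi)) * Pn (ca r2 L) N t) volume T (2 * T) := (cl.mul cP2.continuousOn).intervalIntegrable
  have i3 : IntervalIntegrable (fun t => Pn (ca r1 L) N t * Pn (ca r2 L) N t) volume T (2 * T) := (cP1.mul cP2).intervalIntegrable _ _
  have ex : (∫ t in T..(2 * T), MM r1 N L t * MM r2 N L t) = r1 0 * (∫ t in T..(2 * T), Real.log (t / (2 * Real.pi)) ^ 2)
      - r1 0 * (∫ t in T..(2 * T), Real.log (t / (2 * Real.pi)) * Pn (ca r2 L) N t)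
      - (∫ t in T..(2 * T), Real.log (t / (2 * Real.pi)) * Pn (ca r1 L) N t) + ∫ t in T..(2 * T), Pn (ca r1 L) N t * Pn (ca r2 L) N t := by
    rw [← intervalIntegral.integral_const_mul, ← intervalIntegral.integral_const_mul,
      ← intervalIntegral.integral_sub (i0.const_mul _) (i2.const_mul _),
      ← intervalIntegral.integral_sub ((i0.const_mul _).sub (i2.const_mul _)) i1,
      ← intervalIntegral.integral_add (((i0.const_mul _).sub (i2.const_mul _)).sub i1) i3]
    refine intervalIntegral.integral_congr fun t _ => ?_
    simp only [MM, PP_eq, h20]; ring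
  have lsq : (∫ t in T..(2 * T), Real.log (t / (2 * Real.pi)) ^ 2) ≤ T * L ^ 2 := by
    have := intervalIntegral.integral_mono_on (by linarith) i0 (by simp : IntervalIntegrable (fun _ => L ^ 2) volume T (2 * T)) (by
      intro t ht
      have g1 : 0 ≤ Real.log (t / (2 * Real.pi)) := Real.log_nonneg (by rw [le_div_iff₀ (by positivity)]; linarith [ht.1])
      have g2 : Real.log (t / (2 * Real.pi)) ≤ L := by
        rw [← hlT]
        refine Real.log_le_log (div_pos (by linarith [ht.1]) (by positivity)) ?_
        rw [div_le_iff₀ (by positivity)]; nlinarith [ht.2, Real.pi_gt_three]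
      gcongr)
    refine this.trans (le_of_eq ?_)
    rw [intervalIntegral.integral_const, smul_eq_mul]; ring
  rw [ex]
  have n1 := (abs_le.1 m1).2
  have n2 := (abs_le.1 m2).1
  have n3 := (abs_le.1 m3).1
  have p2 : M1 * L * (8 * (2 * L + 1) * √(N:ℝ)) ≤ M1 * 72 * (L ^ 3 * E) := by
    calc _ ≤ M1 * L * (8 * (3 * L) * (3 * E)) := by gcongr; linarith
      _ = M1 * 72 * (L ^ 2 * 1 * E) := by ring
      _ ≤ M1 * 72 * (L ^ 2 * L * E) := by gcongr
      _ = _ := by ring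
  have p3 : M2 * L * (8 * (2 * L + 1) * √(N:ℝ)) ≤ M2 * 72 * (L ^ 3 * E) := by
    calc _ ≤ M2 * L * (8 * (3 * L) * (3 * E)) := by gcongr; linarith
      _ = M2 * 72 * (L ^ 2 * 1 * E) := by ring
      _ ≤ M2 * 72 * (L ^ 2 * L * E) := by gcongr
      _ = _ := by ring
  have p1 : M1 * L * (M2 * L) * (100 * N * (1 + Real.log N)) ≤ M1 * M2 * 1200 * (L ^ 3 * E) := by
    have : 0 ≤ Real.log N := Real.log_natCast_nonneg N
    calc _ ≤ M1 * L * (M2 * L) * (100 * (3 * E) * (L + 3 * L)) := by gcongr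
      _ = _ := by ring
  have q1 := mul_le_mul_of_nonneg_left s1 (show 0 ≤ 2 * T by positivity)
  have q2 := mul_le_mul_of_nonneg_left lsq hr0
  have q3 : r1 0 * (-(M2 * L * (8 * (2 * L + 1) * √(N:ℝ)))) ≤ r1 0 * (∫ t in T..(2 * T), Real.log (t / (2 * Real.pi)) * Pn (ca r2 L) N t) :=
    mul_le_mul_of_nonneg_left n3 hr0
  have q4 := mul_le_mul_of_nonneg_left p3 hr0
  have w1 : 0 ≤ L ^ 3 * E := by positivity
  have w2 : 0 ≤ L * T := by positivity
  have z1 : 0 ≤ (r1 0 * (M2 * 72) + M1 * 72 + M1 * M2 * 1200) * (L * T) := by positivity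
  have z2 : 0 ≤ 2 * C * (L ^ 3 * E) := by positivity
  nlinarith

lemma moment1 {r2 : ℝ → ℝ} (h2 : TF r2) {A : ℝ} (hA0 : 0 ≤ A) (hA1 : A ≤ 1)
    (hr2 : ∀ u, A < |u| → r2 u = 0) (h20 : r2 0 = 1) :
    ∃ C : ℝ, 0 < C ∧ ∀ L : ℝ, 2 ≤ L →
      Real.exp L * (L - 2) - C * (L * Real.exp (A * L)) ≤
      ∫ t in Real.exp L..(2 * Real.exp L), MM r2 (NN A L) L t := by
  obtain ⟨M2, hM2, b2⟩ := h2.bdd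
  refine ⟨M2 * 48, by positivity, fun L hL => ?_⟩
  have hL0 : 0 < L := by linarith
  have hL1 : 1 ≤ L := by linarith
  set T := Real.exp L with hT
  have hT0 : 0 < T := Real.exp_pos L
  have hlT : Real.log T = L := Real.log_exp L
  set N := NN A L with hN
  set E := Real.exp (A * L) with hE
  have hE1 : 1 ≤ E := Real.one_le_exp (by positivity)
  have hNE : (N:ℝ) ≤ 3 * E := NN_le hA0 hL0.le
  have c2 := ca_CB b2 hr2 hA1 hL1
  have hsq : √(N:ℝ) ≤ 3 * E := by
    refine (Real.sqrt_le_iff.2 ⟨by positivity, ?_⟩)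
    nlinarith
  have m := (abs_le.1 (one_mean c2 N T)).2
  have p : M2 * L * (16 * √(N:ℝ)) ≤ M2 * 48 * (L * E) := by
    calc _ ≤ M2 * L * (16 * (3 * E)) := by gcongr
      _ = _ := by ring
  have cl := lg_cont hT0
  have cP2 : Continuous (Pn (ca r2 L) N) := Pn_cont _ _
  have ex : (∫ t in T..(2 * T), MM r2 N L t) = (∫ t in T..(2 * T), Real.log (t / (2 * Real.pi)))
      - ∫ t in T..(2 * T), Pn (ca r2 L) N t := by
    rw [← intervalIntegral.integral_sub cl.intervalIntegrable (cP2.intervalIntegrable _ _)]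
    refine intervalIntegral.integral_congr fun t _ => ?_
    simp only [MM, PP_eq, h20, one_mul]
  have lsq : T * (L - 2) ≤ (∫ t in T..(2 * T), Real.log (t / (2 * Real.pi))) := by
    have := intervalIntegral.integral_mono_on (by linarith) (by simp : IntervalIntegrable (fun _ => L - 2) volume T (2 * T)) cl.intervalIntegrable (by
      intro t ht
      have : Real.log (T / (2 * Real.pi)) ≤ Real.log (t / (2 * Real.pi)) := by
        refine Real.log_le_log (by positivity) ?_
        gcongr; exact ht.1
      rw [Real.log_div hT0.ne' (by positivity), hlT] at this
      have h2 := Real.log_le_log (by positivity) (two_pi_le (le_refl 2))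
      rw [Real.log_exp] at h2
      linarith)
    refine (le_of_eq ?_).trans this
    rw [intervalIntegral.integral_const, smul_eq_mul]; ring
  rw [ex]
  linarith


lemma bd_finite (T : ℝ) : {ρ : Zr | T < (ρ : ℂ).im ∧ (ρ : ℂ).im ≤ 2 * T}.Finite := by
  refine (Zr_finite' (1 + 2 * |T|)).subset ?_
  rintro ρ ⟨h1, h2⟩
  have h := Complex.norm_le_abs_re_add_abs_im (ρ : ℂ)
  have hr : |(ρ : ℂ).re| ≤ 1 := by rw [abs_le]; constructor <;> linarith [(Zr_re ρ).1, (Zr_re ρ).2]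
  have hi : |(ρ : ℂ).im| ≤ 2 * |T| := by
    rw [abs_le]; constructor <;> cases abs_cases T <;> linarith
  show ‖(ρ : ℂ)‖ ≤ _
  linarith

/-- zeros of the band -/
noncomputable def bd (T : ℝ) : Finset Zr := (bd_finite T).toFinset

lemma mem_bd {T : ℝ} {ρ : Zr} : ρ ∈ bd T ↔ T < (ρ : ℂ).im ∧ (ρ : ℂ).im ≤ 2 * T := by simp [bd]

noncomputable def FB (r : ℝ → ℝ) (L t : ℝ) : ℂ := ∑ ρ ∈ bd (Real.exp L), (mu ρ : ℂ) * Lap (sc r L) (wz ρ t)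

def Near (L : ℝ) : Prop := ∀ ρ : Zr, Real.exp L / 2 < (ρ : ℂ).im → (ρ : ℂ).im ≤ 4 * Real.exp L → L * |(ρ : ℂ).re - 1 / 2| ≤ 1

lemma lap_bd {r : ℝ → ℝ} (h : TF r) {A : ℝ} (hA0 : 0 ≤ A) (hA1 : A ≤ 1) (hA : ∀ u, A < |u| → r u = 0) :
    ∃ C : ℝ, 0 < C ∧ ∀ L : ℝ, 2 ≤ L → Near L → ∀ (ρ : Zr) (t : ℝ),
      (ρ ∈ bd (Real.exp L) ∨ t ∈ Icc (Real.exp L) (2 * Real.exp L)) →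
      ‖Lap (sc r L) (wz ρ t)‖ * (1 + |(ρ : ℂ).im - t|) ^ 6 ≤ C * L := by
  obtain ⟨C6, hC6, h6⟩ := sc_lap_decay h hA 6
  obtain ⟨C8, hC8, h8⟩ := sc_lap_decay h hA 8
  refine ⟨C6 * Real.exp 1 + 4 * C8, by positivity, fun L hL hn ρ t ht => ?_⟩
  have hL0 : 0 < L := by linarith
  have him : |(ρ : ℂ).im - t| ≤ ‖wz ρ t‖ := by rw [← wz_im]; exact Complex.abs_im_le_norm _
  set T := Real.exp L with hT
  have hT1 : 1 ≤ T := Real.one_le_exp hL0.le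
  set x := |(ρ : ℂ).im - t| with hx
  have hx0 : 0 ≤ x := abs_nonneg _
  by_cases hc : T / 2 < (ρ : ℂ).im ∧ (ρ : ℂ).im ≤ 4 * T
  · have k := h6 L (by linarith) (wz ρ t)
    have n := hn ρ hc.1 hc.2
    rw [wz_re] at k
    have e : A * (L * |(ρ : ℂ).re - 1 / 2|) ≤ 1 := by
      have : 0 ≤ L * |(ρ : ℂ).re - 1 / 2| := by positivity
      nlinarith
    calc _ ≤ ‖Lap (sc r L) (wz ρ t)‖ * (1 + ‖wz ρ t‖) ^ 6 := by gcongr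
      _ ≤ C6 * L * Real.exp 1 := k.trans (by gcongr)
      _ ≤ _ := by nlinarith [mul_pos hC8 hL0]
  · have k := h8 L (by linarith) (wz ρ t)
    have hxT : T / 2 ≤ x := by
      rcases ht with ht | ht
      · rw [mem_bd] at ht
        exact absurd ⟨by linarith [ht.1], by linarith [ht.2]⟩ hc
      · rw [not_and_or, not_lt, not_le] at hc
        rcases hc with hc | hc
        · have := neg_le_abs ((ρ : ℂ).im - t)
          linarith [ht.1]
        · have := le_abs_self ((ρ : ℂ).im - t)
          linarith [ht.2]
    have e : A * (L * |(wz ρ t).re|) ≤ L := by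
      have h1 := wz_abs ρ t
      have : 0 ≤ L * |(wz ρ t).re| := by positivity
      nlinarith
    have k2 : ‖Lap (sc r L) (wz ρ t)‖ * (1 + x) ^ 6 * (T / 4) ≤ C8 * L * T := by
      calc _ ≤ ‖Lap (sc r L) (wz ρ t)‖ * (1 + x) ^ 6 * (1 + x) ^ 2 := by
            gcongr; nlinarith
        _ = ‖Lap (sc r L) (wz ρ t)‖ * (1 + x) ^ 8 := by ring
        _ ≤ ‖Lap (sc r L) (wz ρ t)‖ * (1 + ‖wz ρ t‖) ^ 8 := by gcongr
        _ ≤ _ := k.trans (by gcongr; exact Real.exp_le_exp.2 e)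
    have k3 : ‖Lap (sc r L) (wz ρ t)‖ * (1 + x) ^ 6 ≤ 4 * C8 * L := by
      refine le_of_mul_le_mul_right (a := T / 4) ?_ (by positivity)
      linarith
    have := mul_pos (mul_pos hC6 (Real.exp_pos 1)) hL0
    nlinarith

noncomputable def WW (T t : ℝ) : ℝ := 1 / (1 + |t - T|) ^ 2 + 1 / (1 + |t - 2 * T|) ^ 2

lemma WW_nonneg (T t : ℝ) : 0 ≤ WW T t := by unfold WW; positivity
lemma WW_le (T t : ℝ) : WW T t ≤ 2 := by
  unfold WW
  have : ∀ x : ℝ, 1 / (1 + |x|) ^ 2 ≤ 1 := fun x => by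
    rw [div_le_one (by positivity)]
    exact one_le_pow₀ (by linarith [abs_nonneg x])
  linarith [this (t - T), this (t - 2 * T)]

lemma WW_min (T t : ℝ) : 1 / (1 + min |t - T| |t - 2 * T|) ^ 2 ≤ WW T t := by
  unfold WW
  have h1 : 0 ≤ 1 / (1 + |t - T|) ^ 2 := by positivity
  have h2 : 0 ≤ 1 / (1 + |t - 2 * T|) ^ 2 := by positivity
  rcases min_choice |t - T| |t - 2 * T| with h | h <;> rw [h] <;> linarith

lemma wt_tsum : ∃ C : ℝ, 0 < C ∧ ∀ L : ℝ, 2 ≤ L → ∀ (t D K : ℝ), 0 ≤ D → 0 ≤ K → |t| ≤ 2 * Real.exp L + D →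
    ∀ f : Zr → ℂ, (∀ ρ, f ρ = 0 ∨ (D ≤ |(ρ : ℂ).im - t| ∧ ‖f ρ‖ * (1 + |(ρ : ℂ).im - t|) ^ 6 ≤ mu ρ * K)) →
      Summable f ∧ ‖∑' ρ, f ρ‖ ≤ C * K * L * (1 / (1 + D) ^ 2) := by
  obtain ⟨C, hC, hw⟩ := wt_sum_bound
  refine ⟨C * 4, by positivity, fun L hL t D K hD hK htD f hf => ?_⟩
  obtain ⟨hs, hb⟩ := hw t
  have hT := Real.add_one_le_exp L
  have pt : ∀ ρ, ‖f ρ‖ ≤ K * (1 / (1 + D) ^ 4) * wt ρ t := by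
    intro ρ
    have w0 := wt_nonneg ρ t
    rcases hf ρ with h | ⟨h1, h2⟩
    · rw [h, norm_zero]; positivity
    · rw [wt]
      have hm := mu_nonneg ρ
      rw [← sq_abs ((ρ : ℂ).im - t)]
      set x := |(ρ : ℂ).im - t|
      have hx : 0 ≤ x := abs_nonneg _
      have p : (1 + D) ^ 4 * (1 + x ^ 2) ≤ (1 + x) ^ 6 := by
        calc _ ≤ (1 + x) ^ 4 * (1 + x) ^ 2 := by gcongr; nlinarith
          _ = _ := by ring
      have e : K * (1 / (1 + D) ^ 4) * (mu ρ / (1 + x ^ 2)) = mu ρ * K / ((1 + D) ^ 4 * (1 + x ^ 2)) := by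
        rw [mul_one_div, div_mul_div_comm, mul_comm K]
      rw [e, le_div_iff₀ (by positivity)]
      exact (mul_le_mul_of_nonneg_left p (norm_nonneg _)).trans h2
  have hs2 := hs.mul_left (K * (1 / (1 + D) ^ 4))
  have hsf := Summable.of_norm_bounded hs2 pt
  refine ⟨hsf, ?_⟩
  have lg : Real.log (|t| + 2) ≤ 4 * L * (1 + D) ^ 2 := by
    have h1 : Real.log (|t| + 2) ≤ Real.log (4 * Real.exp L * (1 + D)) := by
      refine Real.log_le_log (by positivity) ?_
      nlinarith [mul_nonneg hD (Real.exp_pos L).le]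
    rw [Real.log_mul (by positivity) (by positivity), Real.log_mul (by positivity) (by positivity), Real.log_exp] at h1
    have h2 := Real.log_le_sub_one_of_pos (show 0 < 1 + D by positivity)
    have h3 := Real.log_le_sub_one_of_pos (show (0:ℝ) < 4 by norm_num)
    nlinarith [mul_nonneg hD hD, mul_nonneg (mul_nonneg hD hD) (by linarith : 0 ≤ L)]
  calc _ ≤ ∑' ρ, K * (1 / (1 + D) ^ 4) * wt ρ t := tsum_of_norm_bounded hs2.hasSum pt
    _ = K * (1 / (1 + D) ^ 4) * ∑' ρ, wt ρ t := tsum_mul_left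
    _ ≤ K * (1 / (1 + D) ^ 4) * (C * (4 * L * (1 + D) ^ 2)) := by
        gcongr
        exact hb.trans (by gcongr)
    _ = _ := by field_simp

lemma zero_side {r : ℝ → ℝ} (h : TF r) (heven : ∀ u, r (-u) = r u) {A : ℝ} (hA0 : 0 ≤ A) (hA1 : A ≤ 1) (hA : ∀ u, A < |u| → r u = 0) :
    ∃ C : ℝ, 0 < C ∧ ∀ L : ℝ, 2 ≤ L → Near L → ∀ t : ℝ,
      ‖FB r L t‖ ≤ C * L ^ 2 ∧
      (t ∉ Ioc (Real.exp L) (2 * Real.exp L) → ‖FB r L t‖ ≤ C * L ^ 2 * WW (Real.exp L) t) ∧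
      (t ∈ Ioc (Real.exp L) (2 * Real.exp L) → ‖FB r L t - (MM r (NN A L) L t : ℝ)‖ ≤
        C * (L ^ 2 * WW (Real.exp L) t + L * Real.exp ((A - 1) * L))) := by
  obtain ⟨C1, hC1, h1⟩ := lap_bd h hA0 hA1 hA
  obtain ⟨C2, hC2, h2⟩ := wt_tsum
  obtain ⟨C3, hC3, h3⟩ := explicit3 h heven hA
  refine ⟨2 * C2 * C1 + C3, by positivity, fun L hL hn t => ?_⟩
  have hL0 : 0 < L := by linarith
  have hT0 : 0 < Real.exp L := Real.exp_pos L
  set T := Real.exp L with hT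
  have hW := WW_nonneg T t
  have hW2 := WW_le T t
  have hWm := WW_min T t
  set D := min |t - T| |t - 2 * T| with hD
  have hD0 : 0 ≤ D := le_min (abs_nonneg _) (abs_nonneg _)
  have hD1 : D ≤ |t - T| := min_le_left _ _
  have hD2 : D ≤ |t - 2 * T| := min_le_right _ _
  have htD : |t| ≤ 2 * T + D := by
    have a1 : |t| ≤ |t - T| + |T| := by simpa using abs_add_le (t - T) T
    have a2 : |t| ≤ |t - 2 * T| + |2 * T| := by simpa using abs_add_le (t - 2 * T) (2 * T)
    rw [abs_of_pos hT0] at a1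
    rw [abs_of_pos (by linarith : 0 < 2 * T)] at a2
    rcases min_choice |t - T| |t - 2 * T| with q | q <;> rw [hD, q] <;> linarith
  set g : Zr → ℂ := fun ρ => (mu ρ : ℂ) * Lap (sc r L) (wz ρ t) with hg
  have hgb : ∀ ρ, (ρ ∈ bd T ∨ t ∈ Icc T (2 * T)) → ‖g ρ‖ * (1 + |(ρ : ℂ).im - t|) ^ 6 ≤ mu ρ * (C1 * L) := by
    intro ρ hh
    have := h1 L hL hn ρ t hh
    rw [hg]
    simp only [norm_mul, Complex.norm_real, Real.norm_eq_abs, abs_of_nonneg (mu_nonneg ρ)]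
    rw [mul_assoc]
    exact mul_le_mul_of_nonneg_left this (mu_nonneg ρ)
  classical
  have eFB : FB r L t = ∑' ρ, (if ρ ∈ bd T then g ρ else 0) := by
    rw [tsum_eq_sum (s := bd T) (fun ρ hρ => if_neg hρ), FB]
    exact Finset.sum_congr rfl fun ρ hρ => by rw [if_pos hρ]
  have ub : ∀ d, 1 / (1 + d) ^ 2 ≤ WW T t → C2 * (C1 * L) * L * (1 / (1 + d) ^ 2) ≤ (2 * C2 * C1 + C3) * L ^ 2 * WW T t := by
    intro d hd
    calc _ ≤ C2 * (C1 * L) * L * WW T t := by gcongr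
      _ = C2 * C1 * (L ^ 2 * WW T t) := by ring
      _ ≤ (2 * C2 * C1 + C3) * (L ^ 2 * WW T t) := by gcongr; nlinarith [mul_pos hC2 hC1]
      _ = _ := by ring
  have out : t ∉ Ioc T (2 * T) → ‖FB r L t‖ ≤ C2 * (C1 * L) * L * (1 / (1 + D) ^ 2) := by
    intro ht
    rw [eFB]
    refine (h2 L hL t D (C1 * L) hD0 (by positivity) htD _ fun ρ => ?_).2
    by_cases hρ : ρ ∈ bd T
    · right
      rw [if_pos hρ]
      refine ⟨?_, hgb ρ (Or.inl hρ)⟩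
      rw [mem_bd] at hρ
      rw [mem_Ioc, not_and_or, not_lt, not_le] at ht
      rcases ht with ht | ht
      · rw [abs_of_nonpos (by linarith)] at hD1
        exact le_trans (by linarith) (le_abs_self _)
      · rw [abs_of_nonneg (by linarith)] at hD2
        exact le_trans (by linarith) (neg_le_abs _)
    · left; rw [if_neg hρ]
  refine ⟨?_, fun ht => (out ht).trans (ub D hWm), fun ht => ?_⟩
  · by_cases ht : t ∈ Ioc T (2 * T)
    · rw [eFB]
      have := (h2 L hL t 0 (C1 * L) le_rfl (by positivity) (by rw [abs_of_pos (by linarith [ht.1])]; linarith [ht.2])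
        (fun ρ => if ρ ∈ bd T then g ρ else 0) fun ρ => ?_).2
      · refine this.trans ?_
        have : 0 ≤ (C2 * C1 + C3) * L ^ 2 := by positivity
        norm_num
        nlinarith
      by_cases hρ : ρ ∈ bd T
      · right
        rw [if_pos hρ]
        exact ⟨abs_nonneg _, hgb ρ (Or.inl hρ)⟩
      · left; rw [if_neg hρ]
    · refine (out ht).trans ?_
      have : 1 / (1 + D) ^ 2 ≤ 2 := hWm.trans hW2
      calc _ ≤ C2 * (C1 * L) * L * 2 := by gcongr
        _ ≤ _ := by nlinarith [mul_pos hC3 (pow_pos hL0 2)]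
  · have htI : t ∈ Icc T (2 * T) := ⟨ht.1.le, ht.2⟩
    have ex := h3 L (by linarith) (NN A L) (NN_gt A L) t ht.1.le
    obtain ⟨s1, -⟩ := h2 L hL t 0 (C1 * L) le_rfl (by positivity) (by rw [abs_of_pos (by linarith [ht.1])]; linarith [ht.2])
        g fun ρ => Or.inr ⟨abs_nonneg _, hgb ρ (Or.inr htI)⟩
    obtain ⟨s2, b2⟩ := h2 L hL t D (C1 * L) hD0 (by positivity) htD (fun ρ => if ρ ∈ bd T then 0 else g ρ) fun ρ => by
      by_cases hρ : ρ ∈ bd T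
      · left; rw [if_pos hρ]
      · right
        rw [if_neg hρ]
        refine ⟨?_, hgb ρ (Or.inr htI)⟩
        rw [mem_bd, not_and_or, not_lt, not_le] at hρ
        rcases hρ with hρ | hρ
        · rw [abs_of_nonneg (by linarith [ht.1])] at hD1
          exact le_trans (by linarith) (neg_le_abs _)
        · rw [abs_of_nonpos (by linarith [ht.2])] at hD2
          exact le_trans (by linarith) (le_abs_self _)
    have e : HH (sc r L) t = FB r L t + ∑' ρ, (if ρ ∈ bd T then 0 else g ρ) := by
      rw [eFB, ← Summable.tsum_add (summable_of_ne_finset_zero (s := bd T) fun ρ hρ => if_neg hρ) s2, HH]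
      refine tsum_congr fun ρ => ?_
      by_cases hρ : ρ ∈ bd T <;> simp [hρ, hg]
    have e2 : FB r L t - (MM r (NN A L) L t : ℝ) = (HH (sc r L) t - (MM r (NN A L) L t : ℝ)) - ∑' ρ, (if ρ ∈ bd T then 0 else g ρ) := by
      rw [e]; ring
    rw [e2]
    refine (norm_sub_le _ _).trans ?_
    have u := b2.trans (ub D hWm)
    have : C3 * L * Real.exp ((A - 1) * L) ≤ (2 * C2 * C1 + C3) * (L * Real.exp ((A - 1) * L)) := by
      have : 0 ≤ 2 * C2 * C1 * (L * Real.exp ((A - 1) * L)) := by positivity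
      nlinarith
    calc _ ≤ _ := add_le_add (ex.trans this) u
      _ = _ := by ring


lemma WW_int (T : ℝ) : Integrable (WW T) ∧ ∫ t, WW T t = 2 * ∫ v : ℝ, 1 / (1 + |v|) ^ 2 := by
  have i := int_pow_bound 2 le_rfl
  have i1 := i.comp_sub_right T
  have i2 := i.comp_sub_right (2 * T)
  refine ⟨i1.add i2, ?_⟩
  unfold WW
  rw [integral_add i1 i2, integral_sub_right_eq_self (fun v : ℝ => 1 / (1 + |v|) ^ 2) T,
    integral_sub_right_eq_self (fun v : ℝ => 1 / (1 + |v|) ^ 2) (2 * T)]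
  ring

lemma cmp_int {f : ℝ → ℂ} {m : ℝ → ℝ} {T B η : ℝ} (hT : 0 ≤ T) (hf : Integrable f)
    (hm : IntervalIntegrable m volume T (2 * T)) (h1 : ∀ t ∉ Ioc T (2 * T), ‖f t‖ ≤ B * WW T t)
    (h2 : ∀ t ∈ Ioc T (2 * T), ‖f t - (m t : ℝ)‖ ≤ B * WW T t + η) :
    ‖(∫ t, f t) - ((∫ t in T..(2 * T), m t : ℝ) : ℂ)‖ ≤ B * (2 * ∫ v : ℝ, 1 / (1 + |v|) ^ 2) + T * η := by
  obtain ⟨w1, w2⟩ := WW_int T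
  rw [intervalIntegral.integral_of_le (by linarith), ← integral_complex_ofReal, ← integral_indicator measurableSet_Ioc]
  have hm' := ((intervalIntegrable_iff_integrableOn_Ioc_of_le (by linarith)).1 hm).ofReal (𝕜 := ℂ)
  have hm2 : Integrable ((Ioc T (2 * T)).indicator fun x => ((m x : ℝ) : ℂ)) := (integrable_indicator_iff measurableSet_Ioc).2 hm'
  have hη : Integrable ((Ioc T (2 * T)).indicator fun _ => η) := (integrable_indicator_iff measurableSet_Ioc).2 (by simp)
  rw [← integral_sub hf hm2]
  refine (norm_integral_le_of_norm_le ((w1.const_mul B).add hη) (Eventually.of_forall fun t => ?_)).trans (le_of_eq ?_)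
  · by_cases ht : t ∈ Ioc T (2 * T)
    · simpa [ht] using h2 t ht
    · simpa [ht] using h1 t ht
  · have := integral_add (w1.const_mul B) hη
    refine this.trans ?_
    rw [integral_const_mul, w2, integral_indicator measurableSet_Ioc, setIntegral_const]
    simp
    rw [max_eq_left (by linarith)]; left; ring

lemma wz_eq (ρ : Zr) (t : ℝ) : wz ρ t = ((ρ : ℂ) - 1 / 2) - t * Complex.I := rfl

lemma FB_cont {r : ℝ → ℝ} (h : TF r) {L : ℝ} (hL : 0 < L) : Continuous (FB r L) := by
  have := lap_cont (sc_TF h hL)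
  unfold FB wz
  fun_prop

lemma lapneg_int {g : ℝ → ℝ} (h : TF g) (a : ℂ) : Integrable fun t : ℝ => Lap g (a - t * Complex.I) := by
  have := (lap_vert_int0 h a).comp_neg
  refine this.congr (Eventually.of_forall fun t => ?_)
  simp [sub_eq_add_neg]

lemma FB_int {r : ℝ → ℝ} (h : TF r) {L : ℝ} (hL : 0 < L) : Integrable (FB r L) := by
  unfold FB
  exact integrable_finsetSum _ fun ρ _ => (lapneg_int (sc_TF h hL) _).const_mul _

lemma FB_integral {r : ℝ → ℝ} (h : TF r) {L : ℝ} (hL : 0 < L) :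
    ∫ t, FB r L t = 2 * Real.pi * r 0 * (∑ ρ ∈ bd (Real.exp L), mu ρ : ℝ) := by
  simp only [FB, wz_eq]
  rw [integral_finsetSum _ fun ρ _ => (lapneg_int (sc_TF h hL) _).const_mul _]
  push_cast
  rw [Finset.mul_sum]
  refine Finset.sum_congr rfl fun ρ _ => ?_
  rw [integral_const_mul]
  have := lap_inv (sc_TF h hL) ((ρ : ℂ) - 1 / 2) 0
  rw [← integral_neg_eq_self] at this
  simp only [Complex.ofReal_zero, mul_zero, Complex.exp_zero, mul_one, Complex.ofReal_neg, neg_mul, ← sub_eq_add_neg] at this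
  rw [this]
  simp [sc]; ring

lemma FB_prod {r1 r2 : ℝ → ℝ} (h1 : TF r1) (h2 : TF r2) (heven : ∀ u, r1 (-u) = r1 u) (h12 : ∀ u, r1 u * r2 u = r1 u)
    {L : ℝ} (hL : 0 < L) :
    ∫ t, FB r1 L t * FB r2 L t = 2 * Real.pi * L * ∑ ρ ∈ bd (Real.exp L), ∑ σ ∈ bd (Real.exp L),
      (mu ρ * mu σ : ℝ) * Lap r1 (L * ((σ : ℂ) - ρ)) := by
  have hL1 := sc_TF h1 hL
  have hL2 := sc_TF h2 hL
  have c1 := lap_cont hL1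
  have c2 := lap_cont hL2
  have ii : ∀ a b : ℂ, Integrable fun t : ℝ => Lap (sc r1 L) (a - t * Complex.I) * Lap (sc r2 L) (b - t * Complex.I) := by
    intro a b
    have j2 := lapneg_int hL2 b
    obtain ⟨B, hB⟩ : ∃ B, ∀ t : ℝ, ‖Lap (sc r1 L) (a - t * Complex.I)‖ ≤ B := by
      obtain ⟨S, hS0, hS⟩ := hL1.supp
      obtain ⟨C, hC, hb⟩ := lap_decay hL1 hS 0
      refine ⟨C * Real.exp (S * |a.re|), fun t => ?_⟩
      simpa using hb (a - t * Complex.I)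
    exact j2.bdd_mul (Continuous.aestronglyMeasurable (by fun_prop)) (Eventually.of_forall hB)
  have e : ∀ t, FB r1 L t * FB r2 L t = ∑ ρ ∈ bd (Real.exp L), ∑ σ ∈ bd (Real.exp L), ((mu ρ * mu σ : ℝ) : ℂ) *
      (Lap (sc r1 L) (((ρ : ℂ) - 1 / 2) - t * Complex.I) * Lap (sc r2 L) (((σ : ℂ) - 1 / 2) - t * Complex.I)) := by
    intro t
    rw [FB, FB, Finset.sum_mul_sum]
    refine Finset.sum_congr rfl fun ρ _ => Finset.sum_congr rfl fun σ _ => ?_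
    simp only [wz_eq]; push_cast; ring
  simp_rw [e]
  rw [integral_finsetSum _ fun ρ _ => integrable_finsetSum _ fun σ _ => (ii _ _).const_mul _, Finset.mul_sum]
  refine Finset.sum_congr rfl fun ρ _ => ?_
  rw [integral_finsetSum _ fun σ _ => (ii _ _).const_mul _, Finset.mul_sum]
  refine Finset.sum_congr rfl fun σ _ => ?_
  rw [integral_const_mul, lap_parseval hL1 hL2]
  have e3 : (∫ u : ℝ, (sc r1 L (-u) : ℂ) * sc r2 L u * Complex.exp (((σ : ℂ) - 1 / 2 - ((ρ : ℂ) - 1 / 2)) * u)) = Lap (sc r1 L) ((σ : ℂ) - ρ) := by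
    rw [Lap]
    congr 1; ext u
    rw [sc, sc, neg_div, heven, ← Complex.ofReal_mul, h12, sc, sub_sub_sub_cancel_right]
  rw [e3, sc_lap r1 hL]; ring


lemma MM_cont (r : ℝ → ℝ) (N : ℕ) (L : ℝ) {T : ℝ} (hT : 0 < T) : ContinuousOn (MM r N L) (uIcc T (2 * T)) :=
  (continuousOn_const.mul (lg_cont hT)).sub (Pn_cont (ca r L) N).continuousOn

lemma comb {r1 r2 : ℝ → ℝ} (h1 : TF r1) (h2 : TF r2) (e1 : ∀ u, r1 (-u) = r1 u) (e2 : ∀ u, r2 (-u) = r2 u)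
    {A : ℝ} (hA0 : 0 ≤ A) (hA1 : A ≤ 1) (hr1 : ∀ u, A < |u| → r1 u = 0) (hr2 : ∀ u, A < |u| → r2 u = 0) :
    ∃ C : ℝ, 0 < C ∧ ∀ L : ℝ, 2 ≤ L → Near L →
      ‖(∫ t, FB r1 L t * FB r2 L t) - ((∫ t in Real.exp L..(2 * Real.exp L), MM r1 (NN A L) L t * MM r2 (NN A L) L t : ℝ) : ℂ)‖
        ≤ C * (L ^ 4 + L ^ 3 * Real.exp (A * L)) ∧
      ‖(∫ t, FB r2 L t) - ((∫ t in Real.exp L..(2 * Real.exp L), MM r2 (NN A L) L t : ℝ) : ℂ)‖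
        ≤ C * (L ^ 4 + L ^ 3 * Real.exp (A * L)) := by
  obtain ⟨C1, hC1, z1⟩ := zero_side h1 e1 hA0 hA1 hr1
  obtain ⟨C2, hC2, z2⟩ := zero_side h2 e2 hA0 hA1 hr2
  set J : ℝ := 2 * ∫ v : ℝ, 1 / (1 + |v|) ^ 2 with hJ
  have hJ0 : 0 ≤ J := mul_nonneg zero_le_two (integral_nonneg fun v => by positivity)
  refine ⟨(5 * C1 * C2 + C2) * (J + 1), by positivity, fun L hL hn => ?_⟩
  have hL0 : 0 < L := by linarith
  have hT0 := Real.exp_pos L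
  set T := Real.exp L with hT
  set x := Real.exp ((A - 1) * L) with hx
  have hx0 : 0 < x := Real.exp_pos _
  have hx1 : x ≤ 1 := Real.exp_le_one_iff.2 (by nlinarith)
  have hTx : T * x = Real.exp (A * L) := by rw [hT, hx, ← Real.exp_add]; ring_nf
  have m1 := MM_cont r1 (NN A L) L hT0
  have m2 := MM_cont r2 (NN A L) L hT0
  have f1 := FB_cont h1 hL0
  have i2 := FB_int h2 hL0
  have i12 : Integrable fun t => FB r1 L t * FB r2 L t :=
    i2.bdd_mul f1.aestronglyMeasurable (Eventually.of_forall fun t => (z1 L hL hn t).1)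
  have LL : L * x ≤ L ^ 2 := by nlinarith
  have hE := Real.exp_pos (A * L)
  constructor
  · have := cmp_int (f := fun t => FB r1 L t * FB r2 L t) (m := fun t => MM r1 (NN A L) L t * MM r2 (NN A L) L t)
      (B := 5 * C1 * C2 * L ^ 4) (η := 5 * C1 * C2 * L ^ 3 * x) hT0.le i12 ((m1.mul m2).intervalIntegrable) (by
      intro t ht
      have w := WW_nonneg T t
      rw [norm_mul]
      calc _ ≤ (C1 * L ^ 2) * (C2 * L ^ 2 * WW T t) := by
            gcongr
            exacts [(z1 L hL hn t).1, (z2 L hL hn t).2.1 ht]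
        _ = C1 * C2 * L ^ 4 * WW T t := by ring
        _ ≤ _ := by
            have : 0 ≤ C1 * C2 * L ^ 4 * WW T t := by positivity
            nlinarith) (by
      intro t ht
      have w := WW_nonneg T t
      have w2 := WW_le T t
      have a1 := (z1 L hL hn t).1
      have b1 := (z1 L hL hn t).2.2 ht
      have a2 := (z2 L hL hn t).1
      have b2 := (z2 L hL hn t).2.2 ht
      have mm : ‖((MM r2 (NN A L) L t : ℝ) : ℂ)‖ ≤ 4 * C2 * L ^ 2 := by
        have t1 := norm_sub_le (FB r2 L t) (FB r2 L t - (MM r2 (NN A L) L t : ℝ))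
        rw [sub_sub_cancel] at t1
        have : C2 * (L ^ 2 * WW T t + L * x) ≤ C2 * (L ^ 2 * 2 + L ^ 2) := by gcongr
        linarith
      have e : FB r1 L t * FB r2 L t - ((MM r1 (NN A L) L t * MM r2 (NN A L) L t : ℝ) : ℂ) =
          FB r1 L t * (FB r2 L t - (MM r2 (NN A L) L t : ℝ)) + (FB r1 L t - (MM r1 (NN A L) L t : ℝ)) * (MM r2 (NN A L) L t : ℝ) := by
        push_cast; ring
      rw [e]
      refine (norm_add_le _ _).trans ?_
      rw [norm_mul, norm_mul]
      calc _ ≤ (C1 * L ^ 2) * (C2 * (L ^ 2 * WW T t + L * x)) + (C1 * (L ^ 2 * WW T t + L * x)) * (4 * C2 * L ^ 2) := by gcongr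
        _ = _ := by ring)
    refine this.trans ?_
    rw [← hJ, ← hTx]
    have p1 : 0 ≤ C1 * C2 * L ^ 4 := by positivity
    have p2 : 0 ≤ C1 * C2 * (L ^ 3 * (T * x)) * J := by positivity
    have p3 : 0 ≤ C2 * (J + 1) * (L ^ 4 + L ^ 3 * (T * x)) := by positivity
    linear_combination p3 + 5 * p1 + 5 * p2
  · have := cmp_int (f := FB r2 L) (m := MM r2 (NN A L) L)
      (B := C2 * L ^ 2) (η := C2 * (L * x)) hT0.le i2 (m2.intervalIntegrable) (fun t ht => (z2 L hL hn t).2.1 ht)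
      (fun t ht => ((z2 L hL hn t).2.2 ht).trans (le_of_eq (by ring)))
    refine this.trans ?_
    rw [← hJ, ← hTx]
    have q1 : L ^ 2 ≤ L ^ 4 := pow_le_pow_right₀ (by linarith) (by norm_num)
    have q2 : L ≤ L ^ 3 := le_self_pow₀ (by linarith) (by norm_num)
    calc _ = C2 * (L ^ 2 * J + L * (T * x)) := by ring
      _ ≤ C2 * (L ^ 4 * (J + 1) + L ^ 3 * (T * x) * (J + 1)) := by
        have t1 : L ^ 2 * J ≤ L ^ 4 * (J + 1) := by gcongr; linarith
        have t2 : L * (T * x) ≤ L ^ 3 * (T * x) := by gcongr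
        have t3 : L ^ 3 * (T * x) ≤ L ^ 3 * (T * x) * (J + 1) := le_mul_of_one_le_right (by positivity) (by linarith)
        gcongr ?_ * ?_
        linarith
      _ = C2 * (J + 1) * (L ^ 4 + L ^ 3 * (T * x)) := by ring
      _ ≤ _ := by gcongr; nlinarith [mul_pos hC1 hC2]

lemma bound2 {r1 r2 : ℝ → ℝ} (h1 : TF r1) (h2 : TF r2) (e1 : ∀ u, r1 (-u) = r1 u) (e2 : ∀ u, r2 (-u) = r2 u)
    (h0 : ∀ u, 0 ≤ r1 u) {A b : ℝ} (hA0 : 0 ≤ A) (hA1 : A ≤ 1) (hr1 : ∀ u, A < |u| → r1 u = 0) (hr2 : ∀ u, A < |u| → r2 u = 0)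
    (h20 : r2 0 = 1) (h12 : ∀ u, r1 u * r2 u = r1 u) (hpos : ∀ w : ℂ, |w.re| ≤ b → 0 ≤ (Lap r1 w).re) :
    ∃ C : ℝ, 0 < C ∧ ∀ L : ℝ, 2 ≤ L → Near L → (∀ ρ ∈ bd (Real.exp L), |(ρ : ℂ).re - 1 / 2| ≤ b / (2 * L)) →
      2 * Real.pi * (∫ u, r1 u) * ∑ ρ ∈ bd (Real.exp L), mu ρ ^ 2 ≤
        Real.exp L * L * (r1 0 + 2 * ∫ u in (0:ℝ)..1, u * r1 u) + C * (Real.exp L + L ^ 4 + L ^ 3 * Real.exp (A * L)) ∧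
      Real.exp L * L - C * (Real.exp L + L ^ 4 + L ^ 3 * Real.exp (A * L)) ≤ 2 * Real.pi * ∑ ρ ∈ bd (Real.exp L), mu ρ := by
  obtain ⟨C0, hC0, c0⟩ := comb h1 h2 e1 e2 hA0 hA1 hr1 hr2
  obtain ⟨C1, hC1, c1⟩ := moment2 h1 h2 h0 hA0 hA1 hr1 hr2 h20 h12
  obtain ⟨C2, hC2, c2⟩ := moment1 h2 hA0 hA1 hr2 h20
  refine ⟨C0 + C1 + C2 + 2, by positivity, fun L hL hn hb => ?_⟩
  have hL0 : 0 < L := by linarith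
  have hT0 := Real.exp_pos L
  have hE0 := Real.exp_pos (A * L)
  obtain ⟨d1, d2⟩ := c0 L hL hn
  have m1 := c1 L hL
  have m2 := c2 L hL
  rw [FB_prod h1 h2 e1 h12 hL0] at d1
  rw [FB_integral h2 hL0, h20] at d2
  have d1' := (Complex.abs_re_le_norm _).trans d1
  have d2' := (Complex.abs_re_le_norm _).trans d2
  generalize Real.exp (A * L) = E at *
  generalize hT : Real.exp L = T at *
  have q2 : L ≤ L ^ 3 := le_self_pow₀ (by linarith) (by norm_num)
  constructor
  · have lower : (∫ u, r1 u) * ∑ ρ ∈ bd T, mu ρ ^ 2 ≤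
        (∑ ρ ∈ bd T, ∑ σ ∈ bd T, ((mu ρ * mu σ : ℝ) : ℂ) * Lap r1 (L * ((σ : ℂ) - ρ))).re := by
      rw [Complex.re_sum, Finset.mul_sum]
      refine Finset.sum_le_sum fun ρ hρ => ?_
      rw [Complex.re_sum]
      have hz : (Lap r1 0).re = ∫ u, r1 u := by
        simp only [Lap, zero_mul, Complex.exp_zero, mul_one]
        rw [integral_complex_ofReal, Complex.ofReal_re]
      have nn : ∀ σ ∈ bd T, 0 ≤ (((mu ρ * mu σ : ℝ) : ℂ) * Lap r1 (L * ((σ : ℂ) - ρ))).re := by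
        intro σ hσ
        rw [Complex.re_ofReal_mul]
        refine mul_nonneg (mul_nonneg (mu_nonneg _) (mu_nonneg _)) (hpos _ ?_)
        rw [Complex.re_ofReal_mul, abs_mul, abs_of_pos hL0, Complex.sub_re]
        have := (abs_sub _ _).trans (add_le_add (hb σ hσ) (hb ρ hρ))
        rw [sub_sub_sub_cancel_right] at this
        calc _ ≤ L * (b / (2 * L) + b / (2 * L)) := by gcongr
          _ = b := by field_simp; norm_num
      refine le_trans (le_of_eq ?_) (Finset.single_le_sum nn hρ)
      rw [sub_self, mul_zero, Complex.re_ofReal_mul, hz]; ring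
    rw [Complex.sub_re, Complex.ofReal_re] at d1'
    have d3 := (abs_le.1 d1').2
    have e4 : (2 * Real.pi * L * ∑ ρ ∈ bd T, ∑ σ ∈ bd T, ((mu ρ * mu σ : ℝ) : ℂ) * Lap r1 (L * ((σ : ℂ) - ρ))).re
      = 2 * Real.pi * L * (∑ ρ ∈ bd T, ∑ σ ∈ bd T, ((mu ρ * mu σ : ℝ) : ℂ) * Lap r1 (L * ((σ : ℂ) - ρ))).re := by
      rw [← Complex.re_ofReal_mul]; push_cast; rfl
    rw [e4] at d3
    have l2 := mul_le_mul_of_nonneg_left lower (by positivity : 0 ≤ 2 * Real.pi * L)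
    generalize (∑ ρ ∈ bd T, ∑ σ ∈ bd T, ((mu ρ * mu σ : ℝ) : ℂ) * Lap r1 (L * ((σ : ℂ) - ρ))).re = S at *
    generalize (r1 0 + 2 * ∫ u in (0:ℝ)..1, u * r1 u) = Q at *
    generalize (∫ u, r1 u) = q at *
    generalize ∑ ρ ∈ bd T, mu ρ ^ 2 = s at *
    refine le_of_mul_le_mul_left ?_ hL0
    have k1 : C0 * (L ^ 4 + L ^ 3 * E) ≤ C0 * (L * (L ^ 4 + L ^ 3 * E)) := by
      exact mul_le_mul_of_nonneg_left (le_mul_of_one_le_left (by positivity) (by linarith)) hC0.le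
    have k2 : C1 * (L ^ 3 * E) ≤ C1 * (L * (L ^ 3 * E)) := by
      exact mul_le_mul_of_nonneg_left (le_mul_of_one_le_left (by positivity) (by linarith)) hC1.le
    have k3 : 0 ≤ C0 * (L * T) := by positivity
    have k4 : 0 ≤ C1 * (L * L ^ 4) := by positivity
    have k5 : 0 ≤ (C2 + 2) * (L * (T + L ^ 4 + L ^ 3 * E)) := by positivity
    linarith
  · rw [Complex.sub_re, Complex.ofReal_re] at d2'
    have d3 := (abs_le.1 d2').1
    have e4 : (2 * Real.pi * ((1:ℝ) : ℂ) * ((∑ ρ ∈ bd T, mu ρ : ℝ) : ℂ)).re = 2 * Real.pi * ∑ ρ ∈ bd T, mu ρ := by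
      have : 2 * Real.pi * ((1:ℝ) : ℂ) * ((∑ ρ ∈ bd T, mu ρ : ℝ) : ℂ) = ((2 * Real.pi * ∑ ρ ∈ bd T, mu ρ : ℝ) : ℂ) := by push_cast; ring
      rw [this, Complex.ofReal_re]
    rw [e4] at d3
    have k2 : C2 * (L * E) ≤ C2 * (L ^ 3 * E) := by gcongr
    have k3 : 0 ≤ C0 * T := by positivity
    have k4 : 0 ≤ C2 * (T + L ^ 4) := by positivity
    have k5 : 0 ≤ C1 * (T + L ^ 4 + L ^ 3 * E) := by positivity
    have k6 : 0 ≤ L ^ 4 + L ^ 3 * E := by positivity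
    linarith


lemma Nsimple_ge (T : ℝ) : ∑ ρ ∈ bd T, (2 * mu ρ - mu ρ ^ 2) ≤ Nsimple T := by
  classical
  have hS : {ρ ∈ zeroBand T | zetaMult ρ = 1} = (((bd T).filter fun ρ => mu ρ = 1).map (Function.Embedding.subtype _) : Finset ℂ) := by
    ext z
    simp only [Finset.coe_map, Finset.coe_filter, mem_ofPred_eq, Set.mem_image, mem_bd, Function.Embedding.subtype_apply, zeroBand]
    constructor
    · rintro ⟨⟨hz, h1, h2⟩, h3⟩
      refine ⟨⟨z, (XX_zero_iff z).2 hz⟩, ⟨⟨h1, h2⟩, ?_⟩, rfl⟩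
      rw [zetaMult_eq hz] at h3
      simp [mu, h3]
    · rintro ⟨w, ⟨⟨h1, h2⟩, h3⟩, rfl⟩
      have hz := (XX_zero_iff w).1 w.2
      refine ⟨⟨hz, h1, h2⟩, ?_⟩
      rw [zetaMult_eq hz]
      unfold mu at h3; exact_mod_cast h3
  rw [Nsimple, hS, finsum_mem_coe_finset, Finset.sum_map, Finset.sum_filter]
  refine Finset.sum_le_sum fun ρ _ => ?_
  split_ifs with h
  · rw [h]; norm_num
  · have h1 := mu_pos ρ
    have h2 : 2 ≤ mu ρ := by
      unfold mu at *
      have h1' : 1 ≤ analyticOrderNatAt XX ρ := by exact_mod_cast h1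
      have h3 : analyticOrderNatAt XX ρ ≠ 1 := by exact_mod_cast h
      have : 2 ≤ analyticOrderNatAt XX ρ := by omega
      exact_mod_cast this
    nlinarith

lemma err_tendsto (C A : ℝ) (hA : A < 1) :
    Tendsto (fun L : ℝ => -(C * (1 / L + L ^ 3 * Real.exp (-L) + L ^ 2 * Real.exp (-((1 - A) * L))))) atTop (𝓝 0) := by
  have t1 : Tendsto (fun L : ℝ => 1 / L) atTop (𝓝 0) := by simpa using tendsto_inv_atTop_zero (𝕜 := ℝ)
  have t2 := Real.tendsto_pow_mul_exp_neg_atTop_nhds_zero 3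
  have t3 := (Real.tendsto_pow_mul_exp_neg_atTop_nhds_zero 2).comp (tendsto_id.const_mul_atTop (sub_pos.2 hA))
  have t4 := t3.const_mul ((1 - A) ^ 2)⁻¹
  have := (((t1.add t2).add t4).const_mul C).neg
  simp only [mul_zero, add_zero, neg_zero] at this
  refine this.congr fun L => ?_
  have : (1 - A) ≠ 0 := (sub_pos.2 hA).ne'
  simp only [Function.comp, id]
  congr 3
  rw [mul_pow]; field_simp

theorem final_of_kernel {r1 r2 : ℝ → ℝ} (h1 : TF r1) (h2 : TF r2) (e1 : ∀ u, r1 (-u) = r1 u) (e2 : ∀ u, r2 (-u) = r2 u)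
    (h0 : ∀ u, 0 ≤ r1 u) {A : ℝ} (hA0 : 0 ≤ A) (hA1 : A < 1) (hr1 : ∀ u, A < |u| → r1 u = 0) (hr2 : ∀ u, A < |u| → r2 u = 0)
    (h20 : r2 0 = 1) (h12 : ∀ u, r1 u * r2 u = r1 u) (hpos : ∀ w : ℂ, |w.re| ≤ 0.3185 → 0 ≤ (Lap r1 w).re)
    (hq : 0 < ∫ u, r1 u) (hκ : r1 0 + 2 * (∫ u in (0:ℝ)..1, u * r1 u) ≤ 1.33333092 * ∫ u, r1 u)
    (hbox : ∀ᶠ T in atTop, ∀ ρ ∈ zeroBand T, |ρ.re - 1/2| < 0.3185 / (2 * Real.log T)) :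
    ∃ ε : ℝ → ℝ, Tendsto ε atTop (nhds 0) ∧
      ∀ᶠ T in atTop, (0.66666908 + ε T) * (T / (2 * Real.pi)) * Real.log T ≤ Nsimple T := by
  obtain ⟨C, hC, hb⟩ := bound2 h1 h2 e1 e2 h0 hA0 hA1.le hr1 hr2 h20 h12 hpos
  obtain ⟨T0, hT0⟩ := eventually_atTop.1 hbox
  set q := ∫ u, r1 u with hqd
  refine ⟨_, (err_tendsto (2 * C + C / q) A hA1).comp Real.tendsto_log_atTop, ?_⟩
  filter_upwards [eventually_ge_atTop (Real.exp 2), eventually_ge_atTop (2 * T0)] with T hTe hT2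
  have hTp : 0 < T := (Real.exp_pos 2).trans_le hTe
  simp only [Function.comp]
  set L := Real.log T with hL
  have hTL : Real.exp L = T := Real.exp_log hTp
  have hL2 : 2 ≤ L := (Real.le_log_iff_exp_le hTp).2 hTe
  have he2 : 4 ≤ Real.exp 2 := by
    have := Real.add_one_le_exp 1
    have e : Real.exp 2 = Real.exp 1 * Real.exp 1 := by rw [← Real.exp_add]; norm_num
    nlinarith
  have key : ∀ T' : ℝ, T / 2 ≤ T' → ∀ ρ : Zr, T' < (ρ : ℂ).im → (ρ : ℂ).im ≤ 2 * T' → |(ρ : ℂ).re - 1 / 2| ≤ 0.3185 / (2 * Real.log T') :=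
    fun T' h ρ h3 h4 => (hT0 T' (by linarith) ρ ⟨(XX_zero_iff _).1 ρ.2, h3, h4⟩).le
  have key2 : ∀ T' : ℝ, T / 2 ≤ T' → ∀ ρ : Zr, T' < (ρ : ℂ).im → (ρ : ℂ).im ≤ 2 * T' → L * |(ρ : ℂ).re - 1 / 2| ≤ 1 := by
    intro T' h ρ h3 h4
    have l2 : L - 1 ≤ Real.log T' := by
      have := Real.log_le_log (by positivity) h
      rw [Real.log_div hTp.ne' two_ne_zero, ← hL] at this
      linarith [Real.log_two_lt_d9]
    have k := key T' h ρ h3 h4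
    rw [le_div_iff₀ (by linarith)] at k
    have := abs_nonneg ((ρ : ℂ).re - 1 / 2)
    nlinarith
  have near : Near L := by
    intro ρ h3 h4
    rw [hTL] at h3 h4
    rcases le_or_gt (ρ : ℂ).im T with h | h
    · exact key2 (T / 2) le_rfl ρ h3 (by linarith)
    rcases le_or_gt (ρ : ℂ).im (2 * T) with h' | h'
    · exact key2 T (by linarith) ρ h h'
    · exact key2 (2 * T) (by linarith) ρ h' (by linarith)
  obtain ⟨u1, u2⟩ := hb L hL2 near (by
    intro ρ hρ
    rw [hTL, mem_bd] at hρ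
    exact key T (by linarith) ρ hρ.1 hρ.2)
  rw [hTL] at u1 u2
  refine le_trans ?_ (Nsimple_ge T)
  rw [Finset.sum_sub_distrib, ← Finset.mul_sum]
  have ex : T * L * (1 / L + L ^ 3 * Real.exp (-L) + L ^ 2 * Real.exp (-((1 - A) * L))) = T + L ^ 4 + L ^ 3 * Real.exp (A * L) := by
    have a1 : T * Real.exp (-L) = 1 := by rw [← hTL, ← Real.exp_add]; simp
    have a2 : T * Real.exp (-((1 - A) * L)) = Real.exp (A * L) := by rw [← hTL, ← Real.exp_add]; ring_nf
    have a3 : L * (1 / L) = 1 := by field_simp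
    linear_combination T * a3 + L ^ 4 * a1 + L ^ 3 * a2
  generalize (1 / L + L ^ 3 * Real.exp (-L) + L ^ 2 * Real.exp (-((1 - A) * L))) = y at *
  rw [← ex] at u1 u2
  generalize ∑ ρ ∈ bd T, mu ρ ^ 2 = s2 at *
  generalize ∑ ρ ∈ bd T, mu ρ = s1 at *
  generalize (r1 0 + 2 * ∫ u in (0:ℝ)..1, u * r1 u) = Q at *
  have hp := Real.pi_pos
  have u3 : 2 * Real.pi * s2 ≤ 1.33333092 * (T * L) + C / q * (T * L * y) := by
    have : q * (2 * Real.pi * s2) ≤ q * (1.33333092 * (T * L) + C / q * (T * L * y)) := by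
      have e3 : q * (1.33333092 * (T * L) + C / q * (T * L * y)) = T * L * (1.33333092 * q) + C * (T * L * y) := by field_simp
      have : T * L * Q ≤ T * L * (1.33333092 * q) := by gcongr
      rw [e3]; linarith
    exact le_of_mul_le_mul_left this hq
  have e5 : (0.66666908 + -((2 * C + C / q) * y)) * (T / (2 * Real.pi)) * L = ((0.66666908 + -((2 * C + C / q) * y)) * (T * L)) / (2 * Real.pi) := by ring
  rw [e5, div_le_iff₀ (by positivity)]
  linarith


lemma lap_diff {g : ℝ → ℝ} (h : TF g) : Differentiable ℂ (Lap g) := by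
  intro w0
  have hg := h.cont
  have c1 : Continuous fun u : ℝ => |u| * Real.exp ((‖w0‖ + 1) * |u|) := by fun_prop
  have bi : Integrable fun u : ℝ => |g u| * (|u| * Real.exp ((‖w0‖ + 1) * |u|)) :=
    Continuous.integrable_of_hasCompactSupport (by fun_prop) (h.cpt.abs.mul_right)
  refine (hasDerivAt_integral_of_dominated_loc_of_deriv_le (F := fun (w : ℂ) (u : ℝ) => (g u : ℂ) * Complex.exp (w * u))
    (F' := fun (w : ℂ) (u : ℝ) => (g u : ℂ) * (Complex.exp (w * u) * u)) (Metric.ball_mem_nhds w0 one_pos)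
    (Eventually.of_forall fun w => (h.lap_int w).aestronglyMeasurable) (h.lap_int w0)
    ((h.integrable_mul (by fun_prop)).aestronglyMeasurable) (Eventually.of_forall fun u w hw => ?_) bi
    (Eventually.of_forall fun u w _ => ?_)).2.differentiableAt
  · rw [norm_mul, norm_mul, Complex.norm_real, Complex.norm_real, Complex.norm_exp, Real.norm_eq_abs, Real.norm_eq_abs, mul_comm (Real.exp _)]
    gcongr
    rw [Complex.mul_re, Complex.ofReal_re, Complex.ofReal_im, mul_zero, sub_zero]
    refine (le_abs_self _).trans ?_
    rw [abs_mul]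
    gcongr
    have := norm_le_norm_add_norm_sub' w w0
    rw [mem_ball_iff_norm] at hw
    linarith [Complex.abs_re_le_norm w]
  · have := ((hasDerivAt_id' w).mul_const (u : ℂ)).cexp.const_mul (g u : ℂ)
    simpa using this

lemma lap_even {g : ℝ → ℝ} (he : ∀ u, g (-u) = g u) (w : ℂ) : Lap g (-w) = Lap g w := by
  unfold Lap
  rw [← integral_neg_eq_self]
  simp [he]

lemma lap_conj (g : ℝ → ℝ) (w : ℂ) : Lap g (starRingEnd ℂ w) = starRingEnd ℂ (Lap g w) := by
  unfold Lap
  rw [← integral_conj]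
  refine integral_congr_ae (Eventually.of_forall fun u => ?_)
  simp [← Complex.exp_conj]

lemma lap_pos {r : ℝ → ℝ} (h : TF r) {b : ℝ} (hb : 0 < b) (h1 : ∀ y : ℝ, 0 ≤ (Lap r (b + y * Complex.I)).re)
    (he : ∀ u, r (-u) = r u) (w : ℂ) (hw : |w.re| ≤ b) : 0 ≤ (Lap r w).re := by
  have hd := (lap_diff h).neg.cexp
  have bdry : ∀ z : ℂ, z.re = b → ‖Complex.exp (-Lap r z)‖ ≤ 1 := by
    intro z hz
    rw [Complex.norm_exp, Real.exp_le_one_iff, Complex.neg_re, neg_nonpos]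
    have := h1 z.im
    rwa [← hz, Complex.re_add_im] at this
  obtain ⟨S, hS0, hS⟩ := h.supp
  obtain ⟨C, hC, hb0⟩ := lap_decay h hS 0
  have key := PhragmenLindelof.vertical_strip (a := -b) (b := b) (C := 1) (z := w) (f := fun z => Complex.exp (-Lap r z))
    hd.diffContOnCl ⟨0, div_pos Real.pi_pos (by linarith), 0, by
      refine Asymptotics.IsBigO.of_bound (Real.exp (C * Real.exp (S * b))) ?_
      rw [eventually_inf_principal]
      refine Eventually.of_forall fun z hz => ?_
      simp only [zero_mul, Real.exp_zero, norm_one, mul_one]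
      rw [Complex.norm_exp]
      gcongr
      refine (Complex.re_le_norm _).trans ?_
      rw [norm_neg]
      have := hb0 z
      rw [pow_zero, mul_one] at this
      refine this.trans ?_
      gcongr
      exact abs_le.2 ⟨hz.1.le, hz.2.le⟩⟩
    (fun z hz => by
      have := bdry (-z) (by simp [hz])
      rwa [lap_even he] at this) bdry (abs_le.1 hw).1 (abs_le.1 hw).2
  rw [Complex.norm_exp, Real.exp_le_one_iff, Complex.neg_re, neg_nonpos] at key
  exact key

/-- autocorrelation (of even functions) -/
noncomputable def jj (h : ℝ → ℝ) (α : ℝ) : ℝ := ∫ t, h t * h (α - t)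

lemma jj_eq (h : ℝ → ℝ) : jj h = MeasureTheory.convolution h h (ContinuousLinearMap.mul ℝ ℝ) volume := rfl

lemma jj_TF {h : ℝ → ℝ} (hh : TF h) : TF (jj h) := by
  rw [jj_eq]
  exact ⟨hh.cpt.contDiff_convolution_right _ hh.cont.locallyIntegrable hh.smooth, hh.cpt.convolution _ hh.cpt⟩

lemma jj_lap {h : ℝ → ℝ} (hh : TF h) (w : ℂ) : Lap (jj h) w = Lap h w ^ 2 := by
  have := integral_convolution (L := ContinuousLinearMap.mul ℂ ℂ) (hh.lap_int w) (hh.lap_int w)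
  rw [sq]
  refine Eq.trans ?_ this
  unfold Lap
  refine integral_congr_ae (Eventually.of_forall fun α => ?_)
  simp only [MeasureTheory.convolution_def, ContinuousLinearMap.mul_apply', jj]
  rw [← integral_complex_ofReal, ← integral_mul_const]
  refine integral_congr_ae (Eventually.of_forall fun t => ?_)
  have : Complex.exp (w * α) = Complex.exp (w * t) * Complex.exp (w * (α - t : ℝ)) := by
    rw [← Complex.exp_add]; push_cast; ring_nf
  simp only [this]; push_cast; ring

lemma jj_even {h : ℝ → ℝ} (he : ∀ u, h (-u) = h u) (α : ℝ) : jj h (-α) = jj h α := by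
  unfold jj
  rw [← integral_neg_eq_self]
  refine integral_congr_ae (Eventually.of_forall fun t => ?_)
  simp only [he]
  rw [← he (-α - -t)]; ring_nf

lemma jj_supp {h : ℝ → ℝ} {a : ℝ} (hs : ∀ u, a < |u| → h u = 0) (α : ℝ) (hα : 2 * a < |α|) : jj h α = 0 := by
  unfold jj
  refine integral_eq_zero_of_ae (Eventually.of_forall fun t => ?_)
  rcases lt_or_ge a |t| with h1 | h1
  · simp [hs t h1]
  · have : a < |α - t| := by
      have := abs_sub_abs_le_abs_sub α t
      linarith
    simp [hs _ this]

noncomputable def rk (h : ℝ → ℝ) (b u : ℝ) : ℝ := jj h u / Real.cosh (b * u)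

lemma rk_TF {h : ℝ → ℝ} (hh : TF h) (b : ℝ) : TF (rk h b) := by
  have := jj_TF hh
  refine ⟨this.smooth.div (Real.contDiff_cosh.comp (contDiff_const.mul contDiff_id)) fun x => (Real.cosh_pos _).ne', ?_⟩
  unfold rk
  simp only [div_eq_mul_inv]
  exact this.cpt.mul_right

lemma rk_even {h : ℝ → ℝ} (he : ∀ u, h (-u) = h u) (b u : ℝ) : rk h b (-u) = rk h b u := by
  simp [rk, jj_even he]

lemma rk_pos {h : ℝ → ℝ} (hh : TF h) (he : ∀ u, h (-u) = h u) {b : ℝ} (hb : 0 < b) (w : ℂ) (hw : |w.re| ≤ b) :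
    0 ≤ (Lap (rk h b) w).re := by
  refine lap_pos (rk_TF hh b) hb (fun y => ?_) (rk_even he b) w hw
  have hr := rk_TF hh b
  have e1 : Lap (rk h b) (y * Complex.I + b) + Lap (rk h b) (y * Complex.I - b) = 2 * Lap (jj h) (y * Complex.I) := by
    unfold Lap
    rw [← integral_add (hr.lap_int _) (hr.lap_int _), ← integral_const_mul]
    refine integral_congr_ae (Eventually.of_forall fun u => ?_)
    have hc : (Real.cosh (b * u) : ℂ) ≠ 0 := by exact_mod_cast (Real.cosh_pos _).ne'
    simp only [rk]
    have e2 : Complex.exp ((y * Complex.I + b) * u) + Complex.exp ((y * Complex.I - b) * u) = Complex.exp (y * Complex.I * u) * (2 * Real.cosh (b * u)) := by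
      rw [Complex.ofReal_cosh, Complex.cosh, mul_div_cancel₀ _ two_ne_zero, mul_add, ← Complex.exp_add, ← Complex.exp_add]
      push_cast; ring_nf
    rw [← mul_add, e2, Complex.ofReal_div]
    field_simp
  have e3 : (Lap (rk h b) (y * Complex.I - b)).re = (Lap (rk h b) (y * Complex.I + b)).re := by
    have : (y * Complex.I - b : ℂ) = - starRingEnd ℂ (y * Complex.I + b) := by simp; ring
    rw [this, lap_even (rk_even he b), lap_conj, Complex.conj_re]
  have e4 : 0 ≤ (Lap (jj h) (y * Complex.I)).re := by
    have hc : starRingEnd ℂ (Lap h (y * Complex.I)) = Lap h (y * Complex.I) := by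
      rw [← lap_conj, ← lap_even he]; simp
    rw [jj_lap hh, sq]
    nth_rewrite 2 [← hc]
    rw [Complex.mul_conj, Complex.ofReal_re]
    exact Complex.normSq_nonneg _
  have e5 := congrArg Complex.re e1
  rw [Complex.add_re, e3] at e5
  have e6 : (2 * Lap (jj h) (y * Complex.I)).re = 2 * (Lap (jj h) (y * Complex.I)).re := by simp
  rw [add_comm]; linarith


lemma poly_int (l : List ℝ) (n : ℕ) (a b : ℝ) : ∫ t in a..b, ∑ i ∈ Finset.range n, l.getD i 0 * t ^ i =
    ∑ i ∈ Finset.range n, l.getD i 0 * ((b ^ (i + 1) - a ^ (i + 1)) / (i + 1)) := by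
  rw [intervalIntegral.integral_finsetSum fun i _ => (by fun_prop : Continuous fun t : ℝ => l.getD i 0 * t ^ i).intervalIntegrable _ _]
  refine Finset.sum_congr rfl fun i _ => ?_
  rw [intervalIntegral.integral_const_mul, integral_pow]

noncomputable def jp (α : ℝ) : ℝ := 203/240 - 9/16 * α - 11/12 * α ^ 2 + 2/3 * α ^ 3 - α ^ 5 / 30

lemma jp_eq (α : ℝ) : ∫ t in (α - 1/2)..(1/2), (1 - t ^ 2) * (1 - (α - t) ^ 2) = jp α := by
  have e : ∀ t, (1 - t ^ 2) * (1 - (α - t) ^ 2) = ∑ i ∈ Finset.range 5, [1 - α ^ 2, 2 * α, α ^ 2 - 2, -2 * α, 1].getD i 0 * t ^ i := by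
    intro t; simp [Finset.sum_range_succ]; ring
  simp_rw [e]
  rw [poly_int]
  simp [Finset.sum_range_succ, jp]; ring

noncomputable def Sp (u : ℝ) : ℝ := 1 - 0.0507212 * u ^ 2 + 0.0021438 * u ^ 4 - 0.0000885 * u ^ 6

lemma num_int : 203/240 + 1/10^6 ≤ 2 * ∫ u in (0:ℝ)..1, (1.33333092 - u) * (jp u * Sp u) := by
  have e : ∀ t, (1.33333092 - t) * (jp t * Sp t) = ∑ i ∈ Finset.range 13, [2255551473/2000000000,-1914998371/1200000000,-3584610743430819/5000000000000000,5659489378437913/3000000000000000,-18923614514146379/30000000000000000,-167334445715353/1200000000000000,787600209078581/12000000000000000,125324983120841/20000000000000000,-1836912867469/600000000000000,-318839189779/1250000000000000,6523/50000000,1966663107/500000000000000,-59/20000000].getD i 0 * t ^ i := by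
    intro t; simp [Finset.sum_range_succ, jp, Sp]; ring
  simp_rw [e]
  rw [poly_int]
  simp only [Finset.sum_range_succ, Finset.sum_range_zero, List.getD_cons_zero, List.getD_cons_succ]
  norm_num

lemma sech_lower {u : ℝ} (h0 : 0 ≤ u) (h1 : u ≤ 1) : Sp u ≤ 1 / Real.cosh (0.3185 * u) := by
  rw [le_div_iff₀ (Real.cosh_pos _)]
  set x := 0.3185 * u with hx
  have hx0 : 0 ≤ x := by positivity
  have hx1 : x ≤ 1 := by linarith
  have b1 := (abs_le.1 (Real.exp_bound (x := x) (by rw [abs_of_nonneg hx0]; exact hx1) (n := 8) (by norm_num))).2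
  have b2 := (abs_le.1 (Real.exp_bound (x := -x) (by rw [abs_neg, abs_of_nonneg hx0]; exact hx1) (n := 8) (by norm_num))).2
  rw [abs_neg] at b2
  rw [abs_of_nonneg hx0] at b1 b2
  simp only [Finset.sum_range_succ, Finset.sum_range_zero] at b1 b2
  norm_num [Nat.factorial] at b1 b2
  have hc : Real.cosh x ≤ 1 + x ^ 2 / 2 + x ^ 4 / 24 + x ^ 6 / 720 + x ^ 8 / 35840 := by
    rw [Real.cosh_eq]; nlinarith
  have hy : 0 ≤ u ^ 2 := by positivity
  have hy1 : u ^ 2 ≤ 1 := by nlinarith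
  have hS : 0 ≤ Sp u := by
    unfold Sp
    have : u ^ 6 ≤ 1 := pow_le_one₀ h0 h1
    have : 0 ≤ u ^ 4 := by positivity
    linarith
  refine (mul_le_mul_of_nonneg_left hc hS).trans ?_
  unfold Sp
  rw [hx]
  generalize hyu : u ^ 2 = y at *
  have e4 : u ^ 4 = y ^ 2 := by rw [← hyu]; ring
  have e6 : u ^ 6 = y ^ 3 := by rw [← hyu]; ring
  have e8 : u ^ 8 = y ^ 4 := by rw [← hyu]; ring
  simp only [mul_pow, e4, e6, e8, hyu]
  have p2 : 0 ≤ y ^ 2 := by positivity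
  have p3 : 0 ≤ y ^ 3 := by positivity
  have p4 : 0 ≤ y ^ 4 := by positivity
  have q2 : y ^ 2 ≤ y := by nlinarith
  have q3 : y ^ 3 ≤ y ^ 2 := by nlinarith
  have q4 : y ^ 4 ≤ y ^ 3 := by nlinarith
  have q5 : y ^ 5 ≤ y ^ 4 := by nlinarith
  have q6 : y ^ 6 ≤ y ^ 5 := by nlinarith
  have q7 : y ^ 7 ≤ y ^ 6 := by nlinarith
  have p5 : 0 ≤ y ^ 5 := by positivity
  have p6 : 0 ≤ y ^ 6 := by positivity
  have p7 : 0 ≤ y ^ 7 := by positivity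
  ring_nf
  linarith


lemma bumpx {a c : ℝ} (ha : 0 < a) (hac : a < c) : ∃ χ : ℝ → ℝ, TF χ ∧ (∀ u, χ (-u) = χ u) ∧ (∀ u, 0 ≤ χ u) ∧ (∀ u, χ u ≤ 1) ∧
    (∀ u, |u| ≤ a → χ u = 1) ∧ ∀ u, c < |u| → χ u = 0 := by
  let f : ContDiffBump (0:ℝ) := ⟨a, c, ha, hac⟩
  exact ⟨f, ⟨f.contDiff, f.hasCompactSupport⟩, f.neg, fun u => f.nonneg, fun u => f.le_one,
    fun u hu => f.one_of_mem_closedBall (by simpa using hu), fun u hu => f.zero_of_le_dist (by simpa using hu.le)⟩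

lemma jj_bounds {χ : ℝ → ℝ} (hχ : TF χ) (h0 : ∀ u, 0 ≤ χ u) (h1 : ∀ u, χ u ≤ 1) {δ : ℝ} (hδ0 : 0 < δ) (hδ : δ < 1/4)
    (hone : ∀ u, |u| ≤ 1/2 - 2 * δ → χ u = 1) (hz : ∀ u, 1/2 - δ < |u| → χ u = 0) {α : ℝ} (hα0 : 0 ≤ α) (hα1 : α ≤ 1) :
    jp α - 8 * δ ≤ jj (fun x => χ x * (1 - x ^ 2)) α ∧ jj (fun x => χ x * (1 - x ^ 2)) α ≤ jp α := by
  have hc := hχ.cont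
  have hle : α - 1/2 ≤ 1/2 := by linarith
  have e : jj (fun x => χ x * (1 - x ^ 2)) α = ∫ t in (α - 1/2)..(1/2), (χ t * (1 - t ^ 2)) * (χ (α - t) * (1 - (α - t) ^ 2)) := by
    rw [jj, intervalIntegral.integral_of_le hle, setIntegral_eq_integral_of_forall_compl_eq_zero]
    intro t ht
    rw [mem_Ioc, not_and_or, not_lt, not_le] at ht
    rcases ht with ht | ht
    · rw [hz (α - t) (by rw [abs_of_nonneg] <;> linarith)]; ring
    · rw [hz t (by rw [abs_of_nonneg] <;> linarith)]; ring
  have pt : ∀ t ∈ Icc (α - 1/2) (1/2), 0 ≤ 1 - t ^ 2 ∧ 1 - t ^ 2 ≤ 1 ∧ 0 ≤ 1 - (α - t) ^ 2 ∧ 1 - (α - t) ^ 2 ≤ 1 := by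
    rintro t ⟨ht1, ht2⟩
    refine ⟨by nlinarith, by nlinarith, by nlinarith, by nlinarith⟩
  have D : ∫ t in (α - 1/2)..(1/2), (1 - χ t) ≤ 4 * δ := by
    have c : Continuous fun t => 1 - χ t := by fun_prop
    have s1 : ∫ t in (α - 1/2)..(1/2), (1 - χ t) ≤ ∫ t in (-(1/2:ℝ))..(1/2), (1 - χ t) :=
      intervalIntegral.integral_mono_interval (by linarith) hle le_rfl (Eventually.of_forall fun t => sub_nonneg.2 (h1 t)) (c.intervalIntegrable _ _)
    have s2 : ∫ t in (-(1/2:ℝ))..(1/2), χ t ≥ 1 - 4 * δ := by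
      have m := intervalIntegral.integral_mono_interval (f := χ) (μ := volume) (c := -(1/2:ℝ)) (d := 1/2) (a := -(1/2 - 2 * δ)) (b := 1/2 - 2 * δ)
        (by linarith) (by linarith) (by linarith) (Eventually.of_forall h0) (hc.intervalIntegrable _ _)
      have e2 : ∫ t in (-(1/2 - 2 * δ))..(1/2 - 2 * δ), χ t = ∫ t in (-(1/2 - 2 * δ))..(1/2 - 2 * δ), (1:ℝ) := by
        refine intervalIntegral.integral_congr fun t ht => ?_
        rw [uIcc_of_le (by linarith)] at ht
        exact hone t (abs_le.2 ht)
      rw [e2] at m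
      simp only [intervalIntegral.integral_const, smul_eq_mul] at m
      linarith
    rw [intervalIntegral.integral_sub (by simp) (hc.intervalIntegrable _ _)] at s1
    simp only [intervalIntegral.integral_const, smul_eq_mul] at s1
    rw [intervalIntegral.integral_sub (by simp) (hc.intervalIntegrable _ _)]
    simp only [intervalIntegral.integral_const, smul_eq_mul]
    rw [intervalIntegral.integral_sub (by simp) (hc.intervalIntegrable _ _)] at s1
    simp only [intervalIntegral.integral_const, smul_eq_mul] at s1
    linarith
  have D' : ∫ t in (α - 1/2)..(1/2), (1 - χ (α - t)) ≤ 4 * δ := by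
    rw [intervalIntegral.integral_comp_sub_left (fun t => 1 - χ t)]
    convert D using 2 <;> ring
  have c0 : Continuous fun t => (1 - t ^ 2) * (1 - (α - t) ^ 2) := by fun_prop
  have c1 : Continuous fun t => (χ t * (1 - t ^ 2)) * (χ (α - t) * (1 - (α - t) ^ 2)) := by fun_prop
  have c2 : Continuous fun t => 1 - χ t := by fun_prop
  have c3 : Continuous fun t => 1 - χ (α - t) := by fun_prop
  have c4 : Continuous fun t => (1 - χ t) + (1 - χ (α - t)) := by fun_prop
  have c5 : Continuous fun t => (1 - t ^ 2) * (1 - (α - t) ^ 2) - ((1 - χ t) + (1 - χ (α - t))) := by fun_prop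
  rw [e, ← jp_eq]
  constructor
  · have m := intervalIntegral.integral_mono_on hle (c5.intervalIntegrable _ _) (c1.intervalIntegrable (α - 1/2) (1/2)) (μ := volume) (by
      intro t ht
      obtain ⟨p1, p2, p3, p4⟩ := pt t ht
      have x0 := h0 t
      have x1 := h1 t
      have y0 := h0 (α - t)
      have y1 := h1 (α - t)
      have a1 : (1 - t ^ 2) * (1 - (α - t) ^ 2) ≤ 1 := mul_le_one₀ p2 p3 p4
      have a0 := mul_nonneg p1 p3
      have a2 : 0 ≤ (1 - χ t) * (1 - χ (α - t)) := mul_nonneg (by linarith) (by linarith)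
      have a3 : 1 - χ t * χ (α - t) ≤ (1 - χ t) + (1 - χ (α - t)) := by nlinarith
      have a4 : 0 ≤ 1 - χ t * χ (α - t) := sub_nonneg.2 (mul_le_one₀ x1 y0 y1)
      nlinarith)
    rw [intervalIntegral.integral_sub (c0.intervalIntegrable _ _) (c4.intervalIntegrable _ _),
      intervalIntegral.integral_add (c2.intervalIntegrable _ _) (c3.intervalIntegrable _ _)] at m
    linarith
  · refine intervalIntegral.integral_mono_on hle (c1.intervalIntegrable _ _) (c0.intervalIntegrable _ _) fun t ht => ?_
    obtain ⟨p1, p2, p3, p4⟩ := pt t ht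
    gcongr
    · exact mul_nonneg (h0 _) p3
    · exact mul_le_of_le_one_left p1 (h1 _)
    · exact mul_le_of_le_one_left p3 (h1 _)

theorem simple_bound_b_point3185
    (hbox : ∀ᶠ T in atTop, ∀ ρ ∈ zeroBand T, |ρ.re - 1/2| < 0.3185 / (2 * Real.log T)) :
    ∃ ε : ℝ → ℝ, Tendsto ε atTop (nhds 0) ∧
      ∀ᶠ T in atTop, (0.66666908 + ε T) * (T / (2 * Real.pi)) * Real.log T ≤ Nsimple T := by
  obtain ⟨δ, hδ⟩ : ∃ δ : ℝ, δ = 1 / 10 ^ 8 := ⟨_, rfl⟩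
  obtain ⟨χ, hχ, che, ch0, ch1, chone, chz⟩ := bumpx (a := 1/2 - 2 * δ) (c := 1/2 - δ) (by rw [hδ]; norm_num) (by rw [hδ]; norm_num)
  obtain ⟨r2, hr2, e2, -, -, r2one, r2z⟩ := bumpx (a := 1 - 2 * δ) (c := 1 - δ) (by rw [hδ]; norm_num) (by rw [hδ]; norm_num)
  set h : ℝ → ℝ := fun x => χ x * (1 - x ^ 2) with hh
  have hTF : TF h := ⟨hχ.smooth.mul (by fun_prop), hχ.cpt.mul_right⟩
  have he : ∀ u, h (-u) = h u := fun u => by simp [hh, che]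
  have hd0 : 0 < δ := by rw [hδ]; norm_num
  have hd1 : δ < 1 / 4 := by rw [hδ]; norm_num
  have hsup : ∀ u, 1/2 - δ < |u| → h u = 0 := fun u hu => by simp [hh, chz u hu]
  have hnn : ∀ u, 0 ≤ h u := by
    intro u
    rcases le_or_gt |u| 1 with h1 | h1
    · exact mul_nonneg (ch0 u) (sub_nonneg.2 ((sq_le_one_iff_abs_le_one u).2 h1))
    · rw [hsup u (by linarith)]
  have jb := fun (α : ℝ) => jj_bounds (α := α) hχ ch0 ch1 hd0 hd1 chone chz
  set r1 := rk h 0.3185 with hr1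
  have r1TF : TF r1 := rk_TF hTF _
  have jnn : ∀ u, 0 ≤ jj h u := fun u => integral_nonneg fun t => mul_nonneg (hnn _) (hnn _)
  have r1nn : ∀ u, 0 ≤ r1 u := fun u => div_nonneg (jnn u) (Real.cosh_pos _).le
  have r1s : ∀ u, 1 - 2 * δ < |u| → r1 u = 0 := fun u hu => by
    rw [hr1, rk, jj_supp hsup u (by linarith), zero_div]
  have r10 : r1 0 = jj h 0 := by simp [hr1, rk]
  have cr := r1TF.cont
  have hint : ∫ u, r1 u = 2 * ∫ u in (0:ℝ)..1, r1 u := by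
    have s : ∫ u, r1 u = ∫ u in (-1:ℝ)..1, r1 u := by
      rw [intervalIntegral.integral_of_le (by norm_num), setIntegral_eq_integral_of_forall_compl_eq_zero]
      intro u hu
      rcases le_or_gt |u| (1 - 2 * δ) with h1 | h1
      · exact absurd ⟨by linarith [(abs_le.1 h1).1], by linarith [(abs_le.1 h1).2]⟩ hu
      · exact r1s u h1
    have n : ∫ u in (-1:ℝ)..0, r1 u = ∫ u in (0:ℝ)..1, r1 u := by
      have := intervalIntegral.integral_comp_neg (a := 0) (b := 1) r1
      simp only [hr1, rk_even he, neg_zero] at this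
      exact this.symm
    rw [s, ← intervalIntegral.integral_add_adjacent_intervals (cr.intervalIntegrable (-1) 0) (cr.intervalIntegrable 0 1), n]; ring
  have cj : Continuous jp := by unfold jp; fun_prop
  have cS : Continuous Sp := by unfold Sp; fun_prop
  have low : 2 * (∫ u in (0:ℝ)..1, (1.33333092 - u) * (jp u * Sp u)) - 32 * δ ≤ 2 * ∫ u in (0:ℝ)..1, (1.33333092 - u) * r1 u := by
    have m := intervalIntegral.integral_mono_on (a := 0) (b := 1) (μ := volume) zero_le_one
      ((by fun_prop : Continuous fun u : ℝ => (1.33333092 - u) * (jp u * Sp u) - 16 * δ).intervalIntegrable _ _)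
      ((by fun_prop : Continuous fun u : ℝ => (1.33333092 - u) * r1 u).intervalIntegrable _ _) (by
      rintro u ⟨hu0, hu1⟩
      obtain ⟨b1, b2⟩ := jb u hu0 hu1
      have hj : 0 ≤ jp u := (jnn u).trans b2
      have s := sech_lower hu0 hu1
      have c1 : 1 / Real.cosh (0.3185 * u) ≤ 1 := (div_le_one (Real.cosh_pos _)).2 (Real.one_le_cosh _)
      have er : r1 u = jj h u * (1 / Real.cosh (0.3185 * u)) := by simp [hr1, rk, div_eq_mul_inv]
      have c0 : 0 ≤ 1 / Real.cosh (0.3185 * u) := by have := Real.cosh_pos (0.3185 * u); positivity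
      generalize 1 / Real.cosh (0.3185 * u) = c at *
      have k1 : jp u * Sp u - 8 * δ ≤ r1 u := by
        rw [er]
        calc jp u * Sp u - 8 * δ ≤ jp u * c - 8 * δ * c := by nlinarith
          _ = (jp u - 8 * δ) * c := by ring
          _ ≤ _ := by gcongr
      have k2 : 0 ≤ 1.33333092 - u := by linarith
      nlinarith)
    rw [intervalIntegral.integral_sub ((by fun_prop : Continuous fun u : ℝ => (1.33333092 - u) * (jp u * Sp u)).intervalIntegrable _ _) (by simp)] at m
    simp only [intervalIntegral.integral_const, smul_eq_mul] at m
    linarith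
  have hκ : r1 0 + 2 * (∫ u in (0:ℝ)..1, u * r1 u) ≤ 1.33333092 * ∫ u, r1 u := by
    have ee : ∫ u in (0:ℝ)..1, (1.33333092 - u) * r1 u = 1.33333092 * (∫ u in (0:ℝ)..1, r1 u) - ∫ u in (0:ℝ)..1, u * r1 u := by
      rw [← intervalIntegral.integral_const_mul, ← intervalIntegral.integral_sub
        ((by fun_prop : Continuous fun u : ℝ => 1.33333092 * r1 u).intervalIntegrable _ _) ((by fun_prop : Continuous fun u : ℝ => u * r1 u).intervalIntegrable _ _)]
      congr 1; ext u; ring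
    have b2 := (jb 0 le_rfl zero_le_one).2
    have n := num_int
    rw [ee] at low
    have jp0 : jp 0 = 203 / 240 := by simp [jp]
    rw [jp0] at b2
    rw [hint, r10]
    have : 32 * δ ≤ 1 / 10 ^ 6 := by rw [hδ]; norm_num
    linarith
  have hq : 0 < ∫ u, r1 u := by
    have b1 := (jb 0 le_rfl zero_le_one).1
    have jp0 : jp 0 = 203 / 240 := by simp [jp]
    rw [jp0] at b1
    have : 0 ≤ ∫ u in (0:ℝ)..1, u * r1 u := intervalIntegral.integral_nonneg zero_le_one fun u hu => mul_nonneg hu.1 (r1nn u)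
    rw [r10] at hκ
    have : (0:ℝ) < 203 / 240 - 8 * δ := by linarith
    have : jj h 0 = jj (fun x => χ x * (1 - x ^ 2)) 0 := rfl
    nlinarith
  refine final_of_kernel (A := 1 - δ) r1TF hr2 (rk_even he _) e2 r1nn (by linarith) (by linarith) (fun u hu => r1s u (by linarith)) r2z
    (r2one 0 (by rw [abs_zero]; linarith)) (fun u => ?_) (fun w hw => rk_pos hTF he (by norm_num) w hw) hq hκ hbox
  rcases le_or_gt |u| (1 - 2 * δ) with h1 | h1
  · rw [r2one u h1, mul_one]
  · rw [r1s u h1, zero_mul]
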